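/- arXiv:2605.05189 — 4 statements merged into one kernel-verified Lean document; each statement's English description precedes it below -/
import Mathlib

section
/- For every ε > 0 there exists a constant c > 0 such that for all sufficiently large d the following holds: if n ≥ (π/4 + ε)·d²/log d and u_1,…,u_n, v_1,…,v_n ∈ ℝ^d are mutually independent N(0, I_d/d) vectors, then with probability at least 1 − e^{−c d} there exists no matrix W ∈ ℝ^{d×d} satisfying u_i^⊤ W v_i > u_j^⊤ W v_i for all i ∈ {1,…,n} and all j ≠ i. -/
open MeasureTheory ProbabilityTheory Filter Topology Matrix

noncomputable section

/-- The law `N(0, I_d/d)` on `ℝ^d`. -/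
def stdGaussianVec (d : ℕ) : Measure (Fin d → ℝ) :=
  Measure.pi fun _ => gaussianReal 0 (d : NNReal)⁻¹

/-- The Gaussian model: `u_1, …, u_n, v_1, …, v_n` mutually independent `N(0, I_d/d)`. -/
def gaussianModel (d n : ℕ) :
    Measure ((Fin n → Fin d → ℝ) × (Fin n → Fin d → ℝ)) :=
  (Measure.pi fun _ : Fin n => stdGaussianVec d).prod
    (Measure.pi fun _ : Fin n => stdGaussianVec d)

/-- The score `s_{j,i}(W) = u_j^⊤ W v_i`. -/
def score {d n : ℕ} (u v : Fin n → Fin d → ℝ) (W : Matrix (Fin d) (Fin d) ℝ)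
    (j i : Fin n) : ℝ :=
  u j ⬝ᵥ W.mulVec (v i)

/-- The event that some `W` achieves top-1 retrieval. -/
def PRset (d n : ℕ) : Set ((Fin n → Fin d → ℝ) × (Fin n → Fin d → ℝ)) :=
  {p | ∃ W : Matrix (Fin d) (Fin d) ℝ,
    ∀ i j : Fin n, j ≠ i → score p.1 p.2 W j i < score p.1 p.2 W i i}

lemma aux_lintegral_pi_prod {ι α : Type*} [Fintype ι] [MeasurableSpace α] (P : Measure α)
    [IsProbabilityMeasure P] (f : α → ENNReal) (hf : Measurable f) :
    ∫⁻ x, ∏ i, f (x i) ∂(Measure.pi fun _ : ι => P) = (∫⁻ x, f x ∂P) ^ Fintype.card ι := by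
  rw [lintegral_prod_eq_prod_lintegral_of_indepFun Finset.univ (fun i (x : ι → α) => f (x i))
    (iIndepFun_pi (fun i => hf.aemeasurable)) (fun i => hf.comp (measurable_pi_apply i))]
  have : ∀ i : ι, ∫⁻ x : ι → α, f (x i) ∂(Measure.pi fun _ : ι => P) = ∫⁻ x, f x ∂P := by
    intro i
    exact (measurePreserving_eval (fun _ : ι => P) i).lintegral_comp hf
  simp [this]

lemma aux_swap {ι κ : Type*} [Fintype ι] [Fintype κ] (P : Measure ℝ)
    [IsProbabilityMeasure P] (F : (κ → ι → ℝ) → ENNReal) (hF : Measurable F) :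
    ∫⁻ x, F (fun k i => x i k) ∂(Measure.pi fun _ : ι => Measure.pi fun _ : κ => P)
      = ∫⁻ y, F y ∂(Measure.pi fun _ : κ => Measure.pi fun _ : ι => P) := by
  have h1 : (Measure.pi fun _ : ι × κ => P) =
      (Measure.pi fun _ : ι => Measure.pi fun _ : κ => P).map (fun x (p : ι × κ) => x p.1 p.2) := by
    apply Measure.pi_eq
    intro s hs
    rw [Measure.map_apply (by fun_prop) (MeasurableSet.univ_pi hs)]
    have : (fun (x : ι → κ → ℝ) (p : ι × κ) => x p.1 p.2) ⁻¹' (Set.univ.pi s)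
        = Set.univ.pi (fun i => Set.univ.pi (fun k => s (i, k))) := by
      ext x; simp
    rw [this, Measure.pi_pi]
    simp_rw [Measure.pi_pi]
    rw [Fintype.prod_prod_type]
  have h2 : (Measure.pi fun _ : ι × κ => P) =
      (Measure.pi fun _ : κ => Measure.pi fun _ : ι => P).map (fun x (p : ι × κ) => x p.2 p.1) := by
    apply Measure.pi_eq
    intro s hs
    rw [Measure.map_apply (by fun_prop) (MeasurableSet.univ_pi hs)]
    have : (fun (x : κ → ι → ℝ) (p : ι × κ) => x p.2 p.1) ⁻¹' (Set.univ.pi s)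
        = Set.univ.pi (fun k => Set.univ.pi (fun i => s (i, k))) := by
      ext x; simp; exact forall_comm
    rw [this, Measure.pi_pi]
    simp_rw [Measure.pi_pi]
    rw [Fintype.prod_prod_type_right]
  have h3 := h1.symm.trans h2
  have hG : Measurable (fun (z : ι × κ → ℝ) => F (fun k i => z (i, k))) :=
    hF.comp (by fun_prop)
  have e1 := lintegral_map (μ := Measure.pi fun _ : ι => Measure.pi fun _ : κ => P) hG
    (g := fun x (p : ι × κ) => x p.1 p.2) (by fun_prop)
  have e2 := lintegral_map (μ := Measure.pi fun _ : κ => Measure.pi fun _ : ι => P) hG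
    (g := fun x (p : ι × κ) => x p.2 p.1) (by fun_prop)
  rw [h3] at e1
  exact e1.symm.trans e2

lemma aux_map_lin {ι : Type*} [Fintype ι] (v : NNReal) (c : ι → ℝ) (r : ℝ)
    (hr : r ^ 2 = (∑ k, c k ^ 2) * v) :
    (Measure.pi fun _ : ι => gaussianReal 0 v).map (fun x => ∑ k, c k * x k)
      = (gaussianReal 0 1).map (fun y => r * y) := by
  have hm : Measurable (fun x : ι → ℝ => ∑ k, c k * x k) := by fun_prop
  have : IsProbabilityMeasure ((Measure.pi fun _ : ι => gaussianReal 0 v).map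
    (fun x => ∑ k, c k * x k)) := Measure.isProbabilityMeasure_map hm.aemeasurable
  rw [gaussianReal_map_const_mul]
  apply Measure.ext_of_charFun
  ext t
  rw [charFun_gaussianReal, charFun_apply_real, integral_map hm.aemeasurable (by fun_prop)]
  have h1 : ∀ x : ι → ℝ, Complex.exp (↑t * ↑(∑ k, c k * x k) * Complex.I)
      = ∏ k, Complex.exp (↑(t * c k) * ↑(x k) * Complex.I) := by
    intro x
    rw [← Complex.exp_sum]
    congr 1
    push_cast
    rw [Finset.mul_sum, Finset.sum_mul]
    exact Finset.sum_congr rfl fun k _ => by ring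
  simp_rw [h1]
  rw [integral_fintype_prod_eq_prod (fun k (x : ℝ) => Complex.exp (↑(t * c k) * ↑x * Complex.I))]
  simp_rw [← charFun_apply_real, charFun_gaussianReal]
  rw [← Complex.exp_sum]
  congr 1
  have hr' : (r : ℂ) ^ 2 = (∑ k, (c k : ℂ) ^ 2) * ((v : ℝ) : ℂ) := by exact_mod_cast congrArg (fun x : ℝ => (x : ℂ)) hr
  simp [hr', Finset.sum_mul, Finset.sum_div]
  exact Finset.sum_congr rfl fun k _ => by ring

lemma aux_lint_lin {ι : Type*} [Fintype ι] (v : NNReal) (c : ι → ℝ) (r : ℝ)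
    (hr : r ^ 2 = (∑ k, c k ^ 2) * v) (F : ℝ → ENNReal) (hF : Measurable F) :
    ∫⁻ x, F (∑ k, c k * x k) ∂(Measure.pi fun _ : ι => gaussianReal 0 v)
      = ∫⁻ y, F (r * y) ∂(gaussianReal 0 1) := by
  rw [← lintegral_map hF (by fun_prop : Measurable (fun x : ι → ℝ => ∑ k, c k * x k)),
    aux_map_lin v c r hr, lintegral_map hF (by fun_prop)]

lemma aux_pdf (x : ℝ) : gaussianPDFReal 0 1 x = (√(2 * Real.pi))⁻¹ * Real.exp (-(1/2) * x ^ 2) := by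
  simp only [gaussianPDFReal]
  congr 2
  · simp
  · simp; ring

lemma aux_lint_exp_sq (θ : ℝ) (hθ : θ < 1 / 2) :
    ∫⁻ x, ENNReal.ofReal (Real.exp (θ * x ^ 2)) ∂(gaussianReal 0 1)
      = ENNReal.ofReal ((√(1 - 2 * θ))⁻¹) := by
  rw [gaussianReal_of_var_ne_zero 0 one_ne_zero,
    lintegral_withDensity_eq_lintegral_mul _ (measurable_gaussianPDF 0 1) (by fun_prop)]
  have h : ∀ x, (gaussianPDF 0 1 * fun x => ENNReal.ofReal (Real.exp (θ * x ^ 2))) x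
      = ENNReal.ofReal ((√(2 * Real.pi))⁻¹ * Real.exp (-(1/2 - θ) * x ^ 2)) := by
    intro x
    simp only [Pi.mul_apply, gaussianPDF, aux_pdf]
    rw [← ENNReal.ofReal_mul (by positivity), mul_assoc, ← Real.exp_add]
    congr 3; ring
  simp_rw [h]
  rw [← ofReal_integral_eq_lintegral_ofReal]
  · rw [integral_const_mul, integral_gaussian]
    congr 1
    rw [← Real.sqrt_inv, ← Real.sqrt_mul (by positivity), ← Real.sqrt_inv]
    congr 1
    have : (1 / 2 - θ) ≠ 0 := by linarith
    have : (1 - 2 * θ) ≠ 0 := by linarith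
    have := Real.pi_ne_zero
    field_simp
  · exact (integrable_exp_neg_mul_sq (by linarith)).const_mul _
  · exact Filter.Eventually.of_forall fun x => by positivity

lemma aux_int_abs : ∫ x, |x| ∂(gaussianReal 0 1) = √(2 / Real.pi) := by
  rw [integral_gaussianReal_eq_integral_smul one_ne_zero]
  simp_rw [aux_pdf, smul_eq_mul]
  have h := integral_comp_abs (f := fun x : ℝ => (√(2 * Real.pi))⁻¹ * Real.exp (-(1/2) * x ^ 2) * x)
  simp only [sq_abs] at h
  rw [h]
  have h2 := integral_rpow_mul_exp_neg_mul_rpow (p := 2) (q := 1) (b := 1/2) (by norm_num) (by norm_num) (by norm_num)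
  have h3 : ∫ x in Set.Ioi (0:ℝ), (√(2 * Real.pi))⁻¹ * Real.exp (-(1/2) * x ^ 2) * x
      = (√(2 * Real.pi))⁻¹ * ∫ x in Set.Ioi (0:ℝ), x ^ (1:ℝ) * Real.exp (-(1/2) * x ^ (2:ℝ)) := by
    rw [← integral_const_mul]
    congr 1; ext x
    rw [Real.rpow_one, Real.rpow_two]; ring
  rw [h3, h2]
  norm_num
  have := Real.pi_pos
  have e2 : √2 * √2 = 2 := Real.mul_self_sqrt (by norm_num)
  field_simp
  nlinarith

lemma aux_int_sq : ∫ x, x ^ 2 ∂(gaussianReal 0 1) = 1 := by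
  have h := variance_fun_id_gaussianReal (μ := 0) (v := 1)
  rw [variance_of_integral_eq_zero (by fun_prop) (by simp)] at h
  simpa using h

lemma aux_exp_neg_le (y : ℝ) (hy : 0 ≤ y) : Real.exp (-y) ≤ 1 - y + y ^ 2 / 2 := by
  have h := Real.quadratic_le_exp_of_nonneg hy
  rw [Real.exp_neg]
  have h1 : (1 - y + y ^ 2 / 2) * (1 + y + y ^ 2 / 2) ≥ 1 := by nlinarith [sq_nonneg (y^2)]
  have h2 : 0 < 1 - y + y ^ 2 / 2 := by nlinarith [sq_nonneg (y-1)]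
  rw [inv_le_comm₀ (Real.exp_pos _) h2]
  refine le_trans ?_ h
  rw [inv_le_iff_one_le_mul₀ h2]; linarith

lemma aux_lint_exp_neg_abs (θ : ℝ) (hθ : 0 ≤ θ) :
    ∫⁻ x, ENNReal.ofReal (Real.exp (-θ * |x|)) ∂(gaussianReal 0 1)
      ≤ ENNReal.ofReal (Real.exp (-θ * √(2 / Real.pi) + θ ^ 2 / 2)) := by
  have i1 : Integrable (fun x : ℝ => |x|) (gaussianReal 0 1) := by
    have := (memLp_id_gaussianReal (μ := 0) (v := 1) 1).integrable (by norm_num)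
    exact this.abs
  have i2 : Integrable (fun x : ℝ => x ^ 2) (gaussianReal 0 1) := by
    exact (memLp_id_gaussianReal (μ := 0) (v := 1) 2).integrable_sq
  have i3 : Integrable (fun x : ℝ => 1 - θ * |x| + θ ^ 2 / 2 * x ^ 2) (gaussianReal 0 1) :=
    ((integrable_const _).sub (i1.const_mul _)).add (i2.const_mul _)
  calc ∫⁻ x, ENNReal.ofReal (Real.exp (-θ * |x|)) ∂(gaussianReal 0 1)
      ≤ ∫⁻ x, ENNReal.ofReal (1 - θ * |x| + θ ^ 2 / 2 * x ^ 2) ∂(gaussianReal 0 1) := by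
        apply lintegral_mono
        intro x
        apply ENNReal.ofReal_le_ofReal
        have := aux_exp_neg_le (θ * |x|) (by positivity)
        rw [mul_pow, sq_abs] at this
        rw [neg_mul]; linarith
    _ = ENNReal.ofReal (∫ x, (1 - θ * |x| + θ ^ 2 / 2 * x ^ 2) ∂(gaussianReal 0 1)) := by
        rw [ofReal_integral_eq_lintegral_ofReal i3]
        refine Filter.Eventually.of_forall fun x => ?_
        have := aux_exp_neg_le (θ * |x|) (by positivity)
        rw [mul_pow, sq_abs] at this
        have := Real.exp_pos (-(θ * |x|))
        simp only [Pi.zero_apply]; linarith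
    _ ≤ _ := by
        apply ENNReal.ofReal_le_ofReal
        have i4 : Integrable (fun x : ℝ => 1 - θ * |x|) (gaussianReal 0 1) :=
          (integrable_const _).sub (i1.const_mul _)
        rw [integral_add i4 (i2.const_mul _),
          integral_sub (integrable_const _) (i1.const_mul _), integral_const_mul, integral_const_mul,
          aux_int_abs, aux_int_sq]
        simp
        have := Real.add_one_le_exp (-(θ * √(2 / Real.pi)) + θ ^ 2 / 2)
        simp at this
        linarith

lemma aux_tail (s : ℝ) (hs : 0 ≤ s) :
    ENNReal.ofReal ((√(2 * Real.pi))⁻¹ * Real.exp (-(1/2) * (s + 1) ^ 2)) ≤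
      gaussianReal 0 1 (Set.Ici s) := by
  rw [gaussianReal_apply 0 one_ne_zero]
  calc _ = ∫⁻ x in Set.Icc s (s+1), ENNReal.ofReal ((√(2 * Real.pi))⁻¹ * Real.exp (-(1/2) * (s + 1) ^ 2)) := by
        simp
    _ ≤ ∫⁻ x in Set.Icc s (s+1), gaussianPDF 0 1 x := by
        apply setLIntegral_mono (measurable_gaussianPDF 0 1)
        intro x hx
        rw [gaussianPDF, aux_pdf]
        apply ENNReal.ofReal_le_ofReal
        gcongr ?_ * Real.exp ?_
        have : x ^ 2 ≤ (s+1)^2 := by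
          have := hx.1; have := hx.2; gcongr; linarith
        linarith
    _ ≤ _ := lintegral_mono_set Set.Icc_subset_Ici_self

lemma aux_chernoff {α : Type*} [MeasurableSpace α] (P : Measure α) (X : α → ℝ) (hX : Measurable X)
    (a : ℝ) (S : Set α) (hS : ∀ x ∈ S, a ≤ X x) :
    P S ≤ ENNReal.ofReal (Real.exp (-a)) * ∫⁻ x, ENNReal.ofReal (Real.exp (X x)) ∂P := by
  have h := mul_meas_ge_le_lintegral (μ := P) (f := fun x => ENNReal.ofReal (Real.exp (X x)))
    (by fun_prop) (ENNReal.ofReal (Real.exp a))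
  have h2 : P S ≤ P {x | ENNReal.ofReal (Real.exp a) ≤ ENNReal.ofReal (Real.exp (X x))} := by
    apply measure_mono
    intro x hx
    exact ENNReal.ofReal_le_ofReal (Real.exp_le_exp.2 (hS x hx))
  calc P S = ENNReal.ofReal (Real.exp (-a)) * (ENNReal.ofReal (Real.exp a) * P S) := by
        rw [← mul_assoc, ← ENNReal.ofReal_mul (by positivity), ← Real.exp_add]; simp
    _ ≤ _ := by gcongr; exact (mul_le_mul_right h2 _).trans h

instance aux_prob (d : ℕ) : IsProbabilityMeasure (stdGaussianVec d) := by
  unfold stdGaussianVec; infer_instance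

lemma aux_exp_sum {ι : Type*} (s : Finset ι) (f : ι → ℝ) :
    ENNReal.ofReal (Real.exp (∑ i ∈ s, f i)) = ∏ i ∈ s, ENNReal.ofReal (Real.exp (f i)) := by
  rw [Real.exp_sum, ENNReal.ofReal_prod_of_nonneg (fun i _ => by positivity)]

/-- the chi-square moment generating bound -/
lemma aux_A_le (θ : ℝ) (h0 : 0 ≤ θ) (h1 : θ ≤ 1 / 4) :
    (√(1 - 2 * θ))⁻¹ ≤ Real.exp (θ + 2 * θ ^ 2) := by
  have hpos : 0 < 1 - 2 * θ := by linarith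
  rw [inv_le_comm₀ (Real.sqrt_pos.2 hpos) (Real.exp_pos _), ← Real.exp_neg]
  apply Real.le_sqrt_of_sq_le
  rw [← Real.exp_nat_mul]
  set x := 2 * θ with hx
  have hq := Real.quadratic_le_exp_of_nonneg (x := x + x ^ 2) (by positivity)
  have e : ((2:ℕ):ℝ) * -(θ + 2 * θ ^ 2) = -(x + x ^ 2) := by rw [hx]; push_cast; ring
  rw [e, Real.exp_neg, inv_le_comm₀ (Real.exp_pos _) hpos]
  refine le_trans ?_ hq
  rw [inv_le_iff_one_le_mul₀ hpos]
  have hx0 : 0 ≤ x := by positivity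
  have hx1 : x ≤ 1 / 2 := by rw [hx]; linarith
  have : (1 + (x + x ^ 2) + (x + x ^ 2) ^ 2 / 2) * (1 - x) - 1
     = x ^ 2 * ((1 - x) * (1 + x) ^ 2 / 2 - x) := by ring
  have h3 : 0 ≤ (1 - x) * (1 + x) ^ 2 / 2 - x := by nlinarith [mul_nonneg hx0 hx0]
  nlinarith [mul_nonneg (sq_nonneg x) h3]

lemma aux_chi (δ : ℝ) (h0 : 0 < δ) (h1 : δ < 1) (N : ℕ) :
    ENNReal.ofReal (Real.exp (-(δ / 4 * (1 + δ) * N))) *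
      (ENNReal.ofReal ((√(1 - 2 * (δ / 4)))⁻¹)) ^ N ≤ ENNReal.ofReal (Real.exp (-(δ ^ 2 / 8 * N))) := by
  rw [← ENNReal.ofReal_pow (by positivity), ← ENNReal.ofReal_mul (by positivity)]
  apply ENNReal.ofReal_le_ofReal
  have := aux_A_le (δ / 4) (by positivity) (by linarith)
  calc _ ≤ Real.exp (-(δ / 4 * (1 + δ) * N)) * (Real.exp (δ / 4 + 2 * (δ / 4) ^ 2)) ^ N := by gcongr
    _ = _ := by rw [← Real.exp_nat_mul, ← Real.exp_add]; congr 1; ring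

lemma aux_lint_scale (v : NNReal) (r : ℝ) (hr : r ^ 2 = v) (F : ℝ → ENNReal) (hF : Measurable F) :
    ∫⁻ x, F x ∂(gaussianReal 0 v) = ∫⁻ y, F (r * y) ∂(gaussianReal 0 1) := by
  rw [← lintegral_map hF (by fun_prop : Measurable (fun y : ℝ => r * y)), gaussianReal_map_const_mul]
  congr 2
  · simp
  · ext; simp [hr]

lemma aux_Ea (d n : ℕ) (hd : 0 < d) (δ : ℝ) (h0 : 0 < δ) (h1 : δ < 1) :
    (Measure.pi fun _ : Fin n => stdGaussianVec d)
      {u | (1 + δ) * n < ∑ i, ∑ k, u i k ^ 2} ≤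
      ENNReal.ofReal (Real.exp (-(δ ^ 2 / 8 * (n * d : ℕ)))) := by
  refine (aux_chernoff _ (fun u : Fin n → Fin d → ℝ => ∑ i, ∑ k, δ / 4 * d * u i k ^ 2) (by fun_prop)
    (δ / 4 * (1 + δ) * (n * d : ℕ)) _ ?_).trans ?_
  · intro u hu
    simp only [Set.mem_ofPred_eq] at hu
    simp_rw [← Finset.mul_sum]
    have hd' : (0:ℝ) < d := by exact_mod_cast hd
    push_cast
    have : 0 < δ / 4 * d := by positivity
    nlinarith
  · refine le_trans (le_of_eq ?_) (aux_chi δ h0 h1 (n * d))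
    congr 1
    simp_rw [aux_exp_sum]
    rw [aux_lintegral_pi_prod (stdGaussianVec d)
      (fun x => ∏ k, ENNReal.ofReal (Real.exp (δ / 4 * d * x k ^ 2))) (by fun_prop)]
    unfold stdGaussianVec
    rw [aux_lintegral_pi_prod (gaussianReal 0 (d : NNReal)⁻¹)
      (fun x => ENNReal.ofReal (Real.exp (δ / 4 * d * x ^ 2))) (by fun_prop)]
    have hd' : (0:ℝ) < d := by exact_mod_cast hd
    have hr : (√(d:ℝ)⁻¹) ^ 2 = (((d:NNReal)⁻¹ : NNReal) : ℝ) := by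
      rw [Real.sq_sqrt (by positivity)]; simp
    rw [aux_lint_scale _ _ hr _ (by fun_prop)]
    have : ∀ y : ℝ, δ / 4 * d * (√(d:ℝ)⁻¹ * y) ^ 2 = δ / 4 * y ^ 2 := by
      intro y; rw [mul_pow, Real.sq_sqrt (by positivity)]; field_simp
    simp_rw [this]
    rw [aux_lint_exp_sq _ (by linarith)]
    simp [← pow_mul, mul_comm]

lemma aux_Eb_one (d n : ℕ) (hd : 0 < d) (δ : ℝ) (h0 : 0 < δ) (h1 : δ < 1) (v : Fin n → Fin d → ℝ)
    (S : ℝ) (hS : S = ∑ i, ∑ l, v i l ^ 2) (hSp : 0 < S) :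
    ∫⁻ x, ENNReal.ofReal (Real.exp (δ / 4 * d / S * ∑ l, (∑ i, x i * v i l) ^ 2))
      ∂(Measure.pi fun _ : Fin n => gaussianReal 0 (d : NNReal)⁻¹) ≤
      ENNReal.ofReal ((√(1 - 2 * (δ / 4)))⁻¹) := by
  have hd' : (0:ℝ) < d := by exact_mod_cast hd
  set A := (√(1 - 2 * (δ / 4)))⁻¹ with hA
  have hA1 : 1 ≤ A := by
    rw [hA, one_le_inv₀ (Real.sqrt_pos.2 (by linarith))]
    exact Real.sqrt_le_iff.2 ⟨by norm_num, by linarith⟩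
  set s : Fin d → ℝ := fun l => ∑ i, v i l ^ 2 with hs
  have hs0 : ∀ l, 0 ≤ s l := fun l => Finset.sum_nonneg fun i _ => sq_nonneg _
  have hSs : S = ∑ l, s l := by rw [hS, Finset.sum_comm]
  have hz : ∀ l, s l = 0 → ∀ i, v i l = 0 := by
    intro l hl i
    have := (Finset.sum_eq_zero_iff_of_nonneg (fun i _ => sq_nonneg (v i l))).1 hl i (Finset.mem_univ i)
    exact pow_eq_zero_iff (two_ne_zero) |>.1 this
  have hpt : ∀ x : Fin n → ℝ,
      ENNReal.ofReal (Real.exp (δ / 4 * d / S * ∑ l, (∑ i, x i * v i l) ^ 2)) ≤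
      ∑ l, ENNReal.ofReal (s l / S) *
        ENNReal.ofReal (Real.exp (δ / 4 * d / s l * (∑ i, v i l * x i) ^ 2)) := by
    intro x
    have hc := convexOn_exp.map_sum_le (t := Finset.univ) (w := fun l => s l / S)
      (p := fun l => δ / 4 * d / s l * (∑ i, v i l * x i) ^ 2)
      (fun l _ => div_nonneg (hs0 l) hSp.le) (by rw [← Finset.sum_div, ← hSs, div_self hSp.ne'])
      (fun _ _ => Set.mem_univ _)
    simp_rw [← ENNReal.ofReal_mul (div_nonneg (hs0 _) hSp.le)]
    rw [← ENNReal.ofReal_sum_of_nonneg (fun l _ => mul_nonneg (div_nonneg (hs0 _) hSp.le) (Real.exp_pos _).le)]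
    apply ENNReal.ofReal_le_ofReal
    simp only [smul_eq_mul] at hc
    refine le_trans (le_of_eq ?_) hc
    congr 1
    rw [Finset.mul_sum]
    refine Finset.sum_congr rfl fun l _ => ?_
    rcases eq_or_ne (s l) 0 with h | h
    · simp [hz l h]
    · simp_rw [mul_comm (v _ l)]
      field_simp
  calc _ ≤ ∫⁻ x, ∑ l, ENNReal.ofReal (s l / S) *
        ENNReal.ofReal (Real.exp (δ / 4 * d / s l * (∑ i, v i l * x i) ^ 2))
          ∂(Measure.pi fun _ : Fin n => gaussianReal 0 (d : NNReal)⁻¹) := lintegral_mono hpt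
    _ = ∑ l, ENNReal.ofReal (s l / S) * ∫⁻ x,
        ENNReal.ofReal (Real.exp (δ / 4 * d / s l * (∑ i, v i l * x i) ^ 2))
          ∂(Measure.pi fun _ : Fin n => gaussianReal 0 (d : NNReal)⁻¹) := by
        rw [lintegral_finsetSum _ (fun l _ => by fun_prop)]
        refine Finset.sum_congr rfl fun l _ => ?_
        rw [lintegral_const_mul _ (by fun_prop)]
    _ ≤ ∑ l, ENNReal.ofReal (s l / S) * ENNReal.ofReal A := by
        gcongr with l _
        have hr : (√(s l / d)) ^ 2 = (∑ i, v i l ^ 2) * (((d:NNReal)⁻¹ : NNReal) : ℝ) := by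
          rw [Real.sq_sqrt (div_nonneg (hs0 l) hd'.le)]; simp [hs]; rfl
        rw [aux_lint_lin _ (fun i => v i l) _ hr
          (fun t => ENNReal.ofReal (Real.exp (δ / 4 * d / s l * t ^ 2))) (by fun_prop)]
        rcases eq_or_ne (s l) 0 with h | h
        · simp [h, hA1]
        · have : ∀ y : ℝ, δ / 4 * d / s l * (√(s l / d) * y) ^ 2 = δ / 4 * y ^ 2 := by
            intro y; rw [mul_pow, Real.sq_sqrt (div_nonneg (hs0 l) hd'.le)]; field_simp
          simp_rw [this]
          rw [aux_lint_exp_sq _ (by linarith)]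
    _ = _ := by
        rw [← Finset.sum_mul, ← ENNReal.ofReal_sum_of_nonneg (fun l _ => div_nonneg (hs0 l) hSp.le),
          ← Finset.sum_div, ← hSs, div_self hSp.ne']
        simp

lemma aux_Eb (d n : ℕ) (hd : 0 < d) (δ : ℝ) (h0 : 0 < δ) (h1 : δ < 1) (v : Fin n → Fin d → ℝ) :
    (Measure.pi fun _ : Fin n => stdGaussianVec d)
      {u | (1 + δ) * ∑ i, ∑ l, v i l ^ 2 < ∑ k, ∑ l, (∑ i, u i k * v i l) ^ 2} ≤
      ENNReal.ofReal (Real.exp (-(δ ^ 2 / 8 * d))) := by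
  have hd' : (0:ℝ) < d := by exact_mod_cast hd
  obtain ⟨S, hS⟩ : ∃ S, S = ∑ i, ∑ l, v i l ^ 2 := ⟨_, rfl⟩
  have hS0 : 0 ≤ S := hS ▸ Finset.sum_nonneg fun i _ => Finset.sum_nonneg fun l _ => sq_nonneg _
  rcases hS0.eq_or_lt with h | hSp
  · have hv : ∀ i l, v i l = 0 := by
      intro i l
      rw [hS] at h
      have h2 := (Finset.sum_eq_zero_iff_of_nonneg (fun i _ =>
        Finset.sum_nonneg fun l _ => sq_nonneg (v i l))).1 h.symm i (Finset.mem_univ i)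
      have h3 := (Finset.sum_eq_zero_iff_of_nonneg (fun l _ => sq_nonneg (v i l))).1 h2 l (Finset.mem_univ l)
      exact pow_eq_zero_iff (two_ne_zero) |>.1 h3
    simp [hv]
  rw [← hS]
  refine (aux_chernoff _ (fun u : Fin n → Fin d → ℝ =>
    ∑ k, δ / 4 * d / S * ∑ l, (∑ i, u i k * v i l) ^ 2) (by fun_prop)
    (δ / 4 * (1 + δ) * d) _ ?_).trans ?_
  · intro u hu
    simp only [Set.mem_ofPred_eq] at hu
    simp_rw [← Finset.mul_sum]
    have : δ / 4 * (1 + δ) * d = δ / 4 * d / S * ((1 + δ) * S) := by field_simp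
    rw [this]
    gcongr
  · refine le_trans ?_ (aux_chi δ h0 h1 d)
    gcongr
    simp_rw [aux_exp_sum]
    unfold stdGaussianVec
    rw [aux_swap (gaussianReal 0 (d : NNReal)⁻¹) (fun y => ∏ k, ENNReal.ofReal (Real.exp
      (δ / 4 * d / S * ∑ l, (∑ i, y k i * v i l) ^ 2))) (by fun_prop)]
    rw [aux_lintegral_pi_prod (Measure.pi fun _ : Fin n => gaussianReal 0 (d : NNReal)⁻¹)
      (fun x => ENNReal.ofReal (Real.exp (δ / 4 * d / S * ∑ l, (∑ i, x i * v i l) ^ 2))) (by fun_prop)]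
    simp only [Fintype.card_fin]
    gcongr
    exact aux_Eb_one d n hd δ h0 h1 v S hS hSp

lemma aux_Ec (d n : ℕ) (z : Fin d → ℝ) (r : ℝ) (hr : 0 < r)
    (hr2 : r ^ 2 = (∑ k, z k ^ 2) * (d:ℝ)⁻¹) (s p : ℝ) (hp0 : 0 ≤ p)
    (hp : ENNReal.ofReal p ≤ gaussianReal 0 1 (Set.Ici s)) :
    (Measure.pi fun _ : Fin n => stdGaussianVec d) {u | ∀ j, ∑ k, z k * u j k < s * r} ≤
      ENNReal.ofReal (Real.exp (-(n * p))) := by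
  have e : {u : Fin n → Fin d → ℝ | ∀ j, ∑ k, z k * u j k < s * r}
      = Set.univ.pi (fun _ => {x | ∑ k, z k * x k < s * r}) := by ext; simp
  rw [e, Measure.pi_pi]
  have h1 : stdGaussianVec d {x | ∑ k, z k * x k < s * r} ≤ ENNReal.ofReal (Real.exp (-p)) := by
    have hm : Measurable (fun x : Fin d → ℝ => ∑ k, z k * x k) := by fun_prop
    have h2 : stdGaussianVec d {x | ∑ k, z k * x k < s * r}
        = (stdGaussianVec d).map (fun x => ∑ k, z k * x k) (Set.Iio (s * r)) := by
      rw [Measure.map_apply hm measurableSet_Iio]; rfl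
    rw [h2]
    unfold stdGaussianVec
    rw [aux_map_lin _ z r (by simpa using hr2), Measure.map_apply (by fun_prop) measurableSet_Iio]
    have h3 : (fun y => r * y) ⁻¹' Set.Iio (s * r) = (Set.Ici s)ᶜ := by
      ext y; simp [mul_comm s r, mul_lt_mul_iff_right₀ hr]
    rw [h3, prob_compl_eq_one_sub measurableSet_Ici]
    calc 1 - gaussianReal 0 1 (Set.Ici s) ≤ 1 - ENNReal.ofReal p := tsub_le_tsub_left hp _
      _ = ENNReal.ofReal (1 - p) := by rw [ENNReal.ofReal_sub _ hp0]; simp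
      _ ≤ _ := ENNReal.ofReal_le_ofReal (by have := Real.add_one_le_exp (-p); linarith)
  calc _ ≤ ∏ _i : Fin n, ENNReal.ofReal (Real.exp (-p)) := Finset.prod_le_prod' fun i _ => h1
    _ = _ := by
      rw [Finset.prod_const, ← ENNReal.ofReal_pow (by positivity), ← Real.exp_nat_mul]
      simp

lemma aux_Ed (d n : ℕ) (z : Fin d → ℝ) (r : ℝ) (hr : 0 < r)
    (hr2 : r ^ 2 = (∑ k, z k ^ 2) * (d:ℝ)⁻¹) (δ : ℝ) (hδ : 0 < δ) :
    (Measure.pi fun _ : Fin n => stdGaussianVec d)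
      {v | ∑ i, |∑ k, z k * v i k| < (1 - δ) * √(2 / Real.pi) * n * r} ≤
      ENNReal.ofReal (Real.exp (-(n * (δ ^ 2 / Real.pi)))) := by
  set m := √(2 / Real.pi) with hm
  have hm0 : 0 ≤ m := Real.sqrt_nonneg _
  have hm2 : m ^ 2 = 2 / Real.pi := Real.sq_sqrt (by positivity)
  set θ := δ * m with hθ
  have hθ0 : 0 ≤ θ := by positivity
  refine (aux_chernoff _ (fun v : Fin n → Fin d → ℝ => ∑ i, (-(θ / r) * |∑ k, z k * v i k|)) (by fun_prop)
    (-θ * ((1 - δ) * m * n)) _ ?_).trans ?_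
  · intro u hu
    simp only [Set.mem_ofPred_eq] at hu
    simp_rw [← Finset.mul_sum]
    have : -θ * ((1 - δ) * m * n) = -(θ / r) * ((1 - δ) * m * n * r) := by field_simp
    rw [this, neg_mul, neg_mul]
    gcongr
  · simp_rw [aux_exp_sum]
    rw [aux_lintegral_pi_prod (stdGaussianVec d)
      (fun x => ENNReal.ofReal (Real.exp (-(θ / r) * |∑ k, z k * x k|))) (by fun_prop)]
    unfold stdGaussianVec
    rw [aux_lint_lin _ z r (by simpa using hr2)
      (fun t => ENNReal.ofReal (Real.exp (-(θ / r) * |t|))) (by fun_prop)]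
    have : ∀ y : ℝ, -(θ / r) * |r * y| = -θ * |y| := by
      intro y; rw [abs_mul, abs_of_pos hr]; field_simp
    simp_rw [this, Fintype.card_fin]
    calc _ ≤ ENNReal.ofReal (Real.exp (-(-θ * ((1 - δ) * m * n)))) *
          (ENNReal.ofReal (Real.exp (-θ * m + θ ^ 2 / 2))) ^ n := by
            gcongr; exact aux_lint_exp_neg_abs θ hθ0
      _ = _ := by
        rw [← ENNReal.ofReal_pow (by positivity), ← ENNReal.ofReal_mul (by positivity),
          ← Real.exp_nat_mul, ← Real.exp_add]
        congr 2
        have : δ ^ 2 / Real.pi = δ ^ 2 * m ^ 2 / 2 := by rw [hm2]; ring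
        rw [this, hθ]; ring

/-- the grid points -/
def auxGrid {d : ℕ} (K : ℕ) (f : Fin d → Fin (2 * K + 1)) : Fin d → ℝ :=
  fun k => ((f k : ℕ) : ℝ) / K - 1

lemma aux_cs {ι : Type*} [Fintype ι] (x y : ι → ℝ) :
    |∑ k, x k * y k| ≤ √(∑ k, x k ^ 2) * √(∑ k, y k ^ 2) := by
  rw [← Real.sqrt_mul (Finset.sum_nonneg fun i _ => sq_nonneg _)]
  exact Real.abs_le_sqrt (Finset.sum_mul_sq_le_sq_mul_sq _ _ _)

lemma aux_round {d : ℕ} (K : ℕ) (hK : 0 < K) (w : Fin d → ℝ) (hw : ∑ k, w k ^ 2 = 1) :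
    ∃ f : Fin d → Fin (2 * K + 1), √(∑ k, (auxGrid K f k - w k) ^ 2) ≤ √d / K ∧
      1 - √d / K ≤ √(∑ k, auxGrid K f k ^ 2) := by
  have hK' : (0:ℝ) < K := by exact_mod_cast hK
  have hwk : ∀ k, |w k| ≤ 1 := by
    intro k
    have : w k ^ 2 ≤ 1 := hw ▸ Finset.single_le_sum (f := fun k => w k ^ 2)
      (fun i _ => sq_nonneg _) (Finset.mem_univ k)
    exact abs_le_one_iff_mul_self_le_one.2 (by nlinarith)
  have hlt : ∀ k, ⌊(w k + 1) * K⌋₊ < 2 * K + 1 := by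
    intro k
    have h := abs_le.1 (hwk k)
    rw [Nat.lt_succ_iff]
    apply Nat.floor_le_of_le
    push_cast
    nlinarith
  let f : Fin d → Fin (2 * K + 1) := fun k => ⟨⌊(w k + 1) * K⌋₊, hlt k⟩
  have hf : ∀ k, (auxGrid K f k - w k) ^ 2 ≤ 1 / (K:ℝ) ^ 2 := by
    intro k
    have h := abs_le.1 (hwk k)
    have h1 := Nat.floor_le (show 0 ≤ (w k + 1) * K by apply mul_nonneg <;> linarith)
    have h2 := Nat.lt_floor_add_one ((w k + 1) * K)
    have e : auxGrid K f k - w k = ((⌊(w k + 1) * K⌋₊ : ℝ) - (w k + 1) * K) / K := by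
      simp only [auxGrid, f]; field_simp; ring
    rw [e, div_pow]
    gcongr
    nlinarith
  have hd1 : √(∑ k, (auxGrid K f k - w k) ^ 2) ≤ √d / K := by
    have : ∑ k, (auxGrid K f k - w k) ^ 2 ≤ d / (K:ℝ) ^ 2 := by
      refine (Finset.sum_le_sum fun k _ => hf k).trans ?_
      simp [div_eq_mul_inv]
    refine (Real.sqrt_le_sqrt this).trans ?_
    rw [Real.sqrt_div (by positivity), Real.sqrt_sq hK'.le]
  refine ⟨f, hd1, ?_⟩
  have c1 := aux_cs (auxGrid K f) w
  have c2 := aux_cs (fun k => auxGrid K f k - w k) w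
  rw [hw, Real.sqrt_one, mul_one] at c1 c2
  have e : ∑ k, (auxGrid K f k - w k) * w k = ∑ k, auxGrid K f k * w k - 1 := by
    rw [← hw, ← Finset.sum_sub_distrib]
    exact Finset.sum_congr rfl fun k _ => by ring
  rw [e] at c2
  have := (abs_le.1 c1).2
  have := (abs_le.1 c2).1
  linarith

lemma aux_normalize {d : ℕ} (y : Fin d → ℝ) (h : 0 < √(∑ k, y k ^ 2)) :
    ∑ k, (y k / √(∑ k, y k ^ 2)) ^ 2 = 1 := by
  simp_rw [div_pow]
  rw [← Finset.sum_div, Real.sq_sqrt (Real.sqrt_pos.1 h).le, div_self (Real.sqrt_pos.1 h).ne']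

lemma aux_row_le {d n : ℕ} (u : Fin n → Fin d → ℝ) (R : ℝ) (h : ∑ i, ∑ k, u i k ^ 2 ≤ R) (j : Fin n) :
    √(∑ k, u j k ^ 2) ≤ √R :=
  Real.sqrt_le_sqrt ((Finset.single_le_sum (f := fun i => ∑ k, u i k ^ 2)
    (fun i _ => Finset.sum_nonneg fun k _ => sq_nonneg _) (Finset.mem_univ j)).trans h)

lemma aux_C {d n : ℕ} (hd : 0 < d) (hn : 0 < n) (K : ℕ) (hK : 0 < K) (δ s κ : ℝ) (hδ : 0 < δ) (hδ1 : δ < 1)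
    (hs : 1 ≤ s) (hκ : κ ≤ δ) (hη : √d / K * (1 + √(2 * n * d)) ≤ κ)
    (u : Fin n → Fin d → ℝ) (hu : ∑ i, ∑ k, u i k ^ 2 ≤ 2 * n)
    (hgrid : ∀ f : Fin d → Fin (2 * K + 1), 0 < ∑ k, auxGrid K f k ^ 2 →
      ∃ j, s * (√(∑ k, auxGrid K f k ^ 2) / √d) ≤ ∑ k, auxGrid K f k * u j k)
    (y : Fin d → ℝ) : ∃ j, (1 - δ) * s / √d * √(∑ k, y k ^ 2) ≤ ∑ k, y k * u j k := by
  have hd' : (0:ℝ) < √d := Real.sqrt_pos.2 (by exact_mod_cast hd)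
  have hK' : (0:ℝ) < K := by exact_mod_cast hK
  rcases (Real.sqrt_nonneg (∑ k, y k ^ 2)).eq_or_lt with h0 | hpos
  · refine ⟨⟨0, hn⟩, ?_⟩
    have hz : ∑ k, y k ^ 2 = 0 :=
      le_antisymm (Real.sqrt_eq_zero'.1 h0.symm) (Finset.sum_nonneg fun k _ => sq_nonneg _)
    have hy : ∀ k, y k = 0 := fun k =>
      pow_eq_zero_iff (two_ne_zero) |>.1
        ((Finset.sum_eq_zero_iff_of_nonneg (fun k _ => sq_nonneg (y k))).1 hz k (Finset.mem_univ k))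
    simp [hy]
  set N := √(∑ k, y k ^ 2) with hN
  obtain ⟨f, hf1, hf2⟩ := aux_round K hK (fun k => y k / N) (aux_normalize y hpos)
  set η := √(d:ℝ) / K with hηd
  have hη0 : 0 ≤ η := by positivity
  have hq0 : 0 ≤ √(2 * n * d : ℝ) := Real.sqrt_nonneg _
  have hη1 : η < 1 := by nlinarith
  have hzpos : 0 < ∑ k, auxGrid K f k ^ 2 := Real.sqrt_pos.1 (by linarith)
  obtain ⟨j, hj⟩ := hgrid f hzpos
  refine ⟨j, ?_⟩
  have c := (abs_le.1 (aux_cs (fun k => auxGrid K f k - y k / N) (u j))).2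
  have c' : √(∑ k, (auxGrid K f k - y k / N) ^ 2) * √(∑ k, u j k ^ 2) ≤ η * √(2 * n) := by
    exact mul_le_mul hf1 (aux_row_le u _ hu j) (Real.sqrt_nonneg _) hη0
  have e : ∑ k, (auxGrid K f k - y k / N) * u j k = ∑ k, auxGrid K f k * u j k - (∑ k, y k * u j k) / N := by
    rw [Finset.sum_div, ← Finset.sum_sub_distrib]
    exact Finset.sum_congr rfl fun k _ => by ring
  rw [e] at c
  have h1 : s * ((1 - η) / √d) ≤ s * (√(∑ k, auxGrid K f k ^ 2) / √d) := by gcongr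
  have h2 : (1 - δ) * s / √d ≤ s * ((1 - η) / √d) - η * √(2 * n) := by
    have e2 : √(2 * n * d : ℝ) = √(2 * n) * √d := Real.sqrt_mul (by positivity) _
    have h3 : η * √(2 * n) * √d ≤ s * (δ - η) := by
      have : η + η * √(2 * n) * √d ≤ δ := by rw [e2] at hη; nlinarith
      have h4 : 0 ≤ δ - η := by
        have : 0 ≤ η * √(2 * n : ℝ) * √d := by positivity
        linarith
      nlinarith
    rw [div_le_iff₀ hd']
    have : (s * ((1 - η) / √d) - η * √(2 * n)) * √d = s * (1 - η) - η * √(2 * n) * √d := by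
      field_simp
    rw [this]; linarith
  have h5 : (1 - δ) * s / √d ≤ (∑ k, y k * u j k) / N := by linarith
  rwa [le_div_iff₀ hpos] at h5

lemma aux_D {d n : ℕ} (hd : 0 < d) (K : ℕ) (hK : 0 < K) (δ m : ℝ) (hδ : 0 < δ) (hδ1 : δ < 1)
    (hm0 : 0 < m) (hm1 : m ≤ 1) (hη : √d / K * (1 + √(2 * n * d)) ≤ δ * (1 - δ) * m)
    (v : Fin n → Fin d → ℝ) (hv : ∑ i, ∑ k, v i k ^ 2 ≤ 2 * n)
    (hgrid : ∀ f : Fin d → Fin (2 * K + 1), 0 < ∑ k, auxGrid K f k ^ 2 →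
      (1 - δ) * m * n * (√(∑ k, auxGrid K f k ^ 2) / √d) ≤ ∑ i, |∑ k, auxGrid K f k * v i k|)
    (y : Fin d → ℝ) : (1 - δ) ^ 2 * m * n / √d * √(∑ k, y k ^ 2) ≤ ∑ i, |∑ k, y k * v i k| := by
  have hd' : (0:ℝ) < √d := Real.sqrt_pos.2 (by exact_mod_cast hd)
  have hK' : (0:ℝ) < K := by exact_mod_cast hK
  rcases (Real.sqrt_nonneg (∑ k, y k ^ 2)).eq_or_lt with h0 | hpos
  · rw [← h0, mul_zero]
    exact Finset.sum_nonneg fun i _ => abs_nonneg _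
  set N := √(∑ k, y k ^ 2) with hN
  obtain ⟨f, hf1, hf2⟩ := aux_round K hK (fun k => y k / N) (aux_normalize y hpos)
  set η := √(d:ℝ) / K with hηd
  have hη0 : 0 ≤ η := by positivity
  have hq0 : 0 ≤ √(2 * n * d : ℝ) := Real.sqrt_nonneg _
  have hκ : δ * (1 - δ) * m ≤ δ := by
    have : (1 - δ) * m ≤ 1 := by nlinarith
    nlinarith
  have hη1 : η < 1 := by nlinarith
  have hzpos : 0 < ∑ k, auxGrid K f k ^ 2 := Real.sqrt_pos.1 (by linarith)
  have hj := hgrid f hzpos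
  have hi : ∀ i, |∑ k, auxGrid K f k * v i k| ≤ |∑ k, y k * v i k| / N + η * √(2 * n) := by
    intro i
    have c := aux_cs (fun k => auxGrid K f k - y k / N) (v i)
    have c' : √(∑ k, (auxGrid K f k - y k / N) ^ 2) * √(∑ k, v i k ^ 2) ≤ η * √(2 * n) := by
      exact mul_le_mul hf1 (aux_row_le v _ hv i) (Real.sqrt_nonneg _) hη0
    have e : ∑ k, (auxGrid K f k - y k / N) * v i k = ∑ k, auxGrid K f k * v i k - (∑ k, y k * v i k) / N := by
      rw [Finset.sum_div, ← Finset.sum_sub_distrib]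
      exact Finset.sum_congr rfl fun k _ => by ring
    rw [e] at c
    have t := abs_sub_abs_le_abs_sub (∑ k, auxGrid K f k * v i k) ((∑ k, y k * v i k) / N)
    rw [abs_div, abs_of_pos hpos] at t
    linarith
  have hsum := Finset.sum_le_sum fun i (_ : i ∈ Finset.univ) => hi i
  rw [Finset.sum_add_distrib, ← Finset.sum_div] at hsum
  simp only [Finset.sum_const, Finset.card_univ, Fintype.card_fin, nsmul_eq_mul] at hsum
  have h1 : (1 - δ) * m * n * ((1 - η) / √d) ≤ (1 - δ) * m * n * (√(∑ k, auxGrid K f k ^ 2) / √d) := by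
    have : 0 ≤ (1 - δ) * m * n := mul_nonneg (mul_nonneg (by linarith) hm0.le) (Nat.cast_nonneg n)
    gcongr
  have h2 : (1 - δ) ^ 2 * m * n / √d ≤ (1 - δ) * m * n * ((1 - η) / √d) - n * (η * √(2 * n)) := by
    have e2 : √(2 * n * d : ℝ) = √(2 * n) * √d := Real.sqrt_mul (by positivity) _
    have h3 : η * √(2 * n) * √d ≤ (1 - δ) * m * (δ - η) := by
      have h6 : η + η * √(2 * n) * √d ≤ δ * (1 - δ) * m := by rw [e2] at hη; nlinarith
      have : (1 - δ) * m * η ≤ η := by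
        have : (1 - δ) * m ≤ 1 := by nlinarith
        nlinarith
      nlinarith
    rw [div_le_iff₀ hd']
    have : ((1 - δ) * m * n * ((1 - η) / √d) - n * (η * √(2 * n))) * √d
        = n * ((1 - δ) * m * (1 - η) - η * √(2 * n) * √d) := by
      field_simp
    rw [this]
    have e3 : (1 - δ) ^ 2 * m * n = n * ((1 - δ) ^ 2 * m) := by ring
    rw [e3]
    gcongr
    nlinarith
  have h5 : (1 - δ) ^ 2 * m * n / √d ≤ (∑ i, |∑ k, y k * v i k|) / N := by linarith
  rwa [le_div_iff₀ hpos] at h5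

lemma aux_det {d n : ℕ} (hn : 2 ≤ n) (u v : Fin n → Fin d → ℝ) (τ M : ℝ) (hτ : 0 ≤ τ)
    (hC : ∀ y : Fin d → ℝ, ∃ j, τ * √(∑ k, y k ^ 2) ≤ ∑ k, y k * u j k)
    (hD : ∀ y : Fin d → ℝ, M * √(∑ k, y k ^ 2) ≤ ∑ i, |∑ k, y k * v i k|)
    (W : Matrix (Fin d) (Fin d) ℝ)
    (hW : ∀ i j : Fin n, j ≠ i → score u v W j i < score u v W i i) :
    τ * M ≤ √(∑ k, ∑ l, (∑ i, u i k * v i l) ^ 2) := by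
  set y : Fin n → Fin d → ℝ := fun i k => ∑ l, W k l * v i l with hy
  have hsc : ∀ j i, score u v W j i = ∑ k, y i k * u j k := by
    intro j i
    simp [score, dotProduct, Matrix.mulVec, hy, mul_comm]
  set F := √(∑ k, ∑ l, W k l ^ 2) with hF
  have hFF : F ^ 2 = ∑ k, ∑ l, W k l ^ 2 :=
    Real.sq_sqrt (Finset.sum_nonneg fun _ _ => Finset.sum_nonneg fun _ _ => sq_nonneg _)
  have hFpos : 0 < F := by
    rcases (Real.sqrt_nonneg (∑ k, ∑ l, W k l ^ 2)).eq_or_lt with h | h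
    · exfalso
      rw [← hF] at h
      rw [← h] at hFF
      have hz : ∀ k l, W k l = 0 := by
        intro k l
        have h2 := (Finset.sum_eq_zero_iff_of_nonneg (fun k _ =>
          Finset.sum_nonneg fun l _ => sq_nonneg (W k l))).1 (by rw [← hFF]; simp) k (Finset.mem_univ k)
        have h3 := (Finset.sum_eq_zero_iff_of_nonneg (fun l _ => sq_nonneg (W k l))).1 h2 l (Finset.mem_univ l)
        exact pow_eq_zero_iff (two_ne_zero) |>.1 h3
      have := hW ⟨0, by omega⟩ ⟨1, by omega⟩ (by simp)
      rw [hsc, hsc] at this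
      simp [hy, hz] at this
    · exact h
  set G := √(∑ k, ∑ l, (∑ i, u i k * v i l) ^ 2) with hG
  -- upper bound
  have hup : ∑ i, score u v W i i ≤ F * G := by
    have e : ∑ i, score u v W i i = ∑ p : Fin d × Fin d, W p.1 p.2 * ∑ i, u i p.1 * v i p.2 := by
      rw [Fintype.sum_prod_type]
      simp_rw [hsc, hy, Finset.sum_mul, Finset.mul_sum]
      rw [Finset.sum_comm]
      refine Finset.sum_congr rfl fun k _ => ?_
      rw [Finset.sum_comm]
      refine Finset.sum_congr rfl fun l _ => Finset.sum_congr rfl fun i _ => by ring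
    have c := (abs_le.1 (aux_cs (fun p : Fin d × Fin d => W p.1 p.2)
      (fun p => ∑ i, u i p.1 * v i p.2))).2
    rw [Fintype.sum_prod_type (f := fun p : Fin d × Fin d => W p.1 p.2 ^ 2),
      Fintype.sum_prod_type (f := fun p : Fin d × Fin d => (∑ i, u i p.1 * v i p.2) ^ 2)] at c
    rw [e]; exact c
  have hlow : ∀ i, τ * √(∑ k, y i k ^ 2) ≤ score u v W i i := by
    intro i
    obtain ⟨j, hj⟩ := hC (y i)
    rw [← hsc] at hj
    rcases eq_or_ne j i with h | h
    · rwa [h] at hj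
    · exact hj.trans (hW i j h).le
  have hcs : ∀ i, ∑ k, √(∑ l, W k l ^ 2) * |∑ l, W k l * v i l| ≤ F * √(∑ k, y i k ^ 2) := by
    intro i
    have c := (abs_le.1 (aux_cs (fun k => √(∑ l, W k l ^ 2)) (fun k => |y i k|))).2
    simp only [sq_abs] at c
    have e : ∀ k, √(∑ l, W k l ^ 2) ^ 2 = ∑ l, W k l ^ 2 := fun k =>
      Real.sq_sqrt (Finset.sum_nonneg fun _ _ => sq_nonneg _)
    simp_rw [e] at c
    exact c
  have h1 : M * F ^ 2 ≤ F * ∑ i, √(∑ k, y i k ^ 2) := by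
    rw [Finset.mul_sum]
    refine le_trans ?_ (Finset.sum_le_sum fun i _ => hcs i)
    rw [Finset.sum_comm, hFF, Finset.mul_sum]
    refine Finset.sum_le_sum fun k _ => ?_
    rw [← Finset.mul_sum]
    have := hD (fun l => W k l)
    have e : √(∑ l, W k l ^ 2) * √(∑ l, W k l ^ 2) = ∑ l, W k l ^ 2 :=
      Real.mul_self_sqrt (Finset.sum_nonneg fun _ _ => sq_nonneg _)
    calc M * ∑ l, W k l ^ 2 = √(∑ l, W k l ^ 2) * (M * √(∑ l, W k l ^ 2)) := by
          conv_lhs => rw [← e]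
          ring
      _ ≤ _ := by gcongr
  have h2 : M * F ≤ ∑ i, √(∑ k, y i k ^ 2) := by
    have : F * (M * F) ≤ F * ∑ i, √(∑ k, y i k ^ 2) := by nlinarith
    exact le_of_mul_le_mul_left this hFpos
  have h3 : τ * ∑ i, √(∑ k, y i k ^ 2) ≤ F * G := by
    rw [Finset.mul_sum]
    exact (Finset.sum_le_sum fun i _ => hlow i).trans hup
  have h4 : F * (τ * M) ≤ F * G := by nlinarith [mul_le_mul_of_nonneg_left h2 hτ]
  exact le_of_mul_le_mul_left h4 hFpos

lemma aux_subset {d n : ℕ} (hd : 0 < d) (hn : 2 ≤ n) (K : ℕ) (hK : 0 < K) (δ s m : ℝ) (hδ : 0 < δ)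
    (hδ1 : δ < 1) (hs : 1 ≤ s) (hm0 : 0 < m) (hm1 : m ≤ 1)
    (hη : √d / K * (1 + √(2 * n * d)) ≤ δ * (1 - δ) * m)
    (hfin : (1 + δ) ^ 2 * n < ((1 - δ) ^ 3 * s * m * n / d) ^ 2) :
    PRset d n ⊆ ((({u | (1 + δ) * n < ∑ i, ∑ k, u i k ^ 2} ∪
        ⋃ f : Fin d → Fin (2 * K + 1), {u | 0 < ∑ k, auxGrid K f k ^ 2 ∧
          ∀ j, ∑ k, auxGrid K f k * u j k < s * (√(∑ k, auxGrid K f k ^ 2) / √d)}) ×ˢ Set.univ) ∪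
      (Set.univ ×ˢ ({v | (1 + δ) * n < ∑ i, ∑ k, v i k ^ 2} ∪
        ⋃ f : Fin d → Fin (2 * K + 1), {v | 0 < ∑ k, auxGrid K f k ^ 2 ∧
          ∑ i, |∑ k, auxGrid K f k * v i k| < (1 - δ) * m * n * (√(∑ k, auxGrid K f k ^ 2) / √d)}))) ∪
      {p | (1 + δ) * ∑ i, ∑ l, p.2 i l ^ 2 < ∑ k, ∑ l, (∑ i, p.1 i k * p.2 i l) ^ 2} := by
  rintro ⟨u, v⟩ ⟨W, hW⟩
  by_contra hcon
  simp only [Set.mem_union, Set.mem_prod, Set.mem_univ, and_true, true_and, Set.mem_iUnion,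
    Set.mem_ofPred_eq, not_or, not_exists, not_and, not_lt, not_forall] at hcon
  obtain ⟨⟨⟨ha, hc⟩, ha', hdd⟩, hb⟩ := hcon
  have hn0 : (0:ℝ) ≤ n := Nat.cast_nonneg n
  have hd' : (0:ℝ) < d := by exact_mod_cast hd
  have hκ : δ * (1 - δ) * m ≤ δ := by
    have : (1 - δ) * m ≤ 1 := by nlinarith
    nlinarith
  have hC := aux_C hd (by omega) K hK δ s _ hδ hδ1 hs hκ hη u (by nlinarith) hc
  have hD := aux_D hd K hK δ m hδ hδ1 hm0 hm1 hη v (by nlinarith) hdd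
  have hτ : 0 ≤ (1 - δ) * s / √d := div_nonneg (mul_nonneg (by linarith) (by linarith)) (Real.sqrt_nonneg _)
  have h := aux_det hn u v _ _ hτ hC hD W hW
  have e : (1 - δ) * s / √d * ((1 - δ) ^ 2 * m * n / √d) = (1 - δ) ^ 3 * s * m * n / d := by
    have : √(d:ℝ) * √d = d := Real.mul_self_sqrt hd'.le
    rw [div_mul_div_comm, this]; ring
  rw [e] at h
  have hpos : 0 ≤ (1 - δ) ^ 3 * s * m * n / d := by
    have : 0 ≤ (1 - δ) := by linarith
    positivity
  have h2 := (Real.le_sqrt' (lt_of_le_of_ne hpos (by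
    intro h0
    rw [← h0] at hfin
    have : 0 ≤ (1 + δ) ^ 2 * n := by positivity
    simp at hfin; linarith))).1 h
  have : (1 + δ) * ∑ i, ∑ l, v i l ^ 2 ≤ (1 + δ) * ((1 + δ) * n) := by gcongr
  nlinarith

lemma aux_prob_bound {d n : ℕ} (hd : 0 < d) (hn : 2 ≤ n) (K : ℕ) (hK : 0 < K) (δ s p : ℝ) (hδ : 0 < δ)
    (hδ1 : δ < 1) (hs : 1 ≤ s) (hp0 : 0 ≤ p) (hp : ENNReal.ofReal p ≤ gaussianReal 0 1 (Set.Ici s))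
    (hη : √d / K * (1 + √(2 * n * d)) ≤ δ * (1 - δ) * √(2 / Real.pi))
    (hfin : (1 + δ) ^ 2 * n < ((1 - δ) ^ 3 * s * √(2 / Real.pi) * n / d) ^ 2) :
    gaussianModel d n (PRset d n) ≤
      ENNReal.ofReal (3 * Real.exp (-(δ ^ 2 / 8 * d)) +
        (2 * K + 1) ^ d * (Real.exp (-(n * p)) + Real.exp (-(n * (δ ^ 2 / Real.pi))))) := by
  have hd' : (0:ℝ) < d := by exact_mod_cast hd
  have hm0 : 0 < √(2 / Real.pi) := by positivity
  have hm1 : √(2 / Real.pi) ≤ 1 := by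
    apply Real.sqrt_le_iff.2 ⟨by norm_num, ?_⟩
    rw [div_le_iff₀ Real.pi_pos]; linarith [Real.pi_gt_three]
  refine (measure_mono (aux_subset hd hn K hK δ s _ hδ hδ1 hs hm0 hm1 hη hfin)).trans ?_
  have hr : ∀ z : Fin d → ℝ, (√(∑ k, z k ^ 2) / √d) ^ 2 = (∑ k, z k ^ 2) * (d:ℝ)⁻¹ := by
    intro z
    rw [div_pow, Real.sq_sqrt (Finset.sum_nonneg fun _ _ => sq_nonneg _), Real.sq_sqrt hd'.le]; rfl
  have hEa : (Measure.pi fun _ : Fin n => stdGaussianVec d) {u | (1 + δ) * n < ∑ i, ∑ k, u i k ^ 2}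
      ≤ ENNReal.ofReal (Real.exp (-(δ ^ 2 / 8 * d))) := by
    refine (aux_Ea d n hd δ hδ hδ1).trans (ENNReal.ofReal_le_ofReal (Real.exp_le_exp.2 ?_))
    have : (d:ℝ) ≤ (n * d : ℕ) := by exact_mod_cast Nat.le_mul_of_pos_left d (by omega)
    have : δ ^ 2 / 8 * (d:ℝ) ≤ δ ^ 2 / 8 * (n * d : ℕ) := by gcongr
    linarith
  have hcard : Fintype.card (Fin d → Fin (2 * K + 1)) = (2 * K + 1) ^ d := by simp
  have hun : ∀ (A : (Fin d → Fin (2 * K + 1)) → Set (Fin n → Fin d → ℝ)) (q : ℝ), 0 ≤ q →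
      (∀ f, (Measure.pi fun _ : Fin n => stdGaussianVec d) (A f) ≤ ENNReal.ofReal q) →
      (Measure.pi fun _ : Fin n => stdGaussianVec d) (⋃ f, A f) ≤
        ENNReal.ofReal ((2 * K + 1) ^ d * q) := by
    intro A q hq h
    refine (measure_iUnion_fintype_le _ _).trans ((Finset.sum_le_sum fun f _ => h f).trans ?_)
    rw [Finset.sum_const, Finset.card_univ, hcard, ← ENNReal.ofReal_nsmul]
    apply ENNReal.ofReal_le_ofReal
    simp
  have hEc := hun (fun f => {u | 0 < ∑ k, auxGrid K f k ^ 2 ∧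
          ∀ j, ∑ k, auxGrid K f k * u j k < s * (√(∑ k, auxGrid K f k ^ 2) / √d)})
      (Real.exp (-(n * p))) (by positivity) (by
    intro f
    by_cases hz : 0 < ∑ k, auxGrid K f k ^ 2
    · simp only [hz, true_and]
      exact aux_Ec d n _ _ (by positivity) (hr _) s p hp0 hp
    · simp [hz])
  have hEd := hun (fun f => {v | 0 < ∑ k, auxGrid K f k ^ 2 ∧
          ∑ i, |∑ k, auxGrid K f k * v i k| < (1 - δ) * √(2 / Real.pi) * n * (√(∑ k, auxGrid K f k ^ 2) / √d)})
      (Real.exp (-(n * (δ ^ 2 / Real.pi)))) (by positivity) (by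
    intro f
    by_cases hz : 0 < ∑ k, auxGrid K f k ^ 2
    · simp only [hz, true_and]
      exact aux_Ed d n _ _ (by positivity) (hr _) δ hδ
    · simp [hz])
  have hEb : gaussianModel d n {p | (1 + δ) * ∑ i, ∑ l, p.2 i l ^ 2 < ∑ k, ∑ l, (∑ i, p.1 i k * p.2 i l) ^ 2}
      ≤ ENNReal.ofReal (Real.exp (-(δ ^ 2 / 8 * d))) := by
    unfold gaussianModel
    rw [Measure.prod_apply_symm (measurableSet_lt (by fun_prop) (by fun_prop))]
    refine (lintegral_mono fun v => aux_Eb d n hd δ hδ hδ1 v).trans ?_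
    simp
  refine (measure_union_le _ _).trans ((add_le_add (measure_union_le _ _) hEb).trans ?_)
  unfold gaussianModel
  rw [Measure.prod_prod, Measure.prod_prod]
  simp only [measure_univ, one_mul, mul_one]
  refine (add_le_add_left (add_le_add ((measure_union_le _ _).trans (add_le_add hEa hEc))
    ((measure_union_le _ _).trans (add_le_add hEa hEd))) _).trans ?_
  rw [← ENNReal.ofReal_add (by positivity) (by positivity), ← ENNReal.ofReal_add (by positivity) (by positivity),
    ← ENNReal.ofReal_add (by positivity) (by positivity), ← ENNReal.ofReal_add (by positivity) (by positivity)]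
  apply ENNReal.ofReal_le_ofReal
  linarith

lemma aux_choose_delta (ε : ℝ) (hε : 0 < ε) : ∃ δ : ℝ, 0 < δ ∧ δ ≤ 1 / 2 ∧
    (1 + δ) ^ 2 < (1 - δ) ^ 7 * (4 / Real.pi * (Real.pi / 4 + ε)) := by
  have h1 : (1 : ℝ) < 4 / Real.pi * (Real.pi / 4 + ε) := by
    have : 4 / Real.pi * (Real.pi / 4 + ε) = 1 + 4 * ε / Real.pi := by
      have := Real.pi_ne_zero
      field_simp
    rw [this]
    have : 0 < 4 * ε / Real.pi := by positivity
    linarith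
  have hcont : Continuous fun δ : ℝ => (1 - δ) ^ 7 * (4 / Real.pi * (Real.pi / 4 + ε)) - (1 + δ) ^ 2 := by
    fun_prop
  have hev : ∀ᶠ δ in 𝓝 (0:ℝ), 0 < (1 - δ) ^ 7 * (4 / Real.pi * (Real.pi / 4 + ε)) - (1 + δ) ^ 2 := by
    apply hcont.continuousAt.eventually (lt_mem_nhds _)
    norm_num
    linarith
  have hev2 : ∀ᶠ δ in 𝓝[>] (0:ℝ), 0 < δ ∧ δ ≤ 1 / 2 ∧
      0 < (1 - δ) ^ 7 * (4 / Real.pi * (Real.pi / 4 + ε)) - (1 + δ) ^ 2 := by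
    filter_upwards [self_mem_nhdsWithin, nhdsWithin_le_nhds hev,
      nhdsWithin_le_nhds (ge_mem_nhds (show (0:ℝ) < 1 / 2 by norm_num))] with δ a b c
    exact ⟨a, c, b⟩
  obtain ⟨δ, a, b, c⟩ := hev2.exists
  exact ⟨δ, a, b, by linarith⟩

lemma aux_p_le (δ L : ℝ) (h0 : 0 < δ) (h1 : δ ≤ 1 / 2) (hL0 : 0 ≤ L)
    (hL : 4 / δ * (2 / δ + 3 / 2) ≤ L) :
    Real.exp (-(1 - δ / 2) * L) ≤
      (√(2 * Real.pi))⁻¹ * Real.exp (-(1/2) * (√(2 * (1 - δ) * L) + 1) ^ 2) := by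
  set s := √(2 * (1 - δ) * L) with hs
  have hs2 : s ^ 2 = 2 * (1 - δ) * L := Real.sq_sqrt (by
    have : 0 ≤ 1 - δ := by linarith
    positivity)
  have hs0 : 0 ≤ s := Real.sqrt_nonneg _
  have hsle : s ≤ δ * L / 4 + 2 / δ := by
    apply Real.sqrt_le_iff.2 ⟨by positivity, ?_⟩
    have e : (δ * L / 4 + 2 / δ) ^ 2 = (δ * L / 4 - 2 / δ) ^ 2 + 2 * L := by field_simp; ring
    rw [e]
    nlinarith [sq_nonneg (δ * L / 4 - 2 / δ)]
  have hL' : 2 / δ + 3 / 2 ≤ δ * L / 4 := by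
    have e : 2 / δ + 3 / 2 = δ / 4 * (4 / δ * (2 / δ + 3 / 2)) := by field_simp
    rw [e]
    calc _ ≤ δ / 4 * L := by gcongr
      _ = _ := by ring
  have hpi : √(2 * Real.pi) ≤ Real.exp 1 := by
    apply Real.sqrt_le_iff.2 ⟨by positivity, ?_⟩
    have := Real.exp_one_gt_d9
    have := Real.pi_lt_d2
    nlinarith
  have hinv : Real.exp (-1) ≤ (√(2 * Real.pi))⁻¹ := by
    rw [Real.exp_neg]
    exact inv_anti₀ (by positivity) hpi
  calc _ ≤ Real.exp (-1 + -(1/2) * (s + 1) ^ 2) := by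
        apply Real.exp_le_exp.2
        nlinarith
    _ = Real.exp (-1) * Real.exp (-(1/2) * (s + 1) ^ 2) := Real.exp_add _ _
    _ ≤ _ := by gcongr

set_option maxHeartbeats 4000000 in
lemma aux_main_n (ε δ : ℝ) (hε : 0 < ε) (h0 : 0 < δ) (h1 : δ ≤ 1 / 2)
    (hδε : (1 + δ) ^ 2 < (1 - δ) ^ 7 * (4 / Real.pi * (Real.pi / 4 + ε)))
    (d n : ℕ) (hd3 : 3 ≤ d)
    (hL1 : 1 ≤ Real.log d)
    (hL : 4 / δ * (2 / δ + 3 / 2) ≤ Real.log d)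
    (hLg : Real.log d ≤ 3 / 4 * (d:ℝ) ^ (δ / 8))
    (hg : 5 / (δ / 8) ≤ (d:ℝ) ^ (δ / 8))
    (hp : Real.pi / δ ^ 2 ≤ (d:ℝ) ^ (1 - δ / 2))
    (hκ : (3 / (δ * (1 - δ) * √(2 / Real.pi))) ^ 2 ≤ d)
    (hc : 64 / δ ^ 2 ≤ d)
    (hn : (Real.pi / 4 + ε) * (d : ℝ) ^ 2 / Real.log d ≤ (n : ℝ)) :
    gaussianModel d n (PRset d n) ≤ ENNReal.ofReal (Real.exp (-(δ ^ 2 / 16) * d)) := by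
  have hd0 : (0:ℝ) < d := by exact_mod_cast (show 0 < d by omega)
  have hd1 : (1:ℝ) ≤ d := by exact_mod_cast (show 1 ≤ d by omega)
  set L := Real.log d with hLdef
  have hLpos : 0 < L := by linarith
  set γ := δ / 8 with hγ
  have hγ0 : 0 < γ := by positivity
  have hpi := Real.pi_gt_three
  have hpi0 := Real.pi_pos
  -- n ≥ d^(2-γ)
  have hn2 : (d:ℝ) ^ (2 - γ) ≤ n := by
    refine le_trans ?_ hn
    rw [le_div_iff₀ hLpos, Real.rpow_sub hd0, Real.rpow_two]
    have hx : 0 < (d:ℝ) ^ γ := by positivity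
    rw [div_mul_eq_mul_div, div_le_iff₀ hx]
    have : (d:ℝ) ^ 2 * L ≤ (d:ℝ) ^ 2 * (3 / 4 * (d:ℝ) ^ γ) := by gcongr
    have h3 : (3 / 4 : ℝ) * ((d:ℝ) ^ 2 * (d:ℝ) ^ γ) ≤ (Real.pi / 4 + ε) * ((d:ℝ) ^ 2 * (d:ℝ) ^ γ) := by
      gcongr; linarith
    linarith
  have hnd : (d:ℝ) ≤ n := by
    refine le_trans ?_ hn2
    conv_lhs => rw [← Real.rpow_one (d:ℝ)]
    exact Real.rpow_le_rpow_of_exponent_le hd1 (by rw [hγ]; linarith)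
  have hnd' : d ≤ n := by exact_mod_cast hnd
  have hn0 : (0:ℝ) < n := by linarith
  have hn3 : (3:ℝ) ≤ n := by exact_mod_cast hd3.trans hnd'
  set s := √(2 * (1 - δ) * L) with hs
  have hs2 : s ^ 2 = 2 * (1 - δ) * L := Real.sq_sqrt (by
    have : 0 ≤ 1 - δ := by linarith
    positivity)
  have hs1 : 1 ≤ s := by
    apply Real.le_sqrt_of_sq_le
    nlinarith
  set p := Real.exp (-(1 - δ / 2) * L) with hpdef
  have hp_eq : p = ((d:ℝ) ^ (1 - δ / 2))⁻¹ := by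
    rw [hpdef, Real.rpow_def_of_pos hd0, ← Real.exp_neg]; congr 1; ring
  have hptail : ENNReal.ofReal p ≤ gaussianReal 0 1 (Set.Ici s) :=
    (ENNReal.ofReal_le_ofReal (aux_p_le δ L h0 h1 hLpos.le hL)).trans (aux_tail s (by linarith))
  have hKpos : 0 < n ^ 2 := by have : 0 < n := by omega
                               positivity
  have hη : √d / (n ^ 2 : ℕ) * (1 + √(2 * n * d)) ≤ δ * (1 - δ) * √(2 / Real.pi) := by
    set κ := δ * (1 - δ) * √(2 / Real.pi) with hκd
    have hκ0 : 0 < κ := by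
      have : 0 < 1 - δ := by linarith
      positivity
    have hsd : 3 / κ ≤ √n := (Real.le_sqrt' (by positivity)).2 (hκ.trans hnd)
    have h3 : √(2 * n * d : ℝ) ≤ 2 * n := by
      apply Real.sqrt_le_iff.2 ⟨by positivity, ?_⟩
      nlinarith
    have h4 : √(d:ℝ) ≤ √n := Real.sqrt_le_sqrt hnd
    have hsn : 0 < √(n:ℝ) := Real.sqrt_pos.2 hn0
    have hsq : √(n:ℝ) * √n = n := Real.mul_self_sqrt hn0.le
    calc √d / (n ^ 2 : ℕ) * (1 + √(2 * n * d)) ≤ √n / (n ^ 2 : ℕ) * (n + 2 * n) := by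
          gcongr; linarith
      _ = 3 / √n := by
          push_cast
          have : (n:ℝ) ^ 2 = n * (√n * √n) := by rw [hsq]; ring
          rw [this]
          field_simp
          norm_num
      _ ≤ κ := by
          rw [div_le_iff₀ hsn]
          rw [div_le_iff₀ hκ0] at hsd
          linarith
  have hfin : (1 + δ) ^ 2 * n < ((1 - δ) ^ 3 * s * √(2 / Real.pi) * n / d) ^ 2 := by
    have hm2 : √(2 / Real.pi) ^ 2 = 2 / Real.pi := Real.sq_sqrt (by positivity)
    have e : ((1 - δ) ^ 3 * s * √(2 / Real.pi) * n / d) ^ 2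
        = (1 - δ) ^ 7 * (4 / Real.pi * (n * L / d ^ 2)) * n := by
      rw [div_pow, mul_pow, mul_pow, mul_pow, hs2, hm2]
      field_simp
      ring
    rw [e]
    have h5 : Real.pi / 4 + ε ≤ n * L / d ^ 2 := by
      rw [le_div_iff₀ (by positivity)]
      rwa [div_le_iff₀ hLpos] at hn
    have h6 : 0 ≤ (1 - δ) ^ 7 := pow_nonneg (by linarith) 7
    have h7 : (1 - δ) ^ 7 * (4 / Real.pi * (Real.pi / 4 + ε)) ≤ (1 - δ) ^ 7 * (4 / Real.pi * (n * L / d ^ 2)) := by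
      gcongr
    have : (1 + δ) ^ 2 < (1 - δ) ^ 7 * (4 / Real.pi * (n * L / d ^ 2)) := lt_of_lt_of_le hδε h7
    exact mul_lt_mul_of_pos_right this hn0
  refine (aux_prob_bound (by omega) (by omega) (n ^ 2) hKpos δ s p h0 (by linarith) hs1
    (Real.exp_pos _).le hptail hη hfin).trans (ENNReal.ofReal_le_ofReal ?_)
  -- numeric
  have hpd : p ≤ δ ^ 2 / Real.pi := by
    rw [hp_eq, ← inv_div Real.pi]
    exact inv_anti₀ (by positivity) hp
  have hlogn1 : 1 ≤ Real.log n := by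
    rw [Real.le_log_iff_exp_le hn0]
    have := Real.exp_one_lt_d9
    linarith
  have hlog : Real.log n ≤ (n:ℝ) ^ γ / γ := Real.log_le_rpow_div hn0.le hγ0
  have hkey : 5 * d * Real.log n ≤ n * p := by
    rw [hp_eq, ← div_eq_mul_inv, le_div_iff₀ (by positivity)]
    have hnγ : (d:ℝ) ^ (2 - 3 * γ) ≤ (n:ℝ) ^ (1 - γ) := by
      calc (d:ℝ) ^ (2 - 3 * γ) ≤ (d:ℝ) ^ ((2 - γ) * (1 - γ)) :=
            Real.rpow_le_rpow_of_exponent_le hd1 (by nlinarith)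
        _ = ((d:ℝ) ^ (2 - γ)) ^ (1 - γ) := Real.rpow_mul hd0.le _ _
        _ ≤ _ := Real.rpow_le_rpow (by positivity) hn2 (by rw [hγ]; linarith)
    have e1 : (d:ℝ) * (d:ℝ) ^ (1 - δ / 2) * (d:ℝ) ^ γ = (d:ℝ) ^ (2 - 3 * γ) := by
      conv_lhs => rw [← Real.rpow_one (d:ℝ)]
      rw [Real.rpow_one, ← Real.rpow_one_add' hd0.le (by linarith), ← Real.rpow_add hd0]
      congr 1; rw [hγ]; ring
    have e2 : (n:ℝ) ^ (1 - γ) * (n:ℝ) ^ γ = n := by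
      rw [← Real.rpow_add hn0]; simp
    calc 5 * d * Real.log n * (d:ℝ) ^ (1 - δ / 2)
        ≤ 5 * d * ((n:ℝ) ^ γ / γ) * (d:ℝ) ^ (1 - δ / 2) := by gcongr
      _ = (d * (d:ℝ) ^ (1 - δ / 2) * (5 / γ)) * (n:ℝ) ^ γ := by ring
      _ ≤ (d * (d:ℝ) ^ (1 - δ / 2) * (d:ℝ) ^ γ) * (n:ℝ) ^ γ := by gcongr
      _ ≤ (n:ℝ) ^ (1 - γ) * (n:ℝ) ^ γ := by rw [e1]; gcongr
      _ = n := e2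
  have hgrid : (2 * ((n ^ 2 : ℕ) : ℝ) + 1) ^ d ≤ Real.exp (4 * d * Real.log n) := by
    have : Real.exp (4 * d * Real.log n) = ((n:ℝ) ^ 4) ^ d := by
      rw [← Real.exp_log (show (0:ℝ) < (n:ℝ) ^ 4 by positivity), ← Real.exp_nat_mul, Real.log_pow]
      congr 1; push_cast; ring
    rw [this]
    gcongr
    push_cast
    have h9 : (9:ℝ) ≤ (n:ℝ) ^ 2 := by nlinarith
    have h10 : (n:ℝ) ^ 4 = (n:ℝ) ^ 2 * (n:ℝ) ^ 2 := by ring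
    rw [h10]
    nlinarith
  have hq1 : (2 * ((n ^ 2 : ℕ) : ℝ) + 1) ^ d * (Real.exp (-(n * p)) + Real.exp (-(n * (δ ^ 2 / Real.pi))))
      ≤ 2 * Real.exp (-(δ ^ 2 / 8 * d)) := by
    have : Real.exp (-(n * (δ ^ 2 / Real.pi))) ≤ Real.exp (-(n * p)) := by
      apply Real.exp_le_exp.2; gcongr
    calc _ ≤ Real.exp (4 * d * Real.log n) * (Real.exp (-(n * p)) + Real.exp (-(n * p))) := by gcongr
      _ = 2 * Real.exp (4 * d * Real.log n + -(n * p)) := by rw [Real.exp_add]; ring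
      _ ≤ _ := by
        gcongr
        have : d * 1 ≤ d * Real.log n := by gcongr
        have : δ ^ 2 / 8 * d ≤ 1 * d := by gcongr; nlinarith
        linarith
  have hlast : 5 * Real.exp (-(δ ^ 2 / 8 * d)) ≤ Real.exp (-(δ ^ 2 / 16) * d) := by
    have h5 : 5 ≤ Real.exp (δ ^ 2 / 16 * d) := by
      have := Real.add_one_le_exp (δ ^ 2 / 16 * d)
      have : 4 ≤ δ ^ 2 / 16 * d := by
        rw [div_le_iff₀ (by positivity)] at hc; linarith
      linarith
    calc _ ≤ Real.exp (δ ^ 2 / 16 * d) * Real.exp (-(δ ^ 2 / 8 * d)) := by gcongr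
      _ = _ := by rw [← Real.exp_add]; congr 1; ring
  linarith

/-- **Universal top-1 impossibility bound (Gaussian case).** For every `ε > 0` there is a
constant `c > 0` such that for all sufficiently large `d`: if `n ≥ (π/4 + ε) d²/log d`,
then with probability at least `1 - e^{-c d}` no matrix `W` satisfies all top-1
retrieval inequalities; equivalently `P(PR_n) ≤ e^{-c d}`. -/
theorem universal_top1_impossibility (ε : ℝ) (hε : 0 < ε) :
    ∃ c : ℝ, 0 < c ∧ ∃ d₀ : ℕ, ∀ d : ℕ, d₀ ≤ d → ∀ n : ℕ,
      (Real.pi / 4 + ε) * (d : ℝ) ^ 2 / Real.log d ≤ (n : ℝ) →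
      gaussianModel d n (PRset d n) ≤ ENNReal.ofReal (Real.exp (-c * d)) := by
  obtain ⟨δ, h0, h1, hδε⟩ := aux_choose_delta ε hε
  refine ⟨δ ^ 2 / 16, by positivity, ?_⟩
  have hcast : Tendsto (fun d : ℕ => (d:ℝ)) atTop atTop := tendsto_natCast_atTop_atTop
  have hlog : Tendsto (fun d : ℕ => Real.log d) atTop atTop := Real.tendsto_log_atTop.comp hcast
  have hlo : ∀ᶠ d : ℕ in atTop, Real.log d ≤ 3 / 4 * (d:ℝ) ^ (δ / 8) := by
    have := (isLittleO_log_rpow_atTop (show 0 < δ / 8 by positivity)).bound (show (0:ℝ) < 3 / 4 by norm_num)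
    filter_upwards [hcast.eventually this] with d hd
    refine (Real.le_norm_self _).trans (hd.trans (le_of_eq ?_))
    rw [Real.norm_of_nonneg (by positivity)]
  have hg := ((tendsto_rpow_atTop (show 0 < δ / 8 by positivity)).comp hcast).eventually_ge_atTop
    (5 / (δ / 8))
  have hp := ((tendsto_rpow_atTop (show 0 < 1 - δ / 2 by linarith)).comp hcast).eventually_ge_atTop
    (Real.pi / δ ^ 2)
  have hall : ∀ᶠ d : ℕ in atTop, ∀ n : ℕ,
      (Real.pi / 4 + ε) * (d : ℝ) ^ 2 / Real.log d ≤ (n : ℝ) →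
      gaussianModel d n (PRset d n) ≤ ENNReal.ofReal (Real.exp (-(δ ^ 2 / 16) * d)) := by
    filter_upwards [eventually_ge_atTop 3, hlog.eventually_ge_atTop 1,
      hlog.eventually_ge_atTop (4 / δ * (2 / δ + 3 / 2)), hlo, hg, hp,
      hcast.eventually_ge_atTop ((3 / (δ * (1 - δ) * √(2 / Real.pi))) ^ 2),
      hcast.eventually_ge_atTop (64 / δ ^ 2)] with d a1 a2 a3 a4 a5 a6 a7 a8 n hn
    exact aux_main_n ε δ hε h0 h1 hδε d n a1 a2 a3 a4 a5 a6 a7 a8 hn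
  exact eventually_atTop.1 hall

end
end

section
/- For all constants C₁, c₂, C₃ > 0 there exist constants C′ > 0 and c > 0 such that for all sufficiently large d the following holds. Let v_1,…,v_n ∈ ℝ^d∖{0} be deterministic vectors with ‖v_i‖ ≤ C₁ for all i, (1/n) Σ_{i=1}^n v_i v_i^⊤ ⪰ (c₂/d) I_d in the positive semidefinite order, and (1/n) Σ_{i=1}^n ⟨v_i, x⟩⁴ ≤ C₃ ‖x‖⁴/d² for all x ∈ ℝ^d, and let u_1,…,u_n be i.i.d. N(0, I_d/d). If n ≥ C′ d²/log d, then with probability at least 1 − e^{−c d} there exists no matrix W ∈ ℝ^{d×d} satisfying u_i^⊤ W v_i > u_j^⊤ W v_i for all i ∈ {1,…,n} and all j ≠ i. -/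
open MeasureTheory ProbabilityTheory Filter Topology Matrix

noncomputable section

/-- The model where only the `u_i` are random: `u_1, …, u_n` i.i.d. `N(0, I_d/d)`. -/
def uModel (d n : ℕ) : Measure (Fin n → Fin d → ℝ) :=
  Measure.pi fun _ : Fin n => stdGaussianVec d

instance instProbStd (d : ℕ) : IsProbabilityMeasure (stdGaussianVec d) := by
  unfold stdGaussianVec; infer_instance

lemma dot_nonneg {d : ℕ} (w : Fin d → ℝ) : 0 ≤ w ⬝ᵥ w :=
  Finset.sum_nonneg fun i _ => mul_self_nonneg (w i)

lemma map_dot (d : ℕ) (w : Fin d → ℝ) :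
    (stdGaussianVec d).map (fun u => u ⬝ᵥ w) =
      gaussianReal 0 (Real.toNNReal ((w ⬝ᵥ w) / d)) := by
  have hm : Measurable (fun u : Fin d → ℝ => u ⬝ᵥ w) := by
    unfold dotProduct; fun_prop
  have : IsProbabilityMeasure ((stdGaussianVec d).map (fun u => u ⬝ᵥ w)) :=
    Measure.isProbabilityMeasure_map hm.aemeasurable
  apply Measure.ext_of_charFun
  ext t
  rw [charFun_apply_real, integral_map hm.aemeasurable (by fun_prop)]
  have h1 : ∀ u : Fin d → ℝ, Complex.exp (t * ((u ⬝ᵥ w : ℝ) : ℂ) * Complex.I) =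
      ∏ k, Complex.exp (((t * w k : ℝ) : ℂ) * (u k : ℂ) * Complex.I) := by
    intro u
    rw [← Complex.exp_sum]
    congr 1
    simp only [dotProduct, Complex.ofReal_sum, Finset.mul_sum, Finset.sum_mul]
    apply Finset.sum_congr rfl
    intros; push_cast; ring
  simp_rw [h1]
  unfold stdGaussianVec
  rw [integral_fintype_prod_eq_prod (𝕜 := ℂ) (fun k (x : ℝ) =>
    Complex.exp (((t * w k : ℝ) : ℂ) * (x : ℂ) * Complex.I))]
  simp_rw [← charFun_apply_real, charFun_gaussianReal]
  rw [← Complex.exp_sum]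
  congr 1
  have h0 : 0 ≤ (w ⬝ᵥ w) / d := div_nonneg (dot_nonneg w) (by positivity)
  have h2 : ((Real.toNNReal ((w ⬝ᵥ w) / d) : NNReal) : ℂ) = (((w ⬝ᵥ w) / d : ℝ) : ℂ) := by
    rw [← Complex.ofReal_inj.2 (Real.coe_toNNReal _ h0)]
  rw [h2]
  simp only [dotProduct]
  push_cast
  simp only [mul_zero, zero_mul, zero_sub, Finset.sum_neg_distrib, neg_inj, Finset.sum_div, Finset.sum_mul]
  apply Finset.sum_congr rfl
  intros
  simp
  ring

lemma tail_upper (d : ℕ) (w : Fin d → ℝ) (B τ : ℝ) (hB : 0 < B) (hτ : 0 ≤ τ)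
    (hd : 0 < d) (hw : w ⬝ᵥ w ≤ B * d) :
    stdGaussianVec d {u | τ ≤ u ⬝ᵥ w} ≤ ENNReal.ofReal (Real.exp (-(τ ^ 2 / (2 * B)))) := by
  have hd' : (0 : ℝ) < d := by exact_mod_cast hd
  have h0 : 0 ≤ (w ⬝ᵥ w) / d := div_nonneg (dot_nonneg w) (by positivity)
  have hm : Measurable (fun u : Fin d → ℝ => u ⬝ᵥ w) := by
    unfold dotProduct; fun_prop
  have hmap := map_dot d w
  have e : stdGaussianVec d {u | τ ≤ u ⬝ᵥ w} =
      gaussianReal 0 (Real.toNNReal ((w ⬝ᵥ w) / d)) {x | τ ≤ id x} := by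
    rw [← hmap, Measure.map_apply hm (measurableSet_le measurable_const measurable_id)]
    rfl
  rw [e, ← ENNReal.ofReal_toReal (measure_ne_top _ _)]
  apply ENNReal.ofReal_le_ofReal
  have h := measure_ge_le_exp_mul_mgf (μ := gaussianReal 0 (Real.toNNReal ((w ⬝ᵥ w) / d)))
    (X := id) (t := τ / B) τ (by positivity) (integrable_exp_mul_gaussianReal _)
  refine h.trans ?_
  rw [mgf_id_gaussianReal, ← Real.exp_add]
  apply Real.exp_le_exp.2
  rw [Real.coe_toNNReal _ h0]
  have h3 : (w ⬝ᵥ w) / d ≤ B := by rw [div_le_iff₀ hd']; exact hw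
  have h4 : (w ⬝ᵥ w) / d * (τ / B) ^ 2 / 2 ≤ B * (τ / B) ^ 2 / 2 := by gcongr
  have h5 : B * (τ / B) ^ 2 / 2 = τ ^ 2 / (2 * B) := by field_simp
  have h6 : -(τ / B) * τ = - (2 * (τ ^ 2 / (2 * B))) := by field_simp
  linarith

lemma gauss_lower (t : ℝ) (ht : 0 ≤ t) :
    ENNReal.ofReal (Real.exp (-t ^ 2) / 8) ≤ gaussianReal 0 1 {x | t ≤ x} := by
  rw [gaussianReal_apply _ one_ne_zero]
  calc ENNReal.ofReal (Real.exp (-t ^ 2) / 8)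
      = ∫⁻ x in Set.Icc t (t+1), ENNReal.ofReal (Real.exp (-t ^ 2) / 8) := by
        simp
    _ ≤ ∫⁻ x in Set.Icc t (t+1), gaussianPDF 0 1 x := by
        apply setLIntegral_mono (measurable_gaussianPDF _ _)
        intro x hx
        unfold gaussianPDF
        apply ENNReal.ofReal_le_ofReal
        rw [gaussianPDFReal_def]
        simp only [sub_zero, NNReal.coe_one, mul_one]
        have h1 : x ^ 2 ≤ 2 * t ^ 2 + 2 := by
          have : x ^ 2 ≤ (t+1)^2 := by
            apply pow_le_pow_left₀ (ht.trans hx.1) hx.2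
          nlinarith [sq_nonneg (t-1)]
        have h2 : Real.exp (-t^2) * Real.exp (-1) ≤ Real.exp (-x ^ 2 / 2) := by
          rw [← Real.exp_add]
          apply Real.exp_le_exp.2; linarith
        have h3 : Real.sqrt (2 * Real.pi) ≤ 2.6 := by
          apply Real.sqrt_le_iff.2
          constructor
          · norm_num
          · nlinarith [Real.pi_lt_d2]
        have h4 : Real.exp 1 ≤ 2.8 := by linarith [Real.exp_one_lt_d9]
        have h5 : 0 < Real.sqrt (2 * Real.pi) := by positivity
        have h6 : Real.sqrt (2 * Real.pi) * Real.exp 1 ≤ 8 := by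
          nlinarith [Real.exp_pos 1]
        calc Real.exp (-t ^ 2) / 8 ≤ Real.exp (-t ^ 2) / (Real.sqrt (2 * Real.pi) * Real.exp 1) := by
              gcongr
          _ = (Real.sqrt (2 * Real.pi))⁻¹ * (Real.exp (-t^2) * Real.exp (-1)) := by
              rw [Real.exp_neg 1]; field_simp
          _ ≤ _ := by gcongr
    _ ≤ _ := by
        apply lintegral_mono_set
        intro x hx
        exact hx.1

lemma tail_lower (d : ℕ) (hd : 0 < d) (w : Fin d → ℝ) (hw : 0 < w ⬝ᵥ w) (t : ℝ) (ht : 0 ≤ t) :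
    ENNReal.ofReal (Real.exp (-t ^ 2) / 8) ≤
      stdGaussianVec d {u | t * Real.sqrt ((w ⬝ᵥ w) / d) ≤ u ⬝ᵥ w} := by
  have hd' : (0 : ℝ) < d := by exact_mod_cast hd
  have h0 : 0 < (w ⬝ᵥ w) / d := div_pos hw (by positivity)
  have hm : Measurable (fun u : Fin d → ℝ => u ⬝ᵥ w) := by
    unfold dotProduct; fun_prop
  set s := Real.sqrt ((w ⬝ᵥ w) / d) with hs
  have hspos : 0 < s := Real.sqrt_pos.2 h0
  have hmap := map_dot d w
  have e : stdGaussianVec d {u | t * s ≤ u ⬝ᵥ w} =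
      gaussianReal 0 (Real.toNNReal ((w ⬝ᵥ w) / d)) (Set.Ici (t * s)) := by
    rw [← hmap, Measure.map_apply hm measurableSet_Ici]
    rfl
  have e2 : gaussianReal 0 (Real.toNNReal ((w ⬝ᵥ w) / d)) = (gaussianReal 0 1).map (s * ·) := by
    rw [gaussianReal_map_const_mul]
    congr 1
    · simp
    · ext
      rw [Real.coe_toNNReal _ h0.le]
      simp only [hs, NNReal.coe_mul, NNReal.coe_mk, NNReal.coe_one, mul_one, Real.sq_sqrt h0.le]
  rw [e, e2, Measure.map_apply (by fun_prop) measurableSet_Ici]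
  refine (gauss_lower t ht).trans (measure_mono ?_)
  intro x hx
  simp only [Set.mem_preimage, Set.mem_ofPred_eq, Set.mem_Ici] at *
  nlinarith

lemma norm_markov (d : ℕ) (hd : 0 < d) (R : ℝ) (hR : 0 < R) :
    stdGaussianVec d {u | R < u ⬝ᵥ u} ≤ ENNReal.ofReal (1 / R) := by
  have hd' : (0 : ℝ) < d := by exact_mod_cast hd
  have h1 : ∫⁻ u, ENNReal.ofReal (u ⬝ᵥ u) ∂(stdGaussianVec d) ≤ 1 := by
    have : ∀ u : Fin d → ℝ, ENNReal.ofReal (u ⬝ᵥ u) = ∑ k, ENNReal.ofReal (u k * u k) := by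
      intro u
      rw [dotProduct, ENNReal.ofReal_sum_of_nonneg (fun i _ => mul_self_nonneg _)]
    simp_rw [this]
    rw [lintegral_finsetSum _ (fun k _ => by fun_prop)]
    have h2 : ∀ k : Fin d, ∫⁻ u, ENNReal.ofReal (u k * u k) ∂(stdGaussianVec d) =
        ENNReal.ofReal ((d : ℝ)⁻¹) := by
      intro k
      have mp : MeasurePreserving (Function.eval k) (stdGaussianVec d)
          (gaussianReal 0 (d : NNReal)⁻¹) := by
        unfold stdGaussianVec
        exact measurePreserving_eval (fun _ : Fin d => gaussianReal 0 (d : NNReal)⁻¹) k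
      have := mp.lintegral_comp (f := fun x : ℝ => ENNReal.ofReal (x * x)) (by fun_prop)
      simp only [Function.eval] at this
      rw [this, ← ofReal_integral_eq_lintegral_ofReal]
      · congr 1
        have hv := variance_fun_id_gaussianReal (μ := 0) (v := (d : NNReal)⁻¹)
        rw [variance_eq_integral (by fun_prop)] at hv
        simp only [integral_id_gaussianReal, sub_zero] at hv
        simp_rw [← pow_two, hv]
        simp
      · have := (memLp_id_gaussianReal (μ := 0) (v := (d : NNReal)⁻¹) 2).integrable_sq
        simpa [pow_two] using this
      · exact Eventually.of_forall fun x => mul_self_nonneg x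
    simp_rw [h2]
    simp only [Finset.sum_const, Finset.card_univ, Fintype.card_fin, nsmul_eq_mul]
    rw [← ENNReal.ofReal_natCast, ← ENNReal.ofReal_mul (by positivity), mul_inv_cancel₀ hd'.ne']
    simp
  have h3 := meas_ge_le_lintegral_div (μ := stdGaussianVec d)
    (f := fun u => ENNReal.ofReal (u ⬝ᵥ u)) (by unfold dotProduct; fun_prop)
    (ε := ENNReal.ofReal R) (by simpa using hR) (by simp)
  refine (measure_mono ?_).trans (h3.trans ?_)
  · intro u hu
    exact ENNReal.ofReal_le_ofReal (le_of_lt hu)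
  · rw [ENNReal.ofReal_div_of_pos hR, ENNReal.ofReal_one]
    gcongr

lemma subset_bound {X : Type*} [MeasurableSpace X] (μ : Measure X) [IsProbabilityMeasure μ]
    (n : ℕ) (A : Fin n → Set X) (s k : ℝ) (hs : 0 ≤ s) (T : Finset (Fin n))
    (hA : ∀ i ∈ T, μ (A i) ≤ ENNReal.ofReal (Real.exp (-s))) :
    Measure.pi (fun _ : Fin n => μ) {u | ∃ F : Finset (Fin n), F ⊆ T ∧ k ≤ (F.card : ℝ) ∧
      ∀ i ∈ F, u i ∈ A i} ≤ ENNReal.ofReal (Real.exp (n - s * k)) := by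
  classical
  have h1 : ∀ F : Finset (Fin n), F ⊆ T → k ≤ (F.card : ℝ) →
      Measure.pi (fun _ : Fin n => μ) {u | ∀ i ∈ F, u i ∈ A i} ≤
        ENNReal.ofReal (Real.exp (-(s * k))) := by
    intro F hFT hF
    have e : {u : Fin n → X | ∀ i ∈ F, u i ∈ A i} =
        Set.pi Set.univ (fun i => if i ∈ F then A i else Set.univ) := by
      ext u
      simp only [Set.mem_ofPred_eq, Set.mem_pi, Set.mem_univ, true_implies]
      refine forall_congr' fun i => ?_
      by_cases h : i ∈ F <;> simp [h]
    rw [e, Measure.pi_pi]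
    calc ∏ i, μ (if i ∈ F then A i else Set.univ)
        = ∏ i, (if i ∈ F then μ (A i) else 1) := by
          apply Finset.prod_congr rfl
          intro i _
          by_cases h : i ∈ F <;> simp [h]
      _ = ∏ i ∈ F, μ (A i) := by simp
      _ ≤ ∏ i ∈ F, ENNReal.ofReal (Real.exp (-s)) :=
          Finset.prod_le_prod' fun i hi => hA i (hFT hi)
      _ = ENNReal.ofReal (Real.exp (-(s * F.card))) := by
          rw [Finset.prod_const, ← ENNReal.ofReal_pow (Real.exp_pos _).le, ← Real.exp_nat_mul]
          congr 2; ring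
      _ ≤ _ := by
          apply ENNReal.ofReal_le_ofReal
          apply Real.exp_le_exp.2
          nlinarith
  calc _ ≤ Measure.pi (fun _ : Fin n => μ)
        (⋃ F ∈ (Finset.univ.filter (fun F : Finset (Fin n) => F ⊆ T ∧ k ≤ (F.card : ℝ))),
          {u | ∀ i ∈ F, u i ∈ A i}) := by
        apply measure_mono
        rintro u ⟨F, h1, h2, h3⟩
        simp only [Set.mem_iUnion]
        exact ⟨F, by simp [h1, h2], h3⟩
    _ ≤ ∑ F ∈ (Finset.univ.filter (fun F : Finset (Fin n) => F ⊆ T ∧ k ≤ (F.card : ℝ))),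
          ENNReal.ofReal (Real.exp (-(s * k))) := by
        refine (measure_biUnion_finset_le _ _).trans (Finset.sum_le_sum fun F hF => ?_)
        simp only [Finset.mem_filter] at hF
        exact h1 F hF.2.1 hF.2.2
    _ ≤ ∑ F : Finset (Fin n), ENNReal.ofReal (Real.exp (-(s * k))) :=
        Finset.sum_le_sum_of_subset (Finset.filter_subset _ _)
    _ ≤ _ := by
        rw [Finset.sum_const, Finset.card_univ, Fintype.card_finset, Fintype.card_fin,
          nsmul_eq_mul, ← ENNReal.ofReal_natCast, ← ENNReal.ofReal_mul (by positivity)]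
        apply ENNReal.ofReal_le_ofReal
        rw [sub_eq_add_neg, Real.exp_add]
        gcongr
        push_cast
        rw [← mul_one (n : ℝ), Real.exp_nat_mul]
        gcongr
        linarith [Real.add_one_le_exp (1 : ℝ)]

lemma rounding {ι κ : Type*} [Fintype κ] (F : Finset ι) (a : ι → κ → ℝ) (x : κ → ℝ) :
    ∃ z : κ → ℤ, (∀ k, |x k - z k| ≤ 1) ∧
      ∑ i ∈ F, (∑ k, a i k * (x k - z k)) ^ 2 ≤ ∑ i ∈ F, ∑ k, a i k ^ 2 := by
  classical
  suffices h : ∀ S : Finset κ, ∃ z : κ → ℤ, (∀ k, |x k - z k| ≤ 1) ∧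
      ∑ i ∈ F, (∑ k ∈ S, a i k * (x k - z k)) ^ 2 ≤ ∑ i ∈ F, ∑ k ∈ S, a i k ^ 2 from
    h Finset.univ
  intro S
  induction S using Finset.induction_on with
  | empty =>
    refine ⟨fun k => ⌊x k⌋, fun k => ?_, by simp⟩
    rw [abs_le]
    constructor <;> linarith [Int.floor_le (x k), Int.lt_floor_add_one (x k)]
  | insert k S hk ih =>
    obtain ⟨z, hz1, hz2⟩ := ih
    set s : ι → ℝ := fun i => ∑ k ∈ S, a i k * (x k - z k) with hs
    obtain ⟨m, hm1, hm2⟩ : ∃ m : ℤ, |x k - m| ≤ 1 ∧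
        (x k - m) * (∑ i ∈ F, s i * a i k) ≤ 0 := by
      rcases le_total (∑ i ∈ F, s i * a i k) 0 with h | h
      · refine ⟨⌊x k⌋, ?_, ?_⟩
        · rw [abs_le]
          constructor <;> linarith [Int.floor_le (x k), Int.lt_floor_add_one (x k)]
        · exact mul_nonpos_of_nonneg_of_nonpos (by linarith [Int.floor_le (x k)]) h
      · refine ⟨⌊x k⌋ + 1, ?_, ?_⟩
        · rw [abs_le]; push_cast
          constructor <;> linarith [Int.floor_le (x k), Int.lt_floor_add_one (x k)]
        · refine mul_nonpos_of_nonpos_of_nonneg ?_ h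
          push_cast
          linarith [Int.lt_floor_add_one (x k)]
    refine ⟨Function.update z k m, fun l => ?_, ?_⟩
    · by_cases h : l = k
      · subst h; simpa using hm1
      · simpa [Function.update_of_ne h] using hz1 l
    · have h1 : ∀ i, ∑ l ∈ insert k S, a i l * (x l - (Function.update z k m l : ℤ)) =
          a i k * (x k - m) + s i := by
        intro i
        rw [Finset.sum_insert hk]
        congr 1
        · simp
        · apply Finset.sum_congr rfl
          intro l hl
          have : l ≠ k := fun h => hk (h ▸ hl)
          simp [Function.update_of_ne this]
      simp_rw [h1, Finset.sum_insert hk]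
      rw [Finset.sum_add_distrib]
      have h2 : ∑ i ∈ F, (a i k * (x k - m) + s i) ^ 2 =
          (x k - m) ^ 2 * ∑ i ∈ F, a i k ^ 2 + 2 * ((x k - m) * ∑ i ∈ F, s i * a i k) +
            ∑ i ∈ F, s i ^ 2 := by
        simp only [Finset.mul_sum, ← Finset.sum_add_distrib]
        apply Finset.sum_congr rfl
        intros; ring
      rw [h2]
      have h3 : (x k - m) ^ 2 ≤ 1 := by
        rw [← sq_abs]; exact pow_le_one₀ (abs_nonneg _) hm1
      have h4 : 0 ≤ ∑ i ∈ F, a i k ^ 2 := Finset.sum_nonneg fun i _ => sq_nonneg _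
      nlinarith

lemma count_lattice : ∃ K : ℝ, 0 ≤ K ∧ ∀ (κ : Type) [Fintype κ] [DecidableEq κ] (N : ℝ), 0 ≤ N →
    ∃ Z : Finset (κ → ℤ), (∀ z : κ → ℤ, ∑ k, (z k : ℝ) ^ 2 ≤ N ↔ z ∈ Z) ∧
      (Z.card : ℝ) ≤ Real.exp (N + K * Fintype.card κ) := by
  classical
  have hsum : Summable (fun k : ℤ => Real.exp (-(k : ℝ) ^ 2)) := by
    have h : Summable (fun k : ℕ => Real.exp (-(k : ℝ) ^ 2)) := by
      have hg : Summable (fun k : ℕ => (Real.exp (-1)) ^ k) :=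
        summable_geometric_of_lt_one (Real.exp_pos _).le (by simp)
      refine Summable.of_nonneg_of_le (fun k => (Real.exp_pos _).le) (fun k => ?_) hg
      rw [← Real.exp_nat_mul]
      apply Real.exp_le_exp.2
      have : (k : ℝ) ≤ (k : ℝ) ^ 2 := by
        have : k ≤ k ^ 2 := by nlinarith [Nat.zero_le k, sq_nonneg k, Nat.le_self_pow two_ne_zero k]
        exact_mod_cast this
      linarith
    apply Summable.of_nat_of_neg
    · simpa using h
    · simpa using h
  set K := ∑' k : ℤ, Real.exp (-(k : ℝ) ^ 2) with hK
  have hK0 : 0 ≤ K := tsum_nonneg fun k => (Real.exp_pos _).le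
  refine ⟨K, hK0, fun κ _ _ N hN => ?_⟩
  set m : ℤ := ⌈N⌉ with hm
  let P : Finset (κ → ℤ) := Fintype.piFinset fun _ : κ => Finset.Icc (-m) m
  refine ⟨P.filter (fun z => ∑ k, (z k : ℝ) ^ 2 ≤ N), fun z => ?_, ?_⟩
  · constructor
    · intro hz
      rw [Finset.mem_filter]
      refine ⟨?_, hz⟩
      simp only [P, Fintype.mem_piFinset, Finset.mem_Icc]
      intro k
      have h1 : (z k : ℝ) ^ 2 ≤ N :=
        (Finset.single_le_sum (f := fun k => (z k : ℝ) ^ 2) (fun i _ => sq_nonneg _)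
          (Finset.mem_univ k)).trans hz
      have h2 : ((z k ^ 2 : ℤ) : ℝ) ≤ m := by
        push_cast; exact h1.trans (Int.le_ceil N)
      have h3 : z k ^ 2 ≤ m := by exact_mod_cast h2
      have h4 : |z k| ≤ m := by
        refine le_trans ?_ h3
        rw [← sq_abs]
        exact Int.le_self_sq _
      exact abs_le.1 h4
    · intro hz
      exact (Finset.mem_filter.1 hz).2
  · calc ((P.filter (fun z => ∑ k, (z k : ℝ) ^ 2 ≤ N)).card : ℝ)
        = ∑ z ∈ P.filter (fun z => ∑ k, (z k : ℝ) ^ 2 ≤ N), 1 := by simp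
      _ ≤ ∑ z ∈ P.filter (fun z => ∑ k, (z k : ℝ) ^ 2 ≤ N),
            Real.exp N * ∏ k, Real.exp (-(z k : ℝ) ^ 2) := by
          apply Finset.sum_le_sum
          intro z hz
          have := (Finset.mem_filter.1 hz).2
          rw [← Real.exp_sum, ← Real.exp_add]
          apply Real.one_le_exp
          rw [Finset.sum_neg_distrib]
          linarith
      _ ≤ ∑ z ∈ P, Real.exp N * ∏ k, Real.exp (-(z k : ℝ) ^ 2) := by
          apply Finset.sum_le_sum_of_subset_of_nonneg (Finset.filter_subset _ _)
          intros; positivity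
      _ = Real.exp N * ∏ k : κ, ∑ j ∈ Finset.Icc (-m) m, Real.exp (-(j : ℝ) ^ 2) := by
          rw [← Finset.mul_sum, Finset.prod_univ_sum]
      _ ≤ Real.exp N * ∏ k : κ, Real.exp K := by
          gcongr with k
          refine (hsum.sum_le_tsum _ (fun _ _ => (Real.exp_pos _).le)).trans ?_
          linarith [Real.add_one_le_exp K]
      _ = _ := by
          rw [Finset.prod_const, Finset.card_univ, ← Real.exp_nat_mul, ← Real.exp_add, mul_comm K]

lemma paley {n : ℕ} (a : Fin n → ℝ) (m Q : ℝ) (hm : 0 < m) (hQ : 0 < Q)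
    (h1 : n * m ≤ ∑ i, a i) (h2 : ∑ i, a i ^ 2 ≤ n * Q) :
    m ^ 2 / (4 * Q) * n ≤ ((Finset.univ.filter (fun i => m / 2 ≤ a i)).card : ℝ) := by
  set S := Finset.univ.filter (fun i => m / 2 ≤ a i) with hS
  have e1 : ∑ i ∈ S, a i + ∑ i ∈ Finset.univ.filter (fun i => ¬ m / 2 ≤ a i), a i = ∑ i, a i :=
    Finset.sum_filter_add_sum_filter_not _ _ _
  have e2 : ∑ i ∈ Finset.univ.filter (fun i => ¬ m / 2 ≤ a i), a i ≤ n * (m / 2) := by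
    calc _ ≤ ∑ i ∈ Finset.univ.filter (fun i => ¬ m / 2 ≤ a i), m / 2 := by
          apply Finset.sum_le_sum
          intro i hi
          exact (not_le.1 (Finset.mem_filter.1 hi).2).le
      _ ≤ ∑ i : Fin n, m / 2 := by
          apply Finset.sum_le_sum_of_subset_of_nonneg (Finset.filter_subset _ _)
          intros; positivity
      _ = _ := by simp
  have e3 : n * (m / 2) ≤ ∑ i ∈ S, a i := by linarith
  have e4 : (∑ i ∈ S, a i) ^ 2 ≤ S.card * ∑ i ∈ S, a i ^ 2 := sq_sum_le_card_mul_sum_sq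
  have e5 : ∑ i ∈ S, a i ^ 2 ≤ n * Q := by
    refine le_trans ?_ h2
    apply Finset.sum_le_sum_of_subset_of_nonneg (Finset.filter_subset _ _)
    intros; positivity
  have e6 : (n * (m / 2)) ^ 2 ≤ S.card * (n * Q) := by
    calc _ ≤ (∑ i ∈ S, a i) ^ 2 := by gcongr
      _ ≤ _ := e4.trans (by gcongr)
  rcases Nat.eq_zero_or_pos n with h | h
  · subst h; simp
  · have hn : (0 : ℝ) < n := by exact_mod_cast h
    rw [div_mul_eq_mul_div, div_le_iff₀ (by positivity)]
    have : n * (m ^ 2 * n) ≤ n * (S.card * (4 * Q)) := by nlinarith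
    exact le_of_mul_le_mul_left this hn

/-- squared Frobenius norm -/
def frob {d : ℕ} (M : Matrix (Fin d) (Fin d) ℝ) : ℝ := ∑ k, M k ⬝ᵥ M k

lemma frob_nonneg {d : ℕ} (M : Matrix (Fin d) (Fin d) ℝ) : 0 ≤ frob M :=
  Finset.sum_nonneg fun k _ => dot_nonneg _

lemma fourth {d n : ℕ} (hn : 0 < n) (v : Fin n → Fin d → ℝ) (C₃ : ℝ) (hC : 0 < C₃)
    (h : ∀ x : Fin d → ℝ,
        (n : ℝ)⁻¹ * ∑ i, (v i ⬝ᵥ x) ^ 4 ≤ C₃ * (x ⬝ᵥ x) ^ 2 / (d : ℝ) ^ 2)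
    (M : Matrix (Fin d) (Fin d) ℝ) :
    ∑ i, (M.mulVec (v i) ⬝ᵥ M.mulVec (v i)) ^ 2 ≤ n * (C₃ * frob M ^ 2 / (d : ℝ) ^ 2) := by
  have hn' : (0 : ℝ) < n := by exact_mod_cast hn
  set D : ℝ := n * (C₃ / (d : ℝ) ^ 2) with hD
  have hD0 : 0 ≤ D := by positivity
  have h' : ∀ k, ∑ i, (M k ⬝ᵥ v i) ^ 4 ≤ D * (M k ⬝ᵥ M k) ^ 2 := by
    intro k
    have := h (M k)
    rw [inv_mul_le_iff₀ hn'] at this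
    simp_rw [dotProduct_comm (M k) (v _)]
    refine this.trans (le_of_eq ?_)
    rw [hD]; ring
  have hkl : ∀ k l, ∑ i, (M k ⬝ᵥ v i) ^ 2 * (M l ⬝ᵥ v i) ^ 2 ≤
      D * ((M k ⬝ᵥ M k) * (M l ⬝ᵥ M l)) := by
    intro k l
    apply abs_le_of_sq_le_sq' _ (by have := dot_nonneg (M k); have := dot_nonneg (M l); positivity) |>.2
    calc _ ≤ (∑ i, ((M k ⬝ᵥ v i) ^ 2) ^ 2) * ∑ i, ((M l ⬝ᵥ v i) ^ 2) ^ 2 :=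
          Finset.sum_mul_sq_le_sq_mul_sq _ _ _
      _ = (∑ i, (M k ⬝ᵥ v i) ^ 4) * ∑ i, (M l ⬝ᵥ v i) ^ 4 := by
          simp_rw [← pow_mul]
      _ ≤ (D * (M k ⬝ᵥ M k) ^ 2) * (D * (M l ⬝ᵥ M l) ^ 2) := by
          apply mul_le_mul (h' k) (h' l) (Finset.sum_nonneg fun i _ => by positivity) (by positivity)
      _ = _ := by ring
  have e : ∀ i, (M.mulVec (v i) ⬝ᵥ M.mulVec (v i)) ^ 2 =
      ∑ k, ∑ l, (M k ⬝ᵥ v i) ^ 2 * (M l ⬝ᵥ v i) ^ 2 := by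
    intro i
    rw [← Finset.sum_mul_sum, ← pow_two]
    congr 1
    simp [dotProduct, mulVec, pow_two]
  simp_rw [e]
  rw [Finset.sum_comm]
  calc _ = ∑ k, ∑ l, ∑ i, (M k ⬝ᵥ v i) ^ 2 * (M l ⬝ᵥ v i) ^ 2 := by
        apply Finset.sum_congr rfl
        intro k _
        rw [Finset.sum_comm]
    _ ≤ ∑ k, ∑ l, D * ((M k ⬝ᵥ M k) * (M l ⬝ᵥ M l)) :=
        Finset.sum_le_sum fun k _ => Finset.sum_le_sum fun l _ => hkl k l
    _ = D * (frob M * frob M) := by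
        simp_rw [← Finset.mul_sum]
        rw [frob, ← Finset.sum_mul]
    _ = _ := by rw [hD]; ring

lemma second {d n : ℕ} (hn : 0 < n) (v : Fin n → Fin d → ℝ) (c₂ : ℝ)
    (h : (((n : ℝ)⁻¹ • ∑ i, vecMulVec (v i) (v i)) -
          (c₂ / d) • (1 : Matrix (Fin d) (Fin d) ℝ)).PosSemidef)
    (M : Matrix (Fin d) (Fin d) ℝ) :
    n * (c₂ / d * frob M) ≤ ∑ i, M.mulVec (v i) ⬝ᵥ M.mulVec (v i) := by
  have hn' : (0 : ℝ) < n := by exact_mod_cast hn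
  have h' : ∀ x : Fin d → ℝ, n * (c₂ / d * (x ⬝ᵥ x)) ≤ ∑ i, (x ⬝ᵥ v i) ^ 2 := by
    intro x
    have := h.dotProduct_mulVec_nonneg x
    rw [sub_mulVec, smul_mulVec, smul_mulVec, one_mulVec, sum_mulVec, dotProduct_sub,
      dotProduct_smul, dotProduct_smul, dotProduct_sum] at this
    simp only [star_trivial, smul_eq_mul, vecMulVec_mulVec] at this
    rw [sub_nonneg, le_inv_mul_iff₀ hn'] at this
    refine this.trans (le_of_eq ?_)
    apply Finset.sum_congr rfl
    intro i _
    simp [dotProduct_comm (v i) x, pow_two]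
  calc n * (c₂ / d * frob M) = ∑ k, n * (c₂ / d * (M k ⬝ᵥ M k)) := by
        simp_rw [← Finset.mul_sum]; rfl
    _ ≤ ∑ k, ∑ i, (M k ⬝ᵥ v i) ^ 2 := Finset.sum_le_sum fun k _ => h' _
    _ = _ := by
        rw [Finset.sum_comm]
        simp [dotProduct, mulVec, pow_two]

lemma dot_sq_le {d : ℕ} (x y : Fin d → ℝ) : (x ⬝ᵥ y) ^ 2 ≤ (x ⬝ᵥ x) * (y ⬝ᵥ y) := by
  have := Finset.sum_mul_sq_le_sq_mul_sq Finset.univ x y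
  simpa [dotProduct, pow_two] using this

/-- cast of an integer vector -/
def castv {d : ℕ} (z : Fin d → ℤ) : Fin d → ℝ := fun k => (z k : ℝ)

/-- the set of targets that are good for the direction `w` -/
def goodSet (d : ℕ) (w : Fin d → ℝ) : Set (Fin d → ℝ) :=
  {u | u ⬝ᵥ u ≤ d ∧ Real.sqrt (Real.log d) / 2 * Real.sqrt ((w ⬝ᵥ w) / d) ≤ u ⬝ᵥ w}

lemma goodSet_compl (d : ℕ) (hd : 0 < d) (w : Fin d → ℝ) (hw : 0 < w ⬝ᵥ w)
    (hx : 16 ≤ Real.exp (3 / 4 * Real.log d)) :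
    stdGaussianVec d (goodSet d w)ᶜ ≤
      ENNReal.ofReal (Real.exp (-(Real.exp (-(Real.log d / 4)) / 16))) := by
  have hd' : (0 : ℝ) < d := by exact_mod_cast hd
  have hlog : 0 ≤ Real.log d := Real.log_nonneg (by exact_mod_cast hd)
  set p := Real.exp (-(Real.log d / 4)) / 16 with hp
  set A : Set (Fin d → ℝ) :=
    {u | Real.sqrt (Real.log d) / 2 * Real.sqrt ((w ⬝ᵥ w) / d) ≤ u ⬝ᵥ w} with hA
  set N : Set (Fin d → ℝ) := {u | (d : ℝ) < u ⬝ᵥ u} with hN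
  have hAm : MeasurableSet A :=
    measurableSet_le measurable_const (by unfold dotProduct; fun_prop)
  have h1 : ENNReal.ofReal (2 * p) ≤ stdGaussianVec d A := by
    have := tail_lower d hd w hw (Real.sqrt (Real.log d) / 2) (by positivity)
    refine le_trans (le_of_eq ?_) this
    congr 1
    rw [hp, div_pow, Real.sq_sqrt hlog]
    have : -(Real.log d / 4) = -(Real.log d / 2 ^ 2) := by ring
    rw [this]
    ring
  have h2 : stdGaussianVec d N ≤ ENNReal.ofReal p := by
    refine (norm_markov d hd d hd').trans (ENNReal.ofReal_le_ofReal ?_)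
    rw [hp, le_div_iff₀ (by norm_num)]
    have e : Real.exp (3 / 4 * Real.log d) * Real.exp (-(Real.log d / 4)) * (1/d)  = 
        Real.exp (-(Real.log d / 4))*(1/d) * Real.exp (3 / 4 * Real.log d) := by ring
    have e2 : (1 : ℝ) / d = Real.exp (-Real.log d) := by
      rw [Real.exp_neg, Real.exp_log hd', one_div]
    have e3 : Real.exp (-Real.log d) * Real.exp (3 / 4 * Real.log d) =
        Real.exp (-(Real.log d / 4)) := by
      rw [← Real.exp_add]; congr 1; ring
    rw [e2, ← e3]
    gcongr
  have hsub : (goodSet d w)ᶜ ⊆ Aᶜ ∪ N := by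
    intro u hu
    by_cases h : u ∈ A
    · right
      by_contra hn
      exact hu ⟨not_lt.1 hn, h⟩
    · left; exact h
  have hp0 : 0 ≤ p := by positivity
  have hp1 : 2 * p ≤ 1 := by
    have : Real.exp (-(Real.log d / 4)) ≤ 1 := Real.exp_le_one_iff.2 (by linarith)
    rw [hp]; linarith
  calc stdGaussianVec d (goodSet d w)ᶜ ≤ stdGaussianVec d Aᶜ + stdGaussianVec d N :=
        (measure_mono hsub).trans (measure_union_le _ _)
    _ ≤ (1 - ENNReal.ofReal (2 * p)) + ENNReal.ofReal p := by
        rw [prob_compl_eq_one_sub hAm]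
        gcongr
    _ = ENNReal.ofReal (1 - p) := by
        rw [← ENNReal.ofReal_one, ← ENNReal.ofReal_sub _ (by positivity),
          ← ENNReal.ofReal_add (by linarith) hp0]
        congr 1; ring
    _ ≤ _ := by
        apply ENNReal.ofReal_le_ofReal
        linarith [Real.add_one_le_exp (-p)]

lemma sphere_det (d : ℕ) (hd : 64 ≤ d) (hlog : 1 ≤ Real.log d) (w : Fin d → ℝ)
    (hw : 0 < w ⬝ᵥ w) :
    ∃ z : Fin d → ℤ, (∀ k, z k ∈ Finset.Icc (-((d : ℤ) ^ 2 + 1)) ((d : ℤ) ^ 2 + 1)) ∧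
      0 < castv z ⬝ᵥ castv z ∧
      ∀ u ∈ goodSet d (castv z),
        1 / 8 * Real.sqrt (Real.log d / d) * Real.sqrt (w ⬝ᵥ w) ≤ u ⬝ᵥ w := by
  have hd' : (64 : ℝ) ≤ d := by exact_mod_cast hd
  set s := Real.sqrt (w ⬝ᵥ w) with hs
  have hs0 : 0 < s := Real.sqrt_pos.2 hw
  have hs2 : s ^ 2 = w ⬝ᵥ w := Real.sq_sqrt hw.le
  set L : ℝ := (d : ℝ) ^ 2 with hL
  have hL0 : 0 < L := by positivity
  set w' : Fin d → ℝ := (L / s) • w with hw'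
  have hww : w' ⬝ᵥ w' = L ^ 2 := by
    rw [hw', smul_dotProduct, dotProduct_smul, ← hs2]
    simp only [smul_eq_mul]
    field_simp
  set z : Fin d → ℤ := fun k => ⌊w' k⌋ with hz
  set e : Fin d → ℝ := w' - castv z with he
  have he1 : ∀ k, 0 ≤ e k ∧ e k ≤ 1 := by
    intro k
    simp only [he, hz, castv, Pi.sub_apply]
    constructor <;> linarith [Int.floor_le (w' k), Int.lt_floor_add_one (w' k)]
  have hee : e ⬝ᵥ e ≤ d := by
    calc e ⬝ᵥ e ≤ ∑ k : Fin d, (1 : ℝ) := by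
          apply Finset.sum_le_sum
          intro k _
          have := he1 k
          nlinarith
      _ = d := by simp
  have hwz : w' = castv z + e := by rw [he]; simp
  have hzz : L ^ 2 / 4 ≤ castv z ⬝ᵥ castv z := by
    have h1 : w' ⬝ᵥ w' ≤ 2 * (castv z ⬝ᵥ castv z) + 2 * (e ⬝ᵥ e) := by
      rw [hwz]
      simp only [dotProduct, Finset.mul_sum, ← Finset.sum_add_distrib, Pi.add_apply]
      apply Finset.sum_le_sum
      intro k _
      nlinarith [sq_nonneg (castv z k - e k)]
    have h2 : 4 * (d : ℝ) ≤ L ^ 2 := by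
      rw [hL]
      have : (64 : ℝ) * d ≤ d ^ 2 := by nlinarith
      have : (1 : ℝ) ≤ d ^ 2 := by nlinarith
      nlinarith
    rw [hww] at h1
    linarith
  refine ⟨z, fun k => ?_, lt_of_lt_of_le (by positivity) hzz, ?_⟩
  · have h1 : (w' k) ^ 2 ≤ L ^ 2 := by
      rw [← hww]
      have := Finset.single_le_sum (f := fun k => w' k * w' k) (fun i _ => mul_self_nonneg _)
          (Finset.mem_univ k)
      simpa [dotProduct, pow_two] using this
    have h2 := abs_le_of_sq_le_sq' h1 hL0.le
    rw [Finset.mem_Icc]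
    constructor
    · have : ((-((d : ℤ) ^ 2 + 1) : ℤ) : ℝ) ≤ (z k : ℝ) := by
        push_cast
        simp only [hz]
        linarith [Int.lt_floor_add_one (w' k), h2.1]
      exact_mod_cast this
    · have : (z k : ℝ) ≤ (((d : ℤ) ^ 2 + 1 : ℤ) : ℝ) := by
        push_cast
        simp only [hz]
        linarith [Int.floor_le (w' k), h2.2]
      exact_mod_cast this
  · rintro u ⟨hu1, hu2⟩
    have h1 : u ⬝ᵥ w' = u ⬝ᵥ castv z + u ⬝ᵥ e := by rw [hwz, dotProduct_add]
    have h2 : -(d : ℝ) ≤ u ⬝ᵥ e := by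
      have : (u ⬝ᵥ e) ^ 2 ≤ (d : ℝ) ^ 2 := by
        refine (dot_sq_le u e).trans ?_
        rw [pow_two]
        exact mul_le_mul hu1 hee (dot_nonneg e) (by positivity)
      exact (abs_le_of_sq_le_sq' this (by positivity)).1
    have h3 : u ⬝ᵥ w' = L / s * (u ⬝ᵥ w) := by rw [hw', dotProduct_smul, smul_eq_mul]
    set r := Real.sqrt (Real.log d / d) with hr
    have h4 : r * L / 4 ≤ Real.sqrt (Real.log d) / 2 * Real.sqrt ((castv z ⬝ᵥ castv z) / d) := by
      have : L / 2 ≤ Real.sqrt (castv z ⬝ᵥ castv z) := by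
        apply Real.le_sqrt_of_sq_le
        linarith
      rw [hr, Real.sqrt_div (by linarith), Real.sqrt_div (dot_nonneg _)]
      calc _ = Real.sqrt (Real.log d) / 2 * ((L / 2) / Real.sqrt d) := by ring
        _ ≤ _ := by gcongr
    have h5 : (d : ℝ) ≤ r * L / 8 := by
      have hq : 8 / (d : ℝ) ≤ r := by
        apply Real.le_sqrt_of_sq_le
        rw [div_pow, div_le_div_iff₀ (by positivity) (by positivity)]
        nlinarith
      calc (d : ℝ) = 8 / d * L / 8 := by rw [hL]; field_simp
        _ ≤ _ := by gcongr
    have h6 : r * L / 8 ≤ L / s * (u ⬝ᵥ w) := by linarith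
    have h7 : L * (1 / 8 * r * s) ≤ L * (u ⬝ᵥ w) := by
      have : s * (r * L / 8) ≤ s * (L / s * (u ⬝ᵥ w)) := by gcongr
      have e : s * (L / s * (u ⬝ᵥ w)) = L * (u ⬝ᵥ w) := by field_simp
      linarith
    exact le_of_mul_le_mul_left h7 hL0

lemma sphere_bound (d n : ℕ) (hd : 64 ≤ d) (hlog : 1 ≤ Real.log d)
    (hx : 16 ≤ Real.exp (3 / 4 * Real.log d)) :
    uModel d n {u | ∃ w : Fin d → ℝ, 0 < w ⬝ᵥ w ∧
      ∀ j, u j ⬝ᵥ w < 1 / 8 * Real.sqrt (Real.log d / d) * Real.sqrt (w ⬝ᵥ w)} ≤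
    ENNReal.ofReal (Real.exp (3 * d * Real.log d - n * (Real.exp (-(Real.log d / 4)) / 16))) := by
  classical
  set p := Real.exp (-(Real.log d / 4)) / 16 with hp
  let Z : Finset (Fin d → ℤ) := (Fintype.piFinset fun _ : Fin d =>
    Finset.Icc (-((d : ℤ) ^ 2 + 1)) ((d : ℤ) ^ 2 + 1)).filter
      (fun z => 0 < castv z ⬝ᵥ castv z)
  have hd' : (64 : ℝ) ≤ d := by exact_mod_cast hd
  have hcard : (Z.card : ℝ) ≤ Real.exp (3 * d * Real.log d) := by
    have h1 : Z.card ≤ (2 * d ^ 2 + 3) ^ d := by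
      refine (Finset.card_filter_le _ _).trans (le_of_eq ?_)
      rw [Fintype.card_piFinset]
      simp only [Int.card_Icc, Finset.prod_const, Finset.card_univ, Fintype.card_fin]
      congr 1
      have : ((d : ℤ) ^ 2 + 1 + 1 - -((d : ℤ) ^ 2 + 1)) = ((2 * d ^ 2 + 3 : ℕ) : ℤ) := by
        push_cast; ring
      rw [this, Int.toNat_natCast]
    have h2 : 2 * d ^ 2 + 3 ≤ d ^ 3 := by nlinarith [sq_nonneg d]
    have h3 : Z.card ≤ (d ^ 3) ^ d := h1.trans (Nat.pow_le_pow_left h2 d)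
    have h4 : (Z.card : ℝ) ≤ ((d : ℝ) ^ 3) ^ d := by exact_mod_cast h3
    refine h4.trans (le_of_eq ?_)
    have : Real.exp (3 * d * Real.log d) = Real.exp (Real.log d) ^ (3 * d) := by
      rw [← Real.exp_nat_mul]; push_cast; rfl
    rw [this, Real.exp_log (by linarith), pow_mul]
  have hz : ∀ z ∈ Z, uModel d n {u | ∀ j, u j ∈ (goodSet d (castv z))ᶜ} ≤
      ENNReal.ofReal (Real.exp (-(n * p))) := by
    intro z hz
    have hz' := (Finset.mem_filter.1 hz).2
    have e : {u : Fin n → Fin d → ℝ | ∀ j, u j ∈ (goodSet d (castv z))ᶜ} =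
        Set.pi Set.univ (fun _ => (goodSet d (castv z))ᶜ) := by
      ext u; simp
    rw [e, uModel, Measure.pi_pi, Finset.prod_const, Finset.card_univ, Fintype.card_fin]
    calc _ ≤ (ENNReal.ofReal (Real.exp (-p))) ^ n := by
          gcongr
          exact goodSet_compl d (by omega) _ hz' hx
      _ = _ := by
          rw [← ENNReal.ofReal_pow (Real.exp_pos _).le, ← Real.exp_nat_mul]
          congr 2; ring
  calc _ ≤ uModel d n (⋃ z ∈ Z, {u | ∀ j, u j ∈ (goodSet d (castv z))ᶜ}) := by
        apply measure_mono
        rintro u ⟨w, hw, hu⟩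
        obtain ⟨z, hz1, hz2, hz3⟩ := sphere_det d hd hlog w hw
        simp only [Set.mem_iUnion]
        refine ⟨z, ?_, ?_⟩
        · rw [Finset.mem_filter, Fintype.mem_piFinset]
          exact ⟨hz1, hz2⟩
        · intro j hj
          exact absurd (hz3 _ hj) (not_le.2 (hu j))
    _ ≤ ∑ z ∈ Z, ENNReal.ofReal (Real.exp (-(n * p))) :=
        (measure_biUnion_finset_le _ _).trans (Finset.sum_le_sum hz)
    _ ≤ _ := by
        rw [Finset.sum_const, nsmul_eq_mul, ← ENNReal.ofReal_natCast,
          ← ENNReal.ofReal_mul (by positivity)]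
        apply ENNReal.ofReal_le_ofReal
        rw [sub_eq_add_neg, Real.exp_add]
        gcongr

/-- real matrix from integer entries -/
def toMat {d : ℕ} (z : Fin d × Fin d → ℤ) : Matrix (Fin d) (Fin d) ℝ :=
  fun k l => (z (k, l) : ℝ)

lemma dot_mulVec_eq {d : ℕ} (u v : Fin d → ℝ) (M : Matrix (Fin d) (Fin d) ℝ) :
    u ⬝ᵥ M.mulVec v = ∑ q : Fin d × Fin d, u q.1 * v q.2 * M q.1 q.2 := by
  rw [Fintype.sum_prod_type]
  simp only [dotProduct, mulVec, Finset.mul_sum]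
  refine Finset.sum_congr rfl fun k _ => Finset.sum_congr rfl fun l _ => ?_
  ring

lemma frob_eq {d : ℕ} (M : Matrix (Fin d) (Fin d) ℝ) :
    frob M = ∑ q : Fin d × Fin d, M q.1 q.2 ^ 2 := by
  rw [Fintype.sum_prod_type]
  simp [frob, dotProduct, pow_two]

lemma markov_card {ι : Type*} (F : Finset ι) (f : ι → ℝ) (A t M : ℝ) (ht : 0 < t)
    (hf : ∀ i ∈ F, t ≤ f i) (hs : ∑ i ∈ F, f i ≤ A) (hA : A ≤ t * M) :
    (F.card : ℝ) ≤ M := by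
  have h1 : F.card * t ≤ ∑ i ∈ F, f i := by
    rw [← nsmul_eq_mul, ← Finset.sum_const]
    exact Finset.sum_le_sum hf
  have h2 : t * F.card ≤ t * M := by linarith
  exact le_of_mul_le_mul_left h2 ht

lemma det_main {d n : ℕ} (hd : 0 < d) (hn : 0 < n) (hlog : 0 ≤ Real.log d)
    (C₁ c₂ C₃ θ R K B τ : ℝ)
    (hc₂ : 0 < c₂) (hC₃ : 0 < C₃) (hR : 0 < R) (hK : 0 < K) (hB : 0 < B)
    (hθ : θ = c₂ ^ 2 / (4 * C₃)) (hKR : 4 * (R * C₁ ^ 2) ≤ θ * K ^ 2)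
    (hBB : 64 * C₃ ≤ θ * B ^ 2)
    (hτ : τ = Real.sqrt (c₂ / 2) / 16 * Real.sqrt (Real.log d)) (hτK : K ≤ τ)
    (v : Fin n → Fin d → ℝ)
    (hv1 : ∀ i, v i ⬝ᵥ v i ≤ C₁ ^ 2)
    (hv2 : (((n : ℝ)⁻¹ • ∑ i, vecMulVec (v i) (v i)) -
          (c₂ / d) • (1 : Matrix (Fin d) (Fin d) ℝ)).PosSemidef)
    (hv3 : ∀ x : Fin d → ℝ,
        (n : ℝ)⁻¹ * ∑ i, (v i ⬝ᵥ x) ^ 4 ≤ C₃ * (x ⬝ᵥ x) ^ 2 / (d : ℝ) ^ 2)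
    (u : Fin n → Fin d → ℝ)
    (hu1 : ∀ F : Finset (Fin n), (∀ i ∈ F, R < u i ⬝ᵥ u i) → (F.card : ℝ) < θ / 4 * n)
    (hu2 : ∀ w : Fin d → ℝ, 0 < w ⬝ᵥ w →
      ∃ j, 1 / 8 * Real.sqrt (Real.log d / d) * Real.sqrt (w ⬝ᵥ w) ≤ u j ⬝ᵥ w)
    (W : Matrix (Fin d) (Fin d) ℝ) (hW : frob W = (d : ℝ) ^ 2)
    (hWu : ∀ i j, u j ⬝ᵥ W.mulVec (v i) ≤ u i ⬝ᵥ W.mulVec (v i)) :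
    ∃ z : Fin d × Fin d → ℤ, ∑ q, (z q : ℝ) ^ 2 ≤ 4 * (d : ℝ) ^ 2 ∧
      ∃ F : Finset (Fin n),
        F ⊆ Finset.univ.filter (fun i =>
          (toMat z).mulVec (v i) ⬝ᵥ (toMat z).mulVec (v i) ≤ B * d) ∧
        θ / 4 * n ≤ (F.card : ℝ) ∧
        ∀ i ∈ F, u i ∈ {y : Fin d → ℝ | τ ≤ y ⬝ᵥ (toMat z).mulVec (v i)} := by
  classical
  have hd' : (0 : ℝ) < d := by exact_mod_cast hd
  have hn' : (0 : ℝ) < n := by exact_mod_cast hn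
  have hθ0 : 0 < θ := by rw [hθ]; positivity
  set S := Finset.univ.filter (fun i => c₂ * d / 2 ≤ W.mulVec (v i) ⬝ᵥ W.mulVec (v i)) with hS
  have hScard : θ * n ≤ (S.card : ℝ) := by
    have := paley (fun i => W.mulVec (v i) ⬝ᵥ W.mulVec (v i)) (c₂ * d) (C₃ * (d : ℝ) ^ 2)
      (by positivity) (by positivity)
      (by
        refine le_trans (le_of_eq ?_) (second hn v c₂ hv2 W)
        rw [hW]; field_simp)
      (by
        refine (fourth hn v C₃ hC₃ hv3 W).trans (le_of_eq ?_)
        rw [hW]; field_simp)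
    refine le_trans (le_of_eq ?_) this
    rw [hθ]; field_simp
  set Gb := Finset.univ.filter (fun i => R < u i ⬝ᵥ u i) with hGb
  have hGcard : (Gb.card : ℝ) < θ / 4 * n := hu1 Gb fun i hi => (Finset.mem_filter.1 hi).2
  set F := S \ Gb with hF
  obtain ⟨z, hz1, hz2⟩ := rounding F (fun i (q : Fin d × Fin d) => u i q.1 * v i q.2)
    (fun q => W q.1 q.2)
  have herr : ∀ i, ∑ q : Fin d × Fin d, u i q.1 * v i q.2 * (W q.1 q.2 - z q) =
      u i ⬝ᵥ W.mulVec (v i) - u i ⬝ᵥ (toMat z).mulVec (v i) := by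
    intro i
    rw [dot_mulVec_eq, dot_mulVec_eq, ← Finset.sum_sub_distrib]
    exact Finset.sum_congr rfl fun q _ => by simp only [toMat]; ring
  simp_rw [herr] at hz2
  have hz3 : ∑ i ∈ F, ∑ q : Fin d × Fin d, (u i q.1 * v i q.2) ^ 2 ≤ n * (R * C₁ ^ 2) := by
    calc _ ≤ ∑ i ∈ F, R * C₁ ^ 2 := by
          apply Finset.sum_le_sum
          intro i hi
          have h1 : u i ⬝ᵥ u i ≤ R := by
            have := (Finset.mem_sdiff.1 hi).2
            simpa [hGb] using this
          have h2 : ∑ q : Fin d × Fin d, (u i q.1 * v i q.2) ^ 2 =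
              (u i ⬝ᵥ u i) * (v i ⬝ᵥ v i) := by
            rw [Fintype.sum_prod_type]
            simp only [dotProduct, Finset.sum_mul_sum]
            refine Finset.sum_congr rfl fun k _ => Finset.sum_congr rfl fun l _ => ?_
            ring
          rw [h2]
          exact mul_le_mul h1 (hv1 i) (dot_nonneg _) hR.le
      _ ≤ ∑ i : Fin n, R * C₁ ^ 2 := by
          apply Finset.sum_le_sum_of_subset_of_nonneg (Finset.subset_univ _)
          intros; positivity
      _ = _ := by simp
  set Rb := F.filter (fun i => K < u i ⬝ᵥ W.mulVec (v i) - u i ⬝ᵥ (toMat z).mulVec (v i))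
    with hRb
  have hRcard : (Rb.card : ℝ) ≤ θ / 4 * n := by
    apply markov_card Rb
      (fun i => (u i ⬝ᵥ W.mulVec (v i) - u i ⬝ᵥ (toMat z).mulVec (v i)) ^ 2)
      (n * (R * C₁ ^ 2)) (K ^ 2) _ (by positivity)
    · intro i hi
      have := (Finset.mem_filter.1 hi).2
      exact pow_le_pow_left₀ hK.le this.le 2
    · refine le_trans ?_ (hz2.trans hz3)
      apply Finset.sum_le_sum_of_subset_of_nonneg (Finset.filter_subset _ _)
      intros; positivity
    · nlinarith
  have hfz : ∑ q, (z q : ℝ) ^ 2 ≤ 4 * (d : ℝ) ^ 2 := by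
    calc ∑ q, (z q : ℝ) ^ 2 ≤ ∑ q : Fin d × Fin d, (2 * W q.1 q.2 ^ 2 + 2) := by
          apply Finset.sum_le_sum
          intro q _
          have h1 : (W q.1 q.2 - z q) ^ 2 ≤ 1 := by
            rw [← sq_abs]; exact pow_le_one₀ (abs_nonneg _) (hz1 q)
          nlinarith [sq_nonneg (2 * W q.1 q.2 - z q)]
      _ = 2 * frob W + 2 * (d : ℝ) ^ 2 := by
          rw [Finset.sum_add_distrib, ← Finset.mul_sum, frob_eq]
          simp; ring
      _ = _ := by rw [hW]; ring
  have hfz' : frob (toMat z) ≤ 4 * (d : ℝ) ^ 2 := by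
    rw [frob_eq]; exact hfz
  set Tb := Finset.univ.filter (fun i =>
    B * d < (toMat z).mulVec (v i) ⬝ᵥ (toMat z).mulVec (v i)) with hTb
  have hTcard : (Tb.card : ℝ) ≤ θ / 4 * n := by
    apply markov_card Tb
      (fun i => ((toMat z).mulVec (v i) ⬝ᵥ (toMat z).mulVec (v i)) ^ 2)
      (n * (C₃ * (4 * (d : ℝ) ^ 2) ^ 2 / (d : ℝ) ^ 2)) ((B * d) ^ 2) _ (by positivity)
    · intro i hi
      have := (Finset.mem_filter.1 hi).2
      exact pow_le_pow_left₀ (by positivity) this.le 2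
    · calc _ ≤ ∑ i, ((toMat z).mulVec (v i) ⬝ᵥ (toMat z).mulVec (v i)) ^ 2 := by
            apply Finset.sum_le_sum_of_subset_of_nonneg (Finset.filter_subset _ _)
            intros; positivity
        _ ≤ _ := fourth hn v C₃ hC₃ hv3 _
        _ ≤ _ := by
            have := frob_nonneg (toMat z)
            gcongr
    · have e1 : n * (C₃ * (4 * (d : ℝ) ^ 2) ^ 2 / (d : ℝ) ^ 2) = (64 * C₃) * (n * d ^ 2 / 4) := by
        field_simp; ring
      have e2 : (B * d) ^ 2 * (θ / 4 * n) = (θ * B ^ 2) * (n * d ^ 2 / 4) := by ring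
      rw [e1, e2]
      gcongr
  refine ⟨z, hfz, (F \ Rb) \ Tb, ?_, ?_, ?_⟩
  · intro i hi
    have := (Finset.mem_sdiff.1 hi).2
    simpa [hTb] using this
  · have h1 := Finset.le_card_sdiff Gb S
    have h2 := Finset.le_card_sdiff Rb F
    have h3 := Finset.le_card_sdiff Tb (F \ Rb)
    rw [← hF] at h1
    have h4 : S.card ≤ ((F \ Rb) \ Tb).card + Tb.card + Rb.card + Gb.card := by omega
    have h5 : (S.card : ℝ) ≤ (((F \ Rb) \ Tb).card : ℝ) + Tb.card + Rb.card + Gb.card := by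
      exact_mod_cast h4
    linarith
  · intro i hi
    have hi1 := (Finset.mem_sdiff.1 hi).1
    have hiF := (Finset.mem_sdiff.1 hi1).1
    have hiR := (Finset.mem_sdiff.1 hi1).2
    have hiS := (Finset.mem_filter.1 (Finset.mem_sdiff.1 hiF).1).2
    have hK' : u i ⬝ᵥ W.mulVec (v i) - u i ⬝ᵥ (toMat z).mulVec (v i) ≤ K := by
      by_contra h
      exact hiR (Finset.mem_filter.2 ⟨hiF, not_le.1 h⟩)
    obtain ⟨j, hj⟩ := hu2 (W.mulVec (v i)) (lt_of_lt_of_le (by positivity) hiS)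
    have h1 : 2 * τ ≤ 1 / 8 * Real.sqrt (Real.log d / d) *
        Real.sqrt (W.mulVec (v i) ⬝ᵥ W.mulVec (v i)) := by
      calc 2 * τ = 1 / 8 * Real.sqrt (Real.log d / d) * Real.sqrt (c₂ * d / 2) := by
            rw [hτ, Real.sqrt_div hlog, show c₂ * d / 2 = c₂ / 2 * d by ring,
              Real.sqrt_mul (by positivity)]
            have : 0 < Real.sqrt d := Real.sqrt_pos.2 hd'
            field_simp
            ring
        _ ≤ _ := by gcongr
    have h2 := hWu i j
    show τ ≤ u i ⬝ᵥ (toMat z).mulVec (v i)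
    linarith

lemma scale {d n : ℕ} (hd : 0 < d) (hn : 2 ≤ n) (u v : Fin n → Fin d → ℝ)
    (W : Matrix (Fin d) (Fin d) ℝ)
    (hW : ∀ i j : Fin n, j ≠ i → u j ⬝ᵥ W.mulVec (v i) < u i ⬝ᵥ W.mulVec (v i)) :
    ∃ W' : Matrix (Fin d) (Fin d) ℝ, frob W' = (d : ℝ) ^ 2 ∧
      ∀ i j, u j ⬝ᵥ W'.mulVec (v i) ≤ u i ⬝ᵥ W'.mulVec (v i) := by
  have hf : 0 < frob W := by
    rcases (frob_nonneg W).lt_or_eq with h | h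
    · exact h
    · exfalso
      rw [frob_eq] at h
      have h0 := (Finset.sum_eq_zero_iff_of_nonneg (fun q _ => sq_nonneg _)).1 h.symm
      have hW0 : W = 0 := by
        ext k l
        have := h0 (k, l) (Finset.mem_univ _)
        simpa using this
      have := hW ⟨0, by omega⟩ ⟨1, by omega⟩ (by simp)
      simp [hW0] at this
  set s := Real.sqrt (frob W) with hs
  have hs0 : 0 < s := Real.sqrt_pos.2 hf
  have hs2 : s ^ 2 = frob W := Real.sq_sqrt hf.le
  refine ⟨(d / s) • W, ?_, ?_⟩
  · rw [frob_eq]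
    simp only [Matrix.smul_apply, smul_eq_mul, mul_pow, ← Finset.mul_sum]
    rw [← frob_eq, ← hs2]
    field_simp
  · intro i j
    by_cases h : j = i
    · rw [h]
    · simp only [smul_mulVec, dotProduct_smul, smul_eq_mul]
      have := (hW i j h).le
      gcongr

lemma eventually_conditions (C' γ A K : ℝ) (hC' : 0 < C') (hγ : 0 < γ) (hA : 0 < A) :
    ∀ᶠ x : ℝ in atTop, 1 ≤ x ∧ 16 ≤ Real.exp (3 / 4 * x) ∧
      64 * x ^ 2 ≤ C' * Real.exp (3 / 4 * x) ∧ 4 ≤ γ * x ∧ x ≤ C' * Real.exp x ∧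
      K ≤ A * Real.sqrt x := by
  have h34 : Tendsto (fun x : ℝ => 3 / 4 * x) atTop atTop :=
    tendsto_id.const_mul_atTop (by norm_num)
  have e1 : ∀ᶠ x : ℝ in atTop, 1 ≤ x := eventually_ge_atTop 1
  have e2 : ∀ᶠ x : ℝ in atTop, 16 ≤ Real.exp (3 / 4 * x) :=
    (Real.tendsto_exp_atTop.comp h34).eventually_ge_atTop 16
  have e3 : ∀ᶠ x : ℝ in atTop, 64 * x ^ 2 ≤ C' * Real.exp (3 / 4 * x) := by
    have := (Real.tendsto_exp_div_pow_atTop 2).comp h34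
    filter_upwards [this.eventually_ge_atTop (64 * 16 / 9 / C'), e1] with x hx h1
    simp only [Function.comp] at hx
    rw [le_div_iff₀ (by positivity), div_mul_eq_mul_div, div_le_iff₀ hC'] at hx
    nlinarith
  have e4 : ∀ᶠ x : ℝ in atTop, 4 ≤ γ * x :=
    (tendsto_id.const_mul_atTop hγ).eventually_ge_atTop 4
  have e5 : ∀ᶠ x : ℝ in atTop, x ≤ C' * Real.exp x := by
    filter_upwards [(Real.tendsto_exp_div_pow_atTop 1).eventually_ge_atTop (1 / C'), e1]
      with x hx h1
    rw [le_div_iff₀ (by positivity), div_mul_eq_mul_div, div_le_iff₀ hC'] at hx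
    linarith
  have e6 : ∀ᶠ x : ℝ in atTop, K ≤ A * Real.sqrt x :=
    (Real.tendsto_sqrt_atTop.const_mul_atTop hA).eventually_ge_atTop K
  filter_upwards [e1, e2, e3, e4, e5, e6] with x h1 h2 h3 h4 h5 h6
  exact ⟨h1, h2, h3, h4, h5, h6⟩

set_option maxHeartbeats 1000000 in
/-- **Universal top-1 impossibility bound, general keys.** For all constants
`C₁, c₂, C₃ > 0` there are `C' > 0` and `c > 0` such that for all large `d`: for any
deterministic nonzero keys `v_i` with `‖v_i‖ ≤ C₁`, `(1/n) Σ v_i v_iᵀ ⪰ (c₂/d) I_d`, and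
`(1/n) Σ ⟨v_i,x⟩⁴ ≤ C₃ ‖x‖⁴/d²` for all `x`, if `n ≥ C' d² / log d` then with probability
at least `1 - e^{-c d}` (over i.i.d. `N(0, I_d/d)` targets `u_i`) no matrix `W` attains
top-1 retrieval. -/
theorem universal_top1_impossibility_general (C₁ c₂ C₃ : ℝ)
    (hC₁ : 0 < C₁) (hc₂ : 0 < c₂) (hC₃ : 0 < C₃) :
    ∃ C' : ℝ, 0 < C' ∧ ∃ c : ℝ, 0 < c ∧ ∃ d₀ : ℕ, ∀ d : ℕ, d₀ ≤ d → ∀ n : ℕ,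
      ∀ v : Fin n → Fin d → ℝ,
      (∀ i, v i ≠ 0) →
      (∀ i, Real.sqrt (v i ⬝ᵥ v i) ≤ C₁) →
      (((n : ℝ)⁻¹ • ∑ i, vecMulVec (v i) (v i)) -
          (c₂ / d) • (1 : Matrix (Fin d) (Fin d) ℝ)).PosSemidef →
      (∀ x : Fin d → ℝ,
        (n : ℝ)⁻¹ * ∑ i, (v i ⬝ᵥ x) ^ 4 ≤ C₃ * (x ⬝ᵥ x) ^ 2 / (d : ℝ) ^ 2) →
      C' * (d : ℝ) ^ 2 / Real.log d ≤ (n : ℝ) →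
      uModel d n {u | ∃ W : Matrix (Fin d) (Fin d) ℝ,
          ∀ i j : Fin n, j ≠ i → u j ⬝ᵥ W.mulVec (v i) < u i ⬝ᵥ W.mulVec (v i)} ≤
        ENNReal.ofReal (Real.exp (-c * d)) := by
  obtain ⟨K₀, hK₀, hcount⟩ := count_lattice
  obtain ⟨θ, hθ⟩ : ∃ θ, θ = c₂ ^ 2 / (4 * C₃) := ⟨_, rfl⟩
  have hθ0 : 0 < θ := by rw [hθ]; positivity
  obtain ⟨R, hR⟩ : ∃ R, R = Real.exp (8 / θ) := ⟨_, rfl⟩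
  have hR0 : 0 < R := by rw [hR]; positivity
  obtain ⟨K, hK⟩ : ∃ K, K = Real.sqrt (4 * (R * C₁ ^ 2) / θ) := ⟨_, rfl⟩
  have hK0 : 0 < K := by rw [hK]; positivity
  have hKR : 4 * (R * C₁ ^ 2) ≤ θ * K ^ 2 := by
    rw [hK, Real.sq_sqrt (by positivity)]
    apply le_of_eq; field_simp
  obtain ⟨B, hB⟩ : ∃ B, B = 64 * C₃ / θ + 1 := ⟨_, rfl⟩
  have hB1 : 1 ≤ B := by
    have : 0 < 64 * C₃ / θ := by positivity
    rw [hB]; linarith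
  have hB0 : 0 < B := by linarith
  have hBB : 64 * C₃ ≤ θ * B ^ 2 := by
    have h1 : 64 * C₃ ≤ θ * B := by
      have : θ * B = 64 * C₃ + θ := by rw [hB]; field_simp
      linarith
    have h2 : θ * B ≤ θ * B ^ 2 := by
      have : B ≤ B ^ 2 := by nlinarith
      gcongr
    linarith
  obtain ⟨γ, hγ⟩ : ∃ γ, γ = c₂ * θ / (4096 * B) := ⟨_, rfl⟩
  have hγ0 : 0 < γ := by rw [hγ]; positivity
  obtain ⟨C', hC'⟩ : ∃ C', C' = 4 * (4 + K₀) / γ := ⟨_, rfl⟩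
  have hC'0 : 0 < C' := by rw [hC']; positivity
  refine ⟨C', hC'0, 1 / 2, by norm_num, ?_⟩
  have hev := ((Real.tendsto_log_atTop.comp tendsto_natCast_atTop_atTop).eventually
    (eventually_conditions C' γ (Real.sqrt (c₂ / 2) / 16) K hC'0 hγ0 (by positivity))).and
    (eventually_ge_atTop 64)
  obtain ⟨d₀, hd₀⟩ := eventually_atTop.1 hev
  refine ⟨d₀, fun d hd n v _ hv1 hv2 hv3 hn => ?_⟩
  obtain ⟨⟨hx1, hx2, hx3, hx4, hx5, hx6⟩, hd64⟩ := hd₀ d hd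
  simp only [Function.comp] at hx1 hx2 hx3 hx4 hx5 hx6
  have hdpos : 0 < d := by omega
  have hd' : (64 : ℝ) ≤ d := by exact_mod_cast hd64
  have hdr : (0 : ℝ) < d := by linarith
  have hexp : Real.exp (Real.log d) = d := Real.exp_log hdr
  set x := Real.log d with hx
  have hx0 : 0 < x := by linarith
  rw [hexp] at hx5
  rw [div_le_iff₀ hx0] at hn
  have hnd : (d : ℝ) ≤ n := by
    have h1 : x * d ≤ C' * d * d := by gcongr
    have h2 : d * x ≤ n * x := by linarith [show C' * d * d = C' * (d : ℝ) ^ 2 by ring]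
    exact le_of_mul_le_mul_right h2 hx0
  have hn64 : 64 ≤ n := by
    have : (64 : ℝ) ≤ n := by linarith
    exact_mod_cast this
  have hnr : (0 : ℝ) < n := by linarith
  have hv1' : ∀ i, v i ⬝ᵥ v i ≤ C₁ ^ 2 := fun i => by
    have := Real.sqrt_le_iff.1 (hv1 i)
    exact this.2
  set τ := Real.sqrt (c₂ / 2) / 16 * Real.sqrt x with hτ
  have hτ0 : 0 ≤ τ := by positivity
  have hτ2 : τ ^ 2 / (2 * B) * (θ / 4 * n) = γ * x * n := by
    rw [hτ, mul_pow, div_pow, Real.sq_sqrt (by positivity), Real.sq_sqrt hx0.le, hγ]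
    field_simp
    ring
  -- bad event 1: many large norms
  set E1 : Set (Fin n → Fin d → ℝ) := {u | ∃ F : Finset (Fin n), F ⊆ Finset.univ ∧
    θ / 4 * n ≤ (F.card : ℝ) ∧ ∀ i ∈ F, u i ∈ {y : Fin d → ℝ | R < y ⬝ᵥ y}} with hE1
  have hP1 : uModel d n E1 ≤ ENNReal.ofReal (Real.exp (-d)) := by
    refine (subset_bound (stdGaussianVec d) n (fun _ => {y : Fin d → ℝ | R < y ⬝ᵥ y}) (8 / θ)
      (θ / 4 * n) (by positivity) Finset.univ (fun i _ => ?_)).trans ?_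
    · refine (norm_markov d hdpos R hR0).trans (le_of_eq ?_)
      rw [hR, Real.exp_neg, one_div]
    · apply ENNReal.ofReal_le_ofReal
      apply Real.exp_le_exp.2
      have : 8 / θ * (θ / 4 * n) = 2 * n := by field_simp; ring
      rw [this]; linarith
  -- bad event 2: some direction has no large projection
  set E2 : Set (Fin n → Fin d → ℝ) := {u | ∃ w : Fin d → ℝ, 0 < w ⬝ᵥ w ∧
      ∀ j, u j ⬝ᵥ w < 1 / 8 * Real.sqrt (x / d) * Real.sqrt (w ⬝ᵥ w)} with hE2
  have hP2 : uModel d n E2 ≤ ENNReal.ofReal (Real.exp (-d)) := by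
    refine (sphere_bound d n hd64 hx1 hx2).trans ?_
    apply ENNReal.ofReal_le_ofReal
    apply Real.exp_le_exp.2
    rw [← hx]
    set p := Real.exp (-(x / 4)) with hp
    have hp0 : 0 < p := Real.exp_pos _
    have h34 : Real.exp (3 / 4 * x) = d * p := by
      rw [← hexp, hp, ← Real.exp_add]; congr 1; ring
    rw [h34] at hx3
    have h1 : x * (4 * d * x) ≤ x * (n * (p / 16)) := by
      have h2 : 64 * x ^ 2 * d ≤ C' * (d * p) * d := by gcongr
      have h3 : C' * d ^ 2 * p ≤ n * x * p := by gcongr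
      have h6 : C' * (d * p) * d = C' * d ^ 2 * p := by ring
      have h7 : x * (4 * d * x) = (64 * x ^ 2 * d) / 16 := by ring
      have h8 : x * (n * (p / 16)) = (n * x * p) / 16 := by ring
      linarith
    have h4 : 4 * d * x ≤ n * (p / 16) := le_of_mul_le_mul_left h1 hx0
    have h5 : (d : ℝ) * 1 ≤ d * x := by gcongr
    linarith
  -- bad event 3: the net
  obtain ⟨Z, hZ1, hZ2⟩ := hcount (Fin d × Fin d) (4 * (d : ℝ) ^ 2) (by positivity)
  set H : (Fin d × Fin d → ℤ) → Set (Fin n → Fin d → ℝ) := fun z =>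
    {u | ∃ F : Finset (Fin n),
        F ⊆ Finset.univ.filter (fun i =>
          (toMat z).mulVec (v i) ⬝ᵥ (toMat z).mulVec (v i) ≤ B * d) ∧
        θ / 4 * n ≤ (F.card : ℝ) ∧
        ∀ i ∈ F, u i ∈ {y : Fin d → ℝ | τ ≤ y ⬝ᵥ (toMat z).mulVec (v i)}} with hH
  have hPH : ∀ z, uModel d n (H z) ≤ ENNReal.ofReal (Real.exp (n - γ * x * n)) := by
    intro z
    rw [← hτ2]
    refine subset_bound (stdGaussianVec d) n
      (fun i => {y : Fin d → ℝ | τ ≤ y ⬝ᵥ (toMat z).mulVec (v i)}) (τ ^ 2 / (2 * B))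
      (θ / 4 * n) (by positivity) _ (fun i hi => ?_)
    exact tail_upper d _ B τ hB0 hτ0 hdpos (Finset.mem_filter.1 hi).2
  have hP3 : uModel d n (⋃ z ∈ Z, H z) ≤ ENNReal.ofReal (Real.exp (-d)) := by
    refine (measure_biUnion_finset_le _ _).trans ((Finset.sum_le_sum fun z _ => hPH z).trans ?_)
    rw [Finset.sum_const, nsmul_eq_mul, ← ENNReal.ofReal_natCast,
      ← ENNReal.ofReal_mul (by positivity)]
    apply ENNReal.ofReal_le_ofReal
    calc _ ≤ Real.exp (4 * (d : ℝ) ^ 2 + K₀ * Fintype.card (Fin d × Fin d)) *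
          Real.exp (n - γ * x * n) := by gcongr
      _ ≤ _ := by
        rw [← Real.exp_add]
        apply Real.exp_le_exp.2
        simp only [Fintype.card_prod, Fintype.card_fin, Nat.cast_mul]
        have h1 : 4 * (4 + K₀) * d ^ 2 ≤ γ * x * n := by
          have : γ * (C' * d ^ 2) ≤ γ * (n * x) := by gcongr
          have e : γ * (C' * d ^ 2) = 4 * (4 + K₀) * d ^ 2 := by rw [hC']; field_simp
          linarith
        have h2 : 4 * (n : ℝ) ≤ γ * x * n := by gcongr
        have h3 : 4 * (4 + K₀) * (d : ℝ) ^ 2 = 4 * (4 * (d : ℝ) ^ 2 + K₀ * (d * d)) := by ring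
        linarith
  -- conclusion
  have hsub : {u : Fin n → Fin d → ℝ | ∃ W : Matrix (Fin d) (Fin d) ℝ,
          ∀ i j : Fin n, j ≠ i → u j ⬝ᵥ W.mulVec (v i) < u i ⬝ᵥ W.mulVec (v i)} ⊆
      (E1 ∪ E2) ∪ ⋃ z ∈ Z, H z := by
    rintro u ⟨W₀, hW₀⟩
    by_cases h1 : u ∈ E1
    · exact Or.inl (Or.inl h1)
    by_cases h2 : u ∈ E2
    · exact Or.inl (Or.inr h2)
    right
    obtain ⟨W, hWf, hW⟩ := scale hdpos (by omega) u v W₀ hW₀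
    obtain ⟨z, hz, hF⟩ := det_main hdpos (by omega) hx0.le C₁ c₂ C₃ θ R K B τ hc₂ hC₃ hR0 hK0 hB0
      hθ hKR hBB hτ hx6 v hv1' hv2 hv3 u
      (fun F hF => by
        by_contra h
        exact h1 ⟨F, Finset.subset_univ _, not_lt.1 h, hF⟩)
      (fun w hw => by
        by_contra h
        push Not at h
        exact h2 ⟨w, hw, h⟩) W hWf hW
    simp only [Set.mem_iUnion]
    exact ⟨z, (hZ1 z).1 hz, hF⟩
  calc _ ≤ uModel d n ((E1 ∪ E2) ∪ ⋃ z ∈ Z, H z) := measure_mono hsub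
    _ ≤ uModel d n E1 + uModel d n E2 + uModel d n (⋃ z ∈ Z, H z) :=
        (measure_union_le _ _).trans (by gcongr; exact measure_union_le _ _)
    _ ≤ ENNReal.ofReal (Real.exp (-d)) + ENNReal.ofReal (Real.exp (-d)) +
          ENNReal.ofReal (Real.exp (-d)) := by gcongr
    _ = ENNReal.ofReal (3 * Real.exp (-d)) := by
        rw [← ENNReal.ofReal_add (by positivity) (by positivity),
          ← ENNReal.ofReal_add (by positivity) (by positivity)]
        congr 1; ring
    _ ≤ _ := by
        apply ENNReal.ofReal_le_ofReal
        have h3 : (3 : ℝ) ≤ Real.exp (d / 2) := by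
          linarith [Real.add_one_le_exp ((d : ℝ) / 2)]
        calc 3 * Real.exp (-(d : ℝ)) ≤ Real.exp (d / 2) * Real.exp (-(d : ℝ)) := by gcongr
          _ = _ := by rw [← Real.exp_add]; congr 1; ring

end
end

section
/- For every ε ∈ (0,2) and every c₀ > 0 there exists a constant c > 0 such that for all sufficiently large d the following holds: if n ≥ c₀ d²/log d and u_1,…,u_n ∈ ℝ^d are i.i.d. N(0, I_d/d), then with probability at least 1 − e^{−c d}, inf_{x ∈ S^{d−1}} max_{1≤j≤n} u_j^⊤ x ≥ √((2−ε)(log d)/d), where S^{d−1} is the unit sphere of ℝ^d. -/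
open MeasureTheory ProbabilityTheory Filter Topology Matrix

noncomputable section

lemma aux_law (d : ℕ) (y : Fin d → ℝ) (hy : y ⬝ᵥ y = 1) :
    (stdGaussianVec d).map (fun u => u ⬝ᵥ y) = gaussianReal 0 (d : NNReal)⁻¹ := by
  have hm : Measurable (fun u : Fin d → ℝ => u ⬝ᵥ y) := by
    unfold dotProduct; fun_prop
  have : IsProbabilityMeasure (stdGaussianVec d) := by unfold stdGaussianVec; infer_instance
  have : IsProbabilityMeasure ((stdGaussianVec d).map (fun u => u ⬝ᵥ y)) :=
    Measure.isProbabilityMeasure_map hm.aemeasurable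
  apply Measure.ext_of_charFun
  ext t
  rw [charFun_apply_real, integral_map hm.aemeasurable (by fun_prop), charFun_gaussianReal]
  have h1 : ∀ u : Fin d → ℝ, Complex.exp (t * ((u ⬝ᵥ y : ℝ) : ℂ) * Complex.I)
      = ∏ i, Complex.exp (((t * y i : ℝ) : ℂ) * (u i) * Complex.I) := by
    intro u
    rw [← Complex.exp_sum]
    congr 1
    simp only [dotProduct]
    push_cast
    rw [Finset.mul_sum, Finset.sum_mul]
    refine Finset.sum_congr rfl fun i _ => by ring
  simp_rw [h1]
  unfold stdGaussianVec
  rw [integral_fintype_prod_eq_prod (𝕜 := ℂ)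
    (f := fun (i : Fin d) (x : ℝ) => Complex.exp (((t * y i : ℝ) : ℂ) * x * Complex.I))]
  simp_rw [← charFun_apply_real, charFun_gaussianReal]
  rw [← Complex.exp_sum]
  congr 1
  have hy' : (∑ i, (y i : ℂ) * (y i : ℂ)) = 1 := by
    have := congrArg (fun r : ℝ => (r : ℂ)) hy
    simpa [dotProduct] using this
  push_cast
  simp only [mul_zero, zero_mul, zero_sub]
  rw [Finset.sum_neg_distrib, neg_inj]
  calc _ = ∑ i, (((d : ℂ)⁻¹ * (t:ℂ) ^ 2 / 2) * ((y i : ℂ) * (y i : ℂ))) :=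
        Finset.sum_congr rfl fun i _ => by ring
    _ = _ := by rw [← Finset.mul_sum, hy', mul_one]

lemma aux_hit (d : ℕ) (hd : 0 < d) (y : Fin d → ℝ) (hy : y ⬝ᵥ y = 1) (a b : ℝ)
    (ha : 0 ≤ a) (hab : a ≤ b) :
    ENNReal.ofReal ((b - a) * ((√(2 * Real.pi * (d : ℝ)⁻¹))⁻¹ * Real.exp (-(d * b ^ 2 / 2)))) ≤
      stdGaussianVec d {u | a ≤ u ⬝ᵥ y} := by
  have hm : Measurable (fun u : Fin d → ℝ => u ⬝ᵥ y) := by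
    unfold dotProduct; fun_prop
  have hd' : (0:ℝ) < d := by exact_mod_cast hd
  have e : {u : Fin d → ℝ | a ≤ u ⬝ᵥ y} = (fun u => u ⬝ᵥ y) ⁻¹' Set.Ici a := rfl
  rw [e, ← Measure.map_apply hm measurableSet_Ici, aux_law d y hy,
    gaussianReal_apply _ (by simp; omega)]
  have hc : ∀ x ∈ Set.Icc a b,
      ENNReal.ofReal ((√(2 * Real.pi * (d : ℝ)⁻¹))⁻¹ * Real.exp (-(d * b ^ 2 / 2))) ≤
      gaussianPDF 0 (d : NNReal)⁻¹ x := by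
    intro x hx
    unfold gaussianPDF gaussianPDFReal
    apply ENNReal.ofReal_le_ofReal
    push_cast
    gcongr
    have h2 : x ^ 2 ≤ b ^ 2 := by
      have := hx.1; have := hx.2
      gcongr
      linarith
    have : -(x - 0) ^ 2 / (2 * (d:ℝ)⁻¹) = -(d * x ^ 2 / 2) := by field_simp; ring
    rw [this]
    gcongr
  calc _ = ∫⁻ x in Set.Icc a b,
        ENNReal.ofReal ((√(2 * Real.pi * (d : ℝ)⁻¹))⁻¹ * Real.exp (-(d * b ^ 2 / 2))) := by
        rw [setLIntegral_const, Real.volume_Icc, ← ENNReal.ofReal_mul (by positivity), mul_comm]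
    _ ≤ ∫⁻ x in Set.Icc a b, gaussianPDF 0 (d : NNReal)⁻¹ x :=
        setLIntegral_mono' measurableSet_Icc hc
    _ ≤ _ := lintegral_mono_set Set.Icc_subset_Ici_self

lemma aux_tail_s4 (d : ℕ) (hd : 0 < d) :
    stdGaussianVec d {u | ∃ i, (d : ℝ) ≤ |u i|} ≤ ENNReal.ofReal (1 / (d : ℝ) ^ 2) := by
  have hd' : (0:ℝ) < d := by exact_mod_cast hd
  have e : {u : Fin d → ℝ | ∃ i, (d : ℝ) ≤ |u i|} = ⋃ i, {u | (d : ℝ) ≤ |u i|} := by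
    ext; simp
  rw [e]
  have h1 : ∀ i : Fin d, stdGaussianVec d {u | (d : ℝ) ≤ |u i|}
      ≤ ENNReal.ofReal ((d:ℝ)⁻¹ / (d:ℝ) ^ 2) := by
    intro i
    have h2 := meas_ge_le_variance_div_sq (μ := gaussianReal 0 (d : NNReal)⁻¹) (X := id)
      (memLp_id_gaussianReal 2) hd'
    have h3 : MeasurePreserving (Function.eval i) (stdGaussianVec d)
      (gaussianReal 0 (d : NNReal)⁻¹) := measurePreserving_eval _ i
    have hs : MeasurableSet {x : ℝ | (d:ℝ) ≤ |x|} := measurableSet_le (by fun_prop) (by fun_prop)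
    have h4 := h3.measure_preimage hs.nullMeasurableSet
    change stdGaussianVec d (Function.eval i ⁻¹' {x : ℝ | (d:ℝ) ≤ |x|}) ≤ _
    rw [h4]
    simpa [variance_id_gaussianReal] using h2
  calc _ ≤ ∑ i : Fin d, stdGaussianVec d {u | (d : ℝ) ≤ |u i|} := measure_iUnion_fintype_le _ _
    _ ≤ ∑ i : Fin d, ENNReal.ofReal ((d:ℝ)⁻¹ / (d:ℝ) ^ 2) := Finset.sum_le_sum fun i _ => h1 i
    _ = _ := by
      rw [← ENNReal.ofReal_sum_of_nonneg (fun _ _ => by positivity)]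
      congr 1
      simp
      field_simp

lemma aux_fail (d n : ℕ) (p : ℝ) (B : Set (Fin d → ℝ)) (hB : MeasurableSet B)
    (hp : 0 ≤ p) (h : ENNReal.ofReal p ≤ stdGaussianVec d B) :
    uModel d n {u | ∀ j, u j ∉ B} ≤ ENNReal.ofReal (Real.exp (-(p * n))) := by
  have : IsProbabilityMeasure (stdGaussianVec d) := by unfold stdGaussianVec; infer_instance
  have e : {u : Fin n → Fin d → ℝ | ∀ j, u j ∉ B} = Set.univ.pi fun _ => Bᶜ := by
    ext; simp
  unfold uModel
  rw [e, Measure.pi_pi]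
  simp only [Finset.prod_const, Finset.card_univ, Fintype.card_fin]
  have h1 : stdGaussianVec d Bᶜ ≤ ENNReal.ofReal (Real.exp (-p)) := by
    rw [prob_compl_eq_one_sub hB]
    calc _ ≤ 1 - ENNReal.ofReal p := tsub_le_tsub_left h _
      _ = ENNReal.ofReal (1 - p) := by rw [ENNReal.ofReal_sub _ hp, ENNReal.ofReal_one]
      _ ≤ _ := ENNReal.ofReal_le_ofReal (by linarith [Real.add_one_le_exp (-p)])
  calc _ ≤ (ENNReal.ofReal (Real.exp (-p))) ^ n := by gcongr
    _ = _ := by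
      rw [← ENNReal.ofReal_pow (Real.exp_pos _).le, ← Real.exp_nat_mul]
      congr 2; ring

lemma aux_net (d M : ℕ) (hM : 0 < M) : ∃ S : Finset (Fin d → ℝ), S.card ≤ (2 * M + 1) ^ d ∧
    (∀ y ∈ S, y ⬝ᵥ y = 1) ∧
    ∀ x : Fin d → ℝ, x ⬝ᵥ x = 1 → ∃ y ∈ S, ∀ i, |x i - y i| ≤ 1 / M := by
  classical
  have hM' : (0:ℝ) < M := by exact_mod_cast hM
  let F : (Fin d → ℝ) → (Fin d → ℤ) := fun x i => ⌊(M:ℝ) * x i⌋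
  let T : Finset (Fin d → ℤ) := Fintype.piFinset fun _ => Finset.Icc (-(M:ℤ)) M
  let g : (Fin d → ℤ) → (Fin d → ℝ) := fun k =>
    if h : ∃ x : Fin d → ℝ, x ⬝ᵥ x = 1 ∧ F x = k then h.choose else 0
  refine ⟨(T.filter fun k => ∃ x : Fin d → ℝ, x ⬝ᵥ x = 1 ∧ F x = k).image g, ?_, ?_, ?_⟩
  · refine Finset.card_image_le.trans ((Finset.card_filter_le _ _).trans ?_)
    simp only [T, Fintype.card_piFinset_const, Int.card_Icc]
    apply le_of_eq
    congr 1
    omega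
  · intro y hy
    obtain ⟨k, hk, rfl⟩ := Finset.mem_image.1 hy
    have h := (Finset.mem_filter.1 hk).2
    simp only [g, dif_pos h]
    exact h.choose_spec.1
  · intro x hx
    have h : ∃ z : Fin d → ℝ, z ⬝ᵥ z = 1 ∧ F z = F x := ⟨x, hx, rfl⟩
    refine ⟨g (F x), Finset.mem_image_of_mem _ (Finset.mem_filter.2 ⟨?_, h⟩), ?_⟩
    · simp only [T, Fintype.mem_piFinset, Finset.mem_Icc, F]
      intro i
      have h1 : x i * x i ≤ 1 := by
        rw [← hx]
        exact Finset.single_le_sum (f := fun i => x i * x i)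
          (fun i _ => mul_self_nonneg _) (Finset.mem_univ i)
      have h2 : |x i| ≤ 1 := by
        rw [← sq_le_one_iff_abs_le_one]; nlinarith
      rw [abs_le] at h2
      constructor
      · rw [Int.le_floor]; push_cast; nlinarith
      · have : ((⌊(M:ℝ) * x i⌋ : ℤ) : ℝ) ≤ M := (Int.floor_le _).trans (by nlinarith)
        exact_mod_cast this
    · intro i
      have hg : F (g (F x)) = F x := by
        simp only [g, dif_pos h]; exact h.choose_spec.2
      have h3 : ⌊(M:ℝ) * g (F x) i⌋ = ⌊(M:ℝ) * x i⌋ := congrFun hg i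
      have h4 := Int.abs_sub_lt_one_of_floor_eq_floor h3
      rw [← mul_sub, abs_mul, abs_of_pos hM', abs_sub_comm] at h4
      rw [le_div_iff₀ hM']
      linarith

lemma aux_asymp (ε : ℝ) (hε0 : 0 < ε) (hε2 : ε < 2) (c₀ : ℝ) (hc₀ : 0 < c₀) :
    ∃ d₀ : ℕ, ∀ d : ℕ, d₀ ≤ d → 2 ≤ d ∧
      √((2 - ε) * Real.log d / d) + 1 / (d:ℝ) ^ 2 ≤ √((2 - ε / 2) * Real.log d / d) ∧
      (d : ℝ) ^ (-1 + ε / 4) / 2 ≤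
        (√((2 - ε / 2) * Real.log d / d) - (√((2 - ε) * Real.log d / d) + 1 / (d:ℝ) ^ 2)) *
          ((√(2 * Real.pi * (d : ℝ)⁻¹))⁻¹ *
            Real.exp (-(d * (√((2 - ε / 2) * Real.log d / d)) ^ 2 / 2))) - 1 / (d : ℝ) ^ 2 ∧
      ∀ n : ℕ, c₀ * (d : ℝ) ^ 2 / Real.log d ≤ (n : ℝ) →
        (2 * (d:ℝ) ^ 4 + 1) ^ d * Real.exp (-((d : ℝ) ^ (-1 + ε / 4) / 2 * n)) ≤
          Real.exp (-1 * d) := by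
  set κ : ℝ := √(2 - ε / 2) - √(2 - ε) with hκ
  have hκ0 : 0 < κ := sub_pos.2 (Real.sqrt_lt_sqrt (by linarith) (by linarith))
  have hlog : Tendsto (fun d : ℕ => Real.log d) atTop atTop :=
    Real.tendsto_log_atTop.comp tendsto_natCast_atTop_atTop
  have hlo := ((isLittleO_log_rpow_rpow_atTop 2 (show 0 < ε / 4 by linarith)).bound
    (show 0 < c₀ / 14 by positivity))
  have hlo' := tendsto_natCast_atTop_atTop.eventually hlo
  obtain ⟨d₀, hd₀⟩ := eventually_atTop.1 ((eventually_ge_atTop 2).and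
    ((hlog.eventually_ge_atTop 1).and ((hlog.eventually_ge_atTop
      (((1 + √(2 * Real.pi)) / κ) ^ 2)).and hlo')))
  refine ⟨d₀, fun d hd => ?_⟩
  obtain ⟨h2, hL1, hLκ, hlit⟩ := hd₀ d hd
  have hd2 : (2:ℝ) ≤ d := by exact_mod_cast h2
  have hdpos : (0:ℝ) < d := by linarith
  set L := Real.log d with hL
  have hLd : Real.exp L = d := Real.exp_log hdpos
  set s := √(d:ℝ) with hs
  have hs1 : 1 ≤ s := by rw [hs]; exact Real.one_le_sqrt.2 (by linarith)
  have hss : s ^ 2 = d := Real.sq_sqrt hdpos.le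
  have hLs : (1 + √(2 * Real.pi)) ≤ κ * √L := by
    have := Real.le_sqrt_of_sq_le hLκ
    rw [div_le_iff₀ hκ0] at this
    linarith
  have hb : √((2 - ε / 2) * L / d) = √(2 - ε / 2) * √L / s := by
    rw [Real.sqrt_div' _ hdpos.le, Real.sqrt_mul (by linarith)]
  have ha : √((2 - ε) * L / d) = √(2 - ε) * √L / s := by
    rw [Real.sqrt_div' _ hdpos.le, Real.sqrt_mul (by linarith)]
  have hinv : 1 / (d:ℝ) ^ 2 ≤ 1 / s := by
    rw [← hss]
    apply one_div_le_one_div_of_le (by linarith)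
    rw [← pow_mul]
    exact le_self_pow₀ hs1 (by norm_num)
  have hgap : √(2 * Real.pi) / s ≤
      √((2 - ε / 2) * L / d) - (√((2 - ε) * L / d) + 1 / (d:ℝ) ^ 2) := by
    rw [hb, ha]
    have : √(2 * Real.pi) / s ≤ (κ * √L - 1) / s := by gcongr; linarith
    have e : (κ * √L - 1) / s = √(2 - ε / 2) * √L / s - √(2 - ε) * √L / s - 1 / s := by
      rw [hκ]; ring
    linarith
  have hpi : 0 < √(2 * Real.pi) := by positivity
  have hspos : 0 < s := by linarith
  refine ⟨h2, ?_, ?_, ?_⟩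
  · have : 0 ≤ √(2 * Real.pi) / s := by positivity
    linarith
  · have hexp : Real.exp (-(d * (√((2 - ε / 2) * L / d)) ^ 2 / 2)) = (d:ℝ) ^ (-1 + ε / 4) := by
      rw [Real.sq_sqrt (by apply div_nonneg (mul_nonneg _ _) hdpos.le <;> linarith),
        Real.rpow_def_of_pos hdpos]
      congr 1
      field_simp
      ring
    rw [hexp]
    have hsq : √(2 * Real.pi * (d:ℝ)⁻¹) = √(2 * Real.pi) / s := by
      rw [← div_eq_mul_inv, Real.sqrt_div' _ hdpos.le]
    rw [hsq]
    have hr : 0 < (d:ℝ) ^ (-1 + ε / 4) := Real.rpow_pos_of_pos hdpos _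
    have h5 : (d:ℝ) ^ (-1 + ε / 4) ≤
        (√((2 - ε / 2) * L / d) - (√((2 - ε) * L / d) + 1 / (d:ℝ) ^ 2)) *
          ((√(2 * Real.pi) / s)⁻¹ * (d:ℝ) ^ (-1 + ε / 4)) := by
      calc (d:ℝ) ^ (-1 + ε / 4) = (√(2 * Real.pi) / s) *
          ((√(2 * Real.pi) / s)⁻¹ * (d:ℝ) ^ (-1 + ε / 4)) := by
            rw [mul_inv_cancel_left₀]; positivity
        _ ≤ _ := by gcongr
    have h6 : 1 / (d:ℝ) ^ 2 ≤ (d:ℝ) ^ (-1 + ε / 4) / 2 := by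
      have h7 : (d:ℝ) ^ (-1 : ℝ) ≤ (d:ℝ) ^ (-1 + ε / 4) :=
        Real.rpow_le_rpow_of_exponent_le (by linarith) (by linarith)
      rw [Real.rpow_neg_one] at h7
      have h8 : 1 / (d:ℝ) ^ 2 ≤ (d:ℝ)⁻¹ / 2 := by
        rw [div_le_div_iff₀ (by positivity) (by norm_num)]
        field_simp
        linarith
      linarith
    linarith
  · intro n hn
    have hb1 : 2 * (d:ℝ) ^ 4 + 1 ≤ Real.exp (6 * L) := by
      have : Real.exp (6 * L) = (d:ℝ) ^ 6 := by
        rw [← hLd, ← Real.exp_nat_mul]; norm_num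
      rw [this]
      have h4 : (1:ℝ) ≤ (d:ℝ) ^ 4 := one_le_pow₀ (by linarith)
      have : (d:ℝ) ^ 6 = (d:ℝ) ^ 4 * d ^ 2 := by ring
      have hq : (4:ℝ) ≤ (d:ℝ) ^ 2 := by nlinarith
      have hm := mul_le_mul_of_nonneg_left hq (by linarith : (0:ℝ) ≤ (d:ℝ) ^ 4)
      linarith
    have h9 : L ^ 2 ≤ c₀ / 14 * (d:ℝ) ^ (ε / 4) := by
      have h10 := hlit
      rw [Real.norm_of_nonneg (by positivity), Real.norm_of_nonneg (by positivity)] at h10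
      simpa using h10
    have hr : 0 < (d:ℝ) ^ (-1 + ε / 4) := Real.rpow_pos_of_pos hdpos _
    have hre : (d:ℝ) ^ (-1 + ε / 4) * d = (d:ℝ) ^ (ε / 4) := by
      rw [← Real.rpow_add_one hdpos.ne']; congr 1; ring
    have hpn : (6 * L + 1) * d ≤ (d : ℝ) ^ (-1 + ε / 4) / 2 * n := by
      calc (6 * L + 1) * d ≤ 7 * L * d := by gcongr; linarith
        _ ≤ (d : ℝ) ^ (-1 + ε / 4) / 2 * (c₀ * (d : ℝ) ^ 2 / L) := by
          have : (d : ℝ) ^ (-1 + ε / 4) / 2 * (c₀ * (d : ℝ) ^ 2 / L)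
            = (d:ℝ) ^ (ε / 4) * c₀ * d / 2 / L := by rw [← hre]; ring
          rw [this, le_div_iff₀ (by linarith)]
          nlinarith
        _ ≤ _ := by gcongr
    calc _ ≤ Real.exp (6 * L) ^ d * Real.exp (-((d : ℝ) ^ (-1 + ε / 4) / 2 * n)) := by gcongr
      _ = Real.exp (d * (6 * L) + (-((d : ℝ) ^ (-1 + ε / 4) / 2 * n))) := by
        rw [← Real.exp_nat_mul, Real.exp_add]
      _ ≤ _ := by
        apply Real.exp_le_exp.2
        linarith

/-- **Uniform anticoncentration over the sphere.** For every `ε ∈ (0,2)` and `c₀ > 0`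
there is `c > 0` such that for all large `d`: if `n ≥ c₀ d²/log d` and `u_j` are i.i.d.
`N(0, I_d/d)`, then with probability at least `1 - e^{-c d}`, for every unit vector `x`
some `j` satisfies `u_j^⊤ x ≥ √((2-ε) log d / d)`. -/
theorem sphere_cover_anticoncentration (ε : ℝ) (hε0 : 0 < ε) (hε2 : ε < 2)
    (c₀ : ℝ) (hc₀ : 0 < c₀) :
    ∃ c : ℝ, 0 < c ∧ ∃ d₀ : ℕ, ∀ d : ℕ, d₀ ≤ d → ∀ n : ℕ,
      c₀ * (d : ℝ) ^ 2 / Real.log d ≤ (n : ℝ) →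
      ENNReal.ofReal (1 - Real.exp (-c * d)) ≤
        uModel d n {u | ∀ x : Fin d → ℝ, x ⬝ᵥ x = 1 →
          ∃ j : Fin n, Real.sqrt ((2 - ε) * Real.log d / d) ≤ u j ⬝ᵥ x} := by
  obtain ⟨d₀, hd₀⟩ := aux_asymp ε hε0 hε2 c₀ hc₀
  refine ⟨1, one_pos, d₀, fun d hd n hn => ?_⟩
  obtain ⟨h2, hab, hp, hfin⟩ := hd₀ d hd
  specialize hfin n hn
  have hdpos : (0:ℝ) < d := by exact_mod_cast (by omega : 0 < d)
  set t := √((2 - ε) * Real.log d / d) with ht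
  set b := √((2 - ε / 2) * Real.log d / d) with hb
  set p := (d : ℝ) ^ (-1 + ε / 4) / 2 with hpdef
  have hp0 : 0 ≤ p := by positivity
  obtain ⟨S, hScard, hSunit, hSnet⟩ := aux_net d (d ^ 4) (by positivity)
  have : IsProbabilityMeasure (stdGaussianVec d) := by unfold stdGaussianVec; infer_instance
  have : IsProbabilityMeasure (uModel d n) := by unfold uModel; infer_instance
  let B : (Fin d → ℝ) → Set (Fin d → ℝ) := fun y =>
    {u | t + 1 / (d:ℝ) ^ 2 ≤ u ⬝ᵥ y} \ {u | ∃ i, (d : ℝ) ≤ |u i|}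
  have hBm : ∀ y, MeasurableSet (B y) := by
    intro y
    apply MeasurableSet.diff
    · apply measurableSet_le (by fun_prop)
      unfold dotProduct; fun_prop
    · have e : {u : Fin d → ℝ | ∃ i, (d : ℝ) ≤ |u i|} = ⋃ i, {u | (d : ℝ) ≤ |u i|} := by
        ext; simp
      rw [e]
      exact MeasurableSet.iUnion fun i => measurableSet_le (by fun_prop) (by fun_prop)
  have hBp : ∀ y ∈ S, ENNReal.ofReal p ≤ stdGaussianVec d (B y) := by
    intro y hy
    calc ENNReal.ofReal p ≤ _ := ENNReal.ofReal_le_ofReal hp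
      _ = _ := ENNReal.ofReal_sub _ (by positivity)
      _ ≤ _ := tsub_le_tsub (aux_hit d (by omega) y (hSunit y hy) (t + 1 / (d:ℝ) ^ 2) b
          (by positivity) hab) (aux_tail_s4 d (by omega))
      _ ≤ _ := le_measure_diff
  set A := {u : Fin n → Fin d → ℝ | ∀ x : Fin d → ℝ, x ⬝ᵥ x = 1 →
          ∃ j : Fin n, t ≤ u j ⬝ᵥ x} with hA
  have hsub : Aᶜ ⊆ ⋃ y ∈ S, {u | ∀ j, u j ∉ B y} := by
    intro u hu
    by_contra hcon
    apply hu
    intro x hx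
    obtain ⟨y, hyS, hy⟩ := hSnet x hx
    simp only [Set.mem_iUnion, Set.mem_setOf_eq, not_exists, not_forall, not_not] at hcon
    obtain ⟨j, hj1, hj2⟩ := hcon y hyS
    refine ⟨j, ?_⟩
    simp only [Set.mem_setOf_eq, not_exists, not_le] at hj1 hj2
    have h3 : u j ⬝ᵥ y - u j ⬝ᵥ x ≤ 1 / (d:ℝ) ^ 2 := by
      rw [← dotProduct_sub]
      unfold dotProduct
      calc ∑ i, u j i * (y - x) i ≤ ∑ i : Fin d, (d:ℝ) * (1 / ((d ^ 4 : ℕ) : ℝ)) := by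
            apply Finset.sum_le_sum
            intro i _
            refine (le_abs_self _).trans ?_
            rw [abs_mul, Pi.sub_apply, abs_sub_comm]
            exact mul_le_mul (hj2 i).le (hy i) (abs_nonneg _) hdpos.le
        _ = 1 / (d:ℝ) ^ 2 := by
            simp
            field_simp
    linarith
  have hbound : uModel d n Aᶜ ≤ ENNReal.ofReal (Real.exp (-1 * d)) := by
    calc _ ≤ _ := measure_mono hsub
      _ ≤ ∑ y ∈ S, uModel d n {u | ∀ j, u j ∉ B y} := measure_biUnion_finset_le _ _
      _ ≤ ∑ y ∈ S, ENNReal.ofReal (Real.exp (-(p * n))) :=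
        Finset.sum_le_sum fun y hy => aux_fail d n p (B y) (hBm y) hp0 (hBp y hy)
      _ = ENNReal.ofReal (S.card * Real.exp (-(p * n))) := by
        rw [Finset.sum_const, nsmul_eq_mul, ENNReal.ofReal_mul (by positivity),
          ENNReal.ofReal_natCast]
      _ ≤ _ := by
        apply ENNReal.ofReal_le_ofReal
        refine le_trans ?_ hfin
        gcongr
        exact_mod_cast hScard
  rw [ENNReal.ofReal_sub _ (Real.exp_pos _).le, ENNReal.ofReal_one, tsub_le_iff_right]
  calc (1 : ENNReal) = uModel d n Set.univ := measure_univ.symm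
    _ = uModel d n (A ∪ Aᶜ) := by rw [Set.union_compl_self]
    _ ≤ uModel d n A + uModel d n Aᶜ := measure_union_le _ _
    _ ≤ _ := by gcongr

end
end

section
/- For every ε ∈ (0,2) and every c₀ > 0 there exists a constant c > 0 such that for all sufficiently large d the following holds: if n ≥ c₀ d²/log d and v_1,…,v_n ∈ ℝ^d are i.i.d. N(0, I_d/d), then with probability at least 1 − e^{−c d}, inf_{x ∈ S^{d−1}} (1/n) Σ_{i=1}^n |x^⊤ v_i| ≥ √((2−ε)/(π d)), where S^{d−1} is the unit sphere of ℝ^d. -/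
open MeasureTheory ProbabilityTheory Filter Topology Matrix

noncomputable section

/-- The model `v_1, …, v_n` i.i.d. `N(0, I_d/d)`. -/
def vModel (d n : ℕ) : Measure (Fin n → Fin d → ℝ) :=
  Measure.pi fun _ : Fin n => stdGaussianVec d

instance (d : ℕ) : IsProbabilityMeasure (stdGaussianVec d) := by
  unfold stdGaussianVec; infer_instance

instance (d n : ℕ) : IsProbabilityMeasure (vModel d n) := by
  unfold vModel; infer_instance

/-- Chernoff bound for a sum of functions of i.i.d. coordinates. -/
lemma chernoff_pi {α : Type*} [MeasurableSpace α] (μ : Measure α) [IsProbabilityMeasure μ]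
    (f : α → ℝ) (a : ℝ) (hi : Integrable (fun x => Real.exp (f x)) μ)
    (ha : ∫ x, Real.exp (f x) ∂μ ≤ Real.exp a) (n : ℕ) (s : ℝ) :
    (Measure.pi fun _ : Fin n => μ).real {v | s ≤ ∑ i, f (v i)} ≤ Real.exp (n * a - s) := by
  have hI : Integrable (fun v : Fin n → α => ∏ i, Real.exp (f (v i)))
      (Measure.pi fun _ : Fin n => μ) :=
    Integrable.fintype_prod (f := fun _ x => Real.exp (f x)) (fun _ => hi)
  have h := mul_meas_ge_le_integral_of_nonneg (μ := Measure.pi fun _ : Fin n => μ)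
    (f := fun v : Fin n → α => ∏ i, Real.exp (f (v i)))
    (Eventually.of_forall fun v => Finset.prod_nonneg fun i _ => (Real.exp_pos _).le) hI
    (Real.exp s)
  rw [integral_fintype_prod_eq_pow (f := fun x => Real.exp (f x))] at h
  have h2 : (∫ x, Real.exp (f x) ∂μ) ^ (Fintype.card (Fin n)) ≤ Real.exp (n * a) := by
    rw [Fintype.card_fin, Real.exp_nat_mul]
    exact pow_le_pow_left₀ (integral_nonneg fun x => (Real.exp_pos _).le) ha n
  have h3 : {v : Fin n → α | Real.exp s ≤ ∏ i, Real.exp (f (v i))} = {v | s ≤ ∑ i, f (v i)} := by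
    ext v
    simp only [Set.mem_ofPred_eq, ← Real.exp_sum, Real.exp_le_exp]
  rw [h3] at h
  rw [Real.exp_sub, le_div_iff₀ (Real.exp_pos _), mul_comm]
  exact h.trans h2

lemma map_dot_s5 (d : ℕ) (x : Fin d → ℝ) (hx : x ⬝ᵥ x = 1) :
    (stdGaussianVec d).map (fun v => x ⬝ᵥ v) = gaussianReal 0 (d : NNReal)⁻¹ := by
  have hm : Measurable (fun v : Fin d → ℝ => x ⬝ᵥ v) := by unfold dotProduct; fun_prop
  have := Measure.isProbabilityMeasure_map (μ := stdGaussianVec d) hm.aemeasurable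
  apply Measure.ext_of_charFun
  ext t
  rw [charFun_apply_real, integral_map hm.aemeasurable (by fun_prop), charFun_gaussianReal]
  have : ∀ v : Fin d → ℝ, Complex.exp (t * (x ⬝ᵥ v : ℝ) * Complex.I)
      = ∏ j, Complex.exp ((t * x j : ℝ) * v j * Complex.I) := by
    intro v
    rw [← Complex.exp_sum]
    congr 1
    simp only [dotProduct, Complex.ofReal_sum, Complex.ofReal_mul, Finset.mul_sum, Finset.sum_mul]
    exact Finset.sum_congr rfl fun j _ => by ring
  simp_rw [this]
  unfold stdGaussianVec
  rw [integral_fintype_prod_eq_prod (f := fun j (y : ℝ) => Complex.exp ((t * x j : ℝ) * y * Complex.I))]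
  simp_rw [← charFun_apply_real, charFun_gaussianReal]
  rw [← Complex.exp_sum]
  congr 1
  have hx' : (∑ j, (x j : ℂ) * x j) = 1 := by
    have := congrArg Complex.ofReal hx
    simpa [dotProduct] using this
  push_cast
  simp only [mul_zero, zero_mul, zero_sub]
  rw [Finset.sum_neg_distrib]
  congr 1
  calc _ = ((d:ℂ)⁻¹ * t^2/2) * (∑ j, (x j : ℂ) * x j) := by
        rw [Finset.mul_sum]; exact Finset.sum_congr rfl fun j _ => by ring
    _ = _ := by rw [hx']; ring

lemma integral_abs_gaussian (v : NNReal) (hv : v ≠ 0) :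
    ∫ x, |x| ∂(gaussianReal 0 v) = Real.sqrt (2 * v / Real.pi) := by
  rw [integral_gaussianReal_eq_integral_smul hv]
  have hv' : (0:ℝ) < v := by positivity
  have h1 : ∀ x : ℝ, gaussianPDFReal 0 v x • |x|
      = (fun y => (Real.sqrt (2 * Real.pi * v))⁻¹ * (y ^ (1:ℝ) * Real.exp (-(2*v:ℝ)⁻¹ * y^(2:ℝ)))) |x| := by
    intro x
    simp only [gaussianPDFReal, smul_eq_mul, Real.rpow_one, Real.rpow_two, sq_abs, sub_zero]
    rw [show -x^2 / (2 * (v:ℝ)) = -(2*v:ℝ)⁻¹ * x^2 by field_simp]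
    ring
  simp_rw [h1]
  rw [integral_comp_abs (f := fun y : ℝ => (Real.sqrt (2 * Real.pi * v))⁻¹ *
    (y ^ (1:ℝ) * Real.exp (-(2*v:ℝ)⁻¹ * y^(2:ℝ)))), integral_const_mul, integral_rpow_mul_exp_neg_mul_rpow (by norm_num) (by norm_num) (by positivity)]
  norm_num
  rw [Real.rpow_neg_one]
  have ev : Real.sqrt v * Real.sqrt v = v := Real.mul_self_sqrt hv'.le
  have e2 : Real.sqrt 2 * Real.sqrt 2 = 2 := Real.mul_self_sqrt (by norm_num)
  have hs2 : 0 < Real.sqrt v := Real.sqrt_pos.2 hv'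
  have hs3 : 0 < Real.sqrt Real.pi := Real.sqrt_pos.2 Real.pi_pos
  field_simp
  nlinarith

lemma integral_sq_gaussian (v : NNReal) :
    ∫ x, x^2 ∂(gaussianReal 0 v) = v := by
  have h := variance_fun_id_gaussianReal (μ := 0) (v := v)
  rw [variance_of_integral_eq_zero (by fun_prop) (by simp)] at h
  simpa using h

lemma exp_neg_le (u : ℝ) (hu : 0 ≤ u) : Real.exp (-u) ≤ 1 - u + u^2/2 := by
  have h : (1 + u + u^2/2) ≤ Real.exp u := Real.quadratic_le_exp_of_nonneg hu
  rw [Real.exp_neg]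
  have h0 : 0 < 1 + u + u^2/2 := by positivity
  calc (Real.exp u)⁻¹ ≤ (1 + u + u^2/2)⁻¹ := inv_anti₀ h0 h
    _ ≤ _ := by
      rw [inv_le_iff_one_le_mul₀ h0]
      nlinarith [sq_nonneg (u^2)]

lemma mgf_abs_lower (v : NNReal) (hv : v ≠ 0) (l : ℝ) (hl : 0 ≤ l) :
    Integrable (fun x => Real.exp (-(l * |x|))) (gaussianReal 0 v) ∧
    ∫ x, Real.exp (-(l * |x|)) ∂(gaussianReal 0 v) ≤
      Real.exp (-(l * Real.sqrt (2 * v / Real.pi)) + l^2 * v / 2) := by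
  have hI : Integrable (fun x => Real.exp (-(l * |x|))) (gaussianReal 0 v) := by
    refine Integrable.mono' (integrable_const (1:ℝ)) (by fun_prop) (Eventually.of_forall fun x => ?_)
    rw [Real.norm_eq_abs, abs_of_pos (Real.exp_pos _), Real.exp_le_one_iff]
    have := mul_nonneg hl (abs_nonneg x)
    linarith
  refine ⟨hI, ?_⟩
  have hM := memLp_id_gaussianReal (μ := 0) (v := v) 2
  have h2 : Integrable (fun x : ℝ => x^2) (gaussianReal 0 v) := hM.integrable_sq
  have h1 : Integrable (fun x : ℝ => |x|) (gaussianReal 0 v) :=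
    (hM.integrable (by norm_num)).abs
  calc _ ≤ ∫ x, (1 - l * |x| + l^2/2 * x^2) ∂(gaussianReal 0 v) := by
        refine integral_mono hI (((integrable_const _).sub (h1.const_mul l)).add (h2.const_mul _)) fun x => ?_
        have := exp_neg_le (l * |x|) (mul_nonneg hl (abs_nonneg x))
        rw [mul_pow, sq_abs] at this
        simp only
        linarith
    _ = 1 - l * Real.sqrt (2 * v / Real.pi) + l^2/2 * v := by
        have h3 : Integrable (fun x : ℝ => 1 - l * |x|) (gaussianReal 0 v) :=
          (integrable_const _).sub (h1.const_mul l)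
        rw [integral_add h3 (h2.const_mul _),
          integral_sub (integrable_const _) (h1.const_mul l), integral_const_mul, integral_const_mul,
          integral_abs_gaussian v hv, integral_sq_gaussian]
        simp
    _ ≤ _ := by
        have := Real.add_one_le_exp (-(l * Real.sqrt (2 * v / Real.pi)) + l^2 * v / 2)
        linarith

/-- crude exponential moment. -/
lemma mgf_abs_upper (v : NNReal) (l : ℝ) (hl : l^2 * v = 1) :
    Integrable (fun x => Real.exp (l * |x|)) (gaussianReal 0 v) ∧
    ∫ x, Real.exp (l * |x|) ∂(gaussianReal 0 v) ≤ Real.exp 2 := by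
  have hle : ∀ x : ℝ, Real.exp (l * |x|) ≤ Real.exp (l * x) + Real.exp (-l * x) := by
    intro x
    rcases abs_cases x with h | h <;> rw [h.1]
    · linarith [Real.exp_pos (-l*x)]
    · rw [show l * -x = -l*x by ring]; linarith [Real.exp_pos (l*x)]
  have hi := fun t => integrable_exp_mul_gaussianReal (μ := 0) (v := v) t
  have hI : Integrable (fun x => Real.exp (l * |x|)) (gaussianReal 0 v) := by
    refine Integrable.mono' ((hi l).add (hi (-l))) (by fun_prop) (Eventually.of_forall fun x => ?_)
    rw [Real.norm_eq_abs, abs_of_pos (Real.exp_pos _)]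
    exact hle x
  refine ⟨hI, (integral_mono hI ((hi l).add (hi (-l))) hle).trans ?_⟩
  have hm : ∀ t, ∫ x, Real.exp (t * x) ∂(gaussianReal 0 v) = Real.exp (v * t^2/2) := by
    intro t
    have := mgf_gaussianReal (p := gaussianReal 0 v) (X := id) (μ := 0) (v := v) (by simp) t
    simpa [mgf] using this
  change ∫ x, (Real.exp (l * x) + Real.exp (-l * x)) ∂(gaussianReal 0 v) ≤ _
  rw [integral_add (hi l) (hi (-l)), hm, hm, neg_sq, mul_comm (v:ℝ), hl]
  have h1 : Real.exp 2 = Real.exp (1/2) * Real.exp (3/2) := by rw [← Real.exp_add]; norm_num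
  have h2 := Real.add_one_le_exp (3/2 : ℝ)
  have h3 := Real.exp_pos (1/2 : ℝ)
  rw [h1]
  nlinarith

lemma net (d N : ℕ) (hN : 0 < N) : ∃ T : Finset (Fin d → ℝ), T.card ≤ (2 * N + 1)^d ∧
    (∀ y ∈ T, y ⬝ᵥ y = 1) ∧ ∀ x : Fin d → ℝ, x ⬝ᵥ x = 1 → ∃ y ∈ T, ∀ j, |x j - y j| ≤ 1 / N := by
  classical
  let S : Set (Fin d → ℝ) := {x | x ⬝ᵥ x = 1}
  let f : (Fin d → ℝ) → (Fin d → ℤ) := fun x j => ⌊(N:ℝ) * x j⌋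
  let K : Finset (Fin d → ℤ) := Fintype.piFinset fun _ => Finset.Icc (-(N:ℤ)) N
  have hNr : (0:ℝ) < N := by exact_mod_cast hN
  have hK : ∀ x ∈ S, f x ∈ K := by
    intro x hx
    rw [Fintype.mem_piFinset]
    intro j
    have hx1 : x j ^ 2 ≤ 1 := by
      have : x ⬝ᵥ x = 1 := hx
      rw [← this, dotProduct, sq]
      exact Finset.single_le_sum (f := fun j => x j * x j) (fun i _ => mul_self_nonneg _) (Finset.mem_univ j)
    have hx2 := abs_le.1 ((sq_le_one_iff_abs_le_one _).1 hx1)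
    rw [Finset.mem_Icc]
    constructor
    · apply Int.le_floor.2
      push_cast
      nlinarith
    · have : (⌊(N:ℝ) * x j⌋ : ℝ) ≤ N := (Int.floor_le _).trans (by nlinarith)
      exact_mod_cast this
  refine ⟨(K.filter fun k => k ∈ f '' S).image (Function.invFunOn f S), ?_, ?_, ?_⟩
  · refine Finset.card_image_le.trans ((Finset.card_filter_le _ _).trans ?_)
    simp only [K, Fintype.card_piFinset, Int.card_Icc, Finset.prod_const, Finset.card_univ, Fintype.card_fin]
    apply le_of_eq
    congr 1
    omega
  · intro y hy
    obtain ⟨k, hk, rfl⟩ := Finset.mem_image.1 hy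
    exact Function.invFunOn_mem (Finset.mem_filter.1 hk).2
  · intro x hx
    have hm : f x ∈ f '' S := ⟨x, hx, rfl⟩
    refine ⟨Function.invFunOn f S (f x), Finset.mem_image.2 ⟨f x, Finset.mem_filter.2 ⟨hK x hx, hm⟩, rfl⟩, ?_⟩
    intro j
    have h := congrFun (Function.invFunOn_eq hm) j
    set y := Function.invFunOn f S (f x)
    have h' := Int.abs_sub_lt_one_of_floor_eq_floor h
    rw [← mul_sub, abs_mul, abs_of_pos hNr, abs_sub_comm] at h'
    rw [le_div_iff₀ hNr]
    linarith


lemma bad_point (d n : ℕ) (hd : 0 < d) (y : Fin d → ℝ) (hy : y ⬝ᵥ y = 1) (t : ℝ) (ht : 0 ≤ t) :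
    (vModel d n).real {v | Real.sqrt d * ∑ i, |y ⬝ᵥ v i| ≤ n * (Real.sqrt (2 / Real.pi) - t)}
      ≤ Real.exp (-(n * t^2 / 2)) := by
  have hm : Measurable (fun v : Fin d → ℝ => y ⬝ᵥ v) := by unfold dotProduct; fun_prop
  have hdr : (0:ℝ) < d := by exact_mod_cast hd
  have hv : ((d : NNReal)⁻¹) ≠ 0 := by positivity
  obtain ⟨hI, hle⟩ := mgf_abs_lower _ hv (t * Real.sqrt d) (by positivity)
  rw [← map_dot_s5 d y hy] at hI hle
  rw [integral_map hm.aemeasurable (by fun_prop)] at hle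
  have hI' := hI.comp_measurable hm
  have h := chernoff_pi (stdGaussianVec d) (fun w => -(t * Real.sqrt d * |y ⬝ᵥ w|)) _ hI' hle n
    (-(t * (n * (Real.sqrt (2 / Real.pi) - t))))
  have hsd : Real.sqrt d ^ 2 = d := Real.sq_sqrt hdr.le
  have e1 : Real.sqrt d * Real.sqrt (2 * ((d : NNReal)⁻¹ : NNReal) / Real.pi) = Real.sqrt (2 / Real.pi) := by
    rw [← Real.sqrt_mul hdr.le]
    congr 1
    push_cast
    field_simp
  refine (measureReal_mono ?_).trans (h.trans (le_of_eq ?_))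
  · intro v hv
    simp only [Set.mem_ofPred_eq] at hv ⊢
    rw [Finset.sum_neg_distrib, ← Finset.mul_sum, neg_le_neg_iff, mul_assoc]
    exact mul_le_mul_of_nonneg_left hv ht
  · congr 1
    rw [mul_assoc t, e1, mul_pow, hsd]
    push_cast
    field_simp
    ring

lemma bad_norm (d n : ℕ) (hd : 0 < d) :
    (vModel d n).real {v | 3 * (n * d : ℝ) ≤ ∑ i, Real.sqrt d * ∑ j, |v i j|}
      ≤ Real.exp (-(n * d)) := by
  have hdr : (0:ℝ) < d := by exact_mod_cast hd
  obtain ⟨hI, hle⟩ := mgf_abs_upper ((d : NNReal)⁻¹) (Real.sqrt d)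
    (by rw [Real.sq_sqrt hdr.le]; push_cast; field_simp)
  have hE : ∀ w : Fin d → ℝ, Real.exp (Real.sqrt d * ∑ j, |w j|) = ∏ j, Real.exp (Real.sqrt d * |w j|) := by
    intro w
    rw [← Real.exp_sum, Finset.mul_sum]
  have hI' : Integrable (fun w : Fin d → ℝ => Real.exp (Real.sqrt d * ∑ j, |w j|)) (stdGaussianVec d) := by
    simp_rw [hE]
    exact Integrable.fintype_prod (f := fun _ x => Real.exp (Real.sqrt d * |x|)) (fun _ => hI)
  have hle' : ∫ w : Fin d → ℝ, Real.exp (Real.sqrt d * ∑ j, |w j|) ∂(stdGaussianVec d)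
      ≤ Real.exp (d * 2) := by
    simp_rw [hE]
    unfold stdGaussianVec
    rw [integral_fintype_prod_eq_pow (f := fun x : ℝ => Real.exp (Real.sqrt d * |x|)),
      Fintype.card_fin, Real.exp_nat_mul]
    exact pow_le_pow_left₀ (integral_nonneg fun x => (Real.exp_pos _).le) hle d
  have h := chernoff_pi (stdGaussianVec d) (fun w => Real.sqrt d * ∑ j, |w j|) _ hI' hle' n
    (3 * (n * d : ℝ))
  refine h.trans (le_of_eq ?_)
  congr 1
  ring

lemma good_event (d n : ℕ) (hd : 0 < d) (hn : 0 < n) (t : ℝ) (ht : 0 ≤ t) (htd : 3 / d ≤ t)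
    (v : Fin n → Fin d → ℝ) (T : Finset (Fin d → ℝ))
    (hT : ∀ x : Fin d → ℝ, x ⬝ᵥ x = 1 → ∃ y ∈ T, ∀ j, |x j - y j| ≤ 1 / ((d^2 : ℕ) : ℝ))
    (h1 : ∀ y ∈ T, n * (Real.sqrt (2 / Real.pi) - t) < Real.sqrt d * ∑ i, |y ⬝ᵥ v i|)
    (h2 : ∑ i, Real.sqrt d * ∑ j, |v i j| < 3 * (n * d : ℝ))
    (x : Fin d → ℝ) (hx : x ⬝ᵥ x = 1) :
    (Real.sqrt (2 / Real.pi) - 2 * t) / Real.sqrt d ≤ (n : ℝ)⁻¹ * ∑ i, |x ⬝ᵥ v i| := by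
  have hdr : (0:ℝ) < d := by exact_mod_cast hd
  have hnr : (0:ℝ) < n := by exact_mod_cast hn
  have hsd : 0 < Real.sqrt d := Real.sqrt_pos.2 hdr
  obtain ⟨y, hy, hxy⟩ := hT x hx
  have h3 := h1 y hy
  have h4 : ∀ i, |y ⬝ᵥ v i| ≤ |x ⬝ᵥ v i| + 1 / (d:ℝ)^2 * ∑ j, |v i j| := by
    intro i
    have e : y ⬝ᵥ v i = x ⬝ᵥ v i - (x - y) ⬝ᵥ v i := by rw [sub_dotProduct]; ring
    have e2 : |(x - y) ⬝ᵥ v i| ≤ 1 / (d:ℝ)^2 * ∑ j, |v i j| := by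
      rw [dotProduct, Finset.mul_sum]
      refine (Finset.abs_sum_le_sum_abs _ _).trans (Finset.sum_le_sum fun j _ => ?_)
      rw [abs_mul]
      refine mul_le_mul_of_nonneg_right ?_ (abs_nonneg _)
      simpa using hxy j
    rw [e]
    exact (abs_sub _ _).trans (by linarith)
  have h5 : Real.sqrt d * ∑ i, |y ⬝ᵥ v i| ≤ Real.sqrt d * ∑ i, |x ⬝ᵥ v i|
      + 1 / (d:ℝ)^2 * ∑ i, Real.sqrt d * ∑ j, |v i j| := by
    rw [Finset.mul_sum, Finset.mul_sum, Finset.mul_sum, ← Finset.sum_add_distrib]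
    refine Finset.sum_le_sum fun i _ => ?_
    have := mul_le_mul_of_nonneg_left (h4 i) hsd.le
    linarith
  have h6 : 1 / (d:ℝ)^2 * ∑ i, Real.sqrt d * ∑ j, |v i j| ≤ n * t := by
    calc _ ≤ 1 / (d:ℝ)^2 * (3 * (n * d : ℝ)) := mul_le_mul_of_nonneg_left h2.le (by positivity)
      _ = n * (3 / d) := by field_simp
      _ ≤ _ := mul_le_mul_of_nonneg_left htd hnr.le
  rw [div_le_iff₀ hsd, inv_mul_eq_div, div_mul_eq_mul_div, le_div_iff₀ hnr]
  linarith

lemma prob_bound (d n : ℕ) (hd : 0 < d) (hn : 0 < n) (t : ℝ) (ht : 0 ≤ t) (htd : 3 / d ≤ t) :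
    ENNReal.ofReal (1 - ((2 * (d:ℝ)^2 + 1)^d * Real.exp (-(n * t^2 / 2)) + Real.exp (-(n*d)))) ≤
        vModel d n {v | ∀ x : Fin d → ℝ, x ⬝ᵥ x = 1 →
          (Real.sqrt (2 / Real.pi) - 2 * t) / Real.sqrt d ≤ (n : ℝ)⁻¹ * ∑ i, |x ⬝ᵥ v i|} := by
  obtain ⟨T, hTc, hTs, hT⟩ := net d (d^2) (by positivity)
  let B : Set (Fin n → Fin d → ℝ) := (⋃ y ∈ T, {v | Real.sqrt d * ∑ i, |y ⬝ᵥ v i| ≤ n * (Real.sqrt (2 / Real.pi) - t)})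
    ∪ {v | 3 * (n * d : ℝ) ≤ ∑ i, Real.sqrt d * ∑ j, |v i j|}
  have hB : MeasurableSet B := by
    refine MeasurableSet.union (Finset.measurableSet_biUnion _ fun y _ => ?_) ?_
    · unfold dotProduct
      exact measurableSet_le (by fun_prop) (by fun_prop)
    · exact measurableSet_le (by fun_prop) (by fun_prop)
  have hPB : (vModel d n).real B ≤ (2 * (d:ℝ)^2 + 1)^d * Real.exp (-(n * t^2 / 2)) + Real.exp (-(n*d)) := by
    refine (measureReal_union_le _ _).trans (add_le_add ?_ (bad_norm d n hd))
    refine (measureReal_biUnion_finset_le _ _).trans ?_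
    refine (Finset.sum_le_card_nsmul _ _ _ fun y hy => bad_point d n hd y (hTs y hy) t ht).trans ?_
    rw [nsmul_eq_mul]
    refine mul_le_mul_of_nonneg_right ?_ (Real.exp_pos _).le
    exact_mod_cast hTc
  have hsub : Bᶜ ⊆ {v | ∀ x : Fin d → ℝ, x ⬝ᵥ x = 1 →
          (Real.sqrt (2 / Real.pi) - 2 * t) / Real.sqrt d ≤ (n : ℝ)⁻¹ * ∑ i, |x ⬝ᵥ v i|} := by
    intro v hv x hx
    simp only [B, Set.mem_compl_iff, Set.mem_union, Set.mem_iUnion, Set.mem_ofPred_eq, not_or,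
      not_exists, not_le] at hv
    exact good_event d n hd hn t ht htd v T hT hv.1 hv.2 x hx
  refine le_trans ?_ (measure_mono hsub)
  rw [← ofReal_measureReal, probReal_compl_eq_one_sub hB]
  exact ENNReal.ofReal_le_ofReal (by linarith)

/-- **Uniform ℓ¹ lower bound over the sphere.** For every `ε ∈ (0,2)` and `c₀ > 0` there
is `c > 0` such that for all large `d`: if `n ≥ c₀ d²/log d` and `v_i` are i.i.d.
`N(0, I_d/d)`, then with probability at least `1 - e^{-c d}`, for every unit vector `x`,
`(1/n) Σ_i |x^⊤ v_i| ≥ √((2-ε)/(π d))`. -/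
theorem sphere_l1_lower_bound (ε : ℝ) (hε0 : 0 < ε) (hε2 : ε < 2)
    (c₀ : ℝ) (hc₀ : 0 < c₀) :
    ∃ c : ℝ, 0 < c ∧ ∃ d₀ : ℕ, ∀ d : ℕ, d₀ ≤ d → ∀ n : ℕ,
      c₀ * (d : ℝ) ^ 2 / Real.log d ≤ (n : ℝ) →
      ENNReal.ofReal (1 - Real.exp (-c * d)) ≤
        vModel d n {v | ∀ x : Fin d → ℝ, x ⬝ᵥ x = 1 →
          Real.sqrt ((2 - ε) / (Real.pi * d)) ≤ (n : ℝ)⁻¹ * ∑ i, |x ⬝ᵥ v i|} := by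
  have hpi := Real.pi_pos
  obtain ⟨t, htdef⟩ : ∃ t, t = (Real.sqrt (2 / Real.pi) - Real.sqrt ((2 - ε) / Real.pi)) / 2 := ⟨_, rfl⟩
  have ht : 0 < t := by
    have : Real.sqrt ((2 - ε) / Real.pi) < Real.sqrt (2 / Real.pi) := by
      apply Real.sqrt_lt_sqrt (div_nonneg (by linarith) hpi.le)
      gcongr
      linarith
    rw [htdef]; linarith
  have hlog : ∀ᶠ d : ℕ in atTop, Real.log d ^ 2 ≤ (min (c₀ / 2) (c₀ * t^2 / 10)) * d := by
    have h := (Real.isLittleO_pow_log_id_atTop (n := 2)).bound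
      (c := min (c₀ / 2) (c₀ * t^2 / 10)) (by positivity)
    filter_upwards [tendsto_natCast_atTop_atTop (R := ℝ) |>.eventually h] with d hd
    simpa using hd
  have hbig : ∀ᶠ d : ℕ in atTop, max 3 (3 / t) ≤ (d:ℝ) :=
    tendsto_natCast_atTop_atTop.eventually (eventually_ge_atTop _)
  obtain ⟨d₀, hd₀⟩ := eventually_atTop.1 (hlog.and hbig)
  refine ⟨1, one_pos, d₀, fun d hd n hn => ?_⟩
  obtain ⟨hL, hb⟩ := hd₀ d hd
  have hd3 : (3:ℝ) ≤ d := (le_max_left _ _).trans hb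
  have hdt : 3 / t ≤ (d:ℝ) := (le_max_right _ _).trans hb
  have hdr : (0:ℝ) < d := by linarith
  have hdn : 0 < d := by exact_mod_cast hdr
  have hlog1 : 1 ≤ Real.log d := by
    rw [Real.le_log_iff_exp_le hdr]
    linarith [Real.exp_one_lt_d9]
  have hlp : 0 < Real.log d := by linarith
  have hL1 : Real.log d ^ 2 ≤ c₀ / 2 * d := hL.trans (mul_le_mul_of_nonneg_right (min_le_left _ _) hdr.le)
  have hL2 : Real.log d ^ 2 ≤ c₀ * t^2 / 10 * d := hL.trans (mul_le_mul_of_nonneg_right (min_le_right _ _) hdr.le)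
  have hn' := (div_le_iff₀ hlp).1 hn
  have hn2 : (2:ℝ) ≤ n := by
    have : 2 * Real.log d ≤ n * Real.log d := by nlinarith
    exact le_of_mul_le_mul_right this hlp
  have hnt : 5 * d * Real.log d ≤ n * t^2 / 2 := by
    have : 5 * d * Real.log d * Real.log d ≤ n * t^2 / 2 * Real.log d := by
      have a1 := mul_le_mul_of_nonneg_left hL2 (by positivity : 0 ≤ 5 * (d:ℝ))
      have a2 := mul_le_mul_of_nonneg_left hn' (by positivity : 0 ≤ t^2/2)
      nlinarith
    exact le_of_mul_le_mul_right this hlp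
  have hn0 : 0 < n := by
    have : (0:ℝ) < n := by linarith
    exact_mod_cast this
  have htd : 3 / (d:ℝ) ≤ t := by
    rw [div_le_iff₀ ht] at hdt
    rw [div_le_iff₀ hdr]; linarith
  have key := prob_bound d n hdn hn0 t ht.le htd
  have hthr : Real.sqrt ((2 - ε) / (Real.pi * d)) = (Real.sqrt (2 / Real.pi) - 2 * t) / Real.sqrt d := by
    rw [← div_div, Real.sqrt_div (div_nonneg (by linarith) hpi.le), htdef]
    congr 1
    ring
  rw [hthr]
  refine le_trans (ENNReal.ofReal_le_ofReal ?_) key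
  have hpow : (2 * (d:ℝ)^2 + 1)^d ≤ Real.exp (3 * d * Real.log d) := by
    have e : Real.exp (3 * d * Real.log d) = ((d:ℝ)^3)^d := by
      rw [show 3 * d * Real.log d = (d:ℝ) * ((3:ℕ) * Real.log d) by push_cast; ring,
        Real.exp_nat_mul, Real.exp_nat_mul, Real.exp_log hdr]
    rw [e]
    exact pow_le_pow_left₀ (by positivity) (by nlinarith) d
  have b1 : (2 * (d:ℝ)^2 + 1)^d * Real.exp (-(n * t^2 / 2)) ≤ Real.exp (-2 * d) := by
    refine (mul_le_mul_of_nonneg_right hpow (Real.exp_pos _).le).trans ?_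
    rw [← Real.exp_add, Real.exp_le_exp]
    nlinarith
  have b2 : Real.exp (-((n:ℝ)*d)) ≤ Real.exp (-2 * d) := by
    rw [Real.exp_le_exp]; nlinarith
  have b3 : 2 * Real.exp (-2 * d) ≤ Real.exp (-1 * d) := by
    have e : Real.exp (-1 * (d:ℝ)) = Real.exp d * Real.exp (-2 * d) := by
      rw [← Real.exp_add]; congr 1; ring
    rw [e]
    have := Real.add_one_le_exp (d:ℝ)
    exact mul_le_mul_of_nonneg_right (by linarith) (Real.exp_pos _).le
  linarith

end
end
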